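/- Let λ, μ ∈ ℝ with μ > 0 and 3λ + 2μ > 0, and let r₀, E₀ > 0, D₀ > 1. There exist constants b, c₁, c₂ > 0, depending only on λ, μ, r₀, E₀, D₀, such that for all C³ cavities C₁, C₂ with parameters r₀, E₀, D₀, every p > 0, all normalized solutions wᵢ of the cavity problem in Ωᵢ = ℝ³₋ \ C̄ᵢ (i = 1,2), and every η with 0 < η < c₁ p² satisfying ∫_{C₂ \ C̄₁} |∇̂w₁|² dx ≤ η and ∫_{C₁ \ C̄₂} |∇̂w₂|² dx ≤ η, the Hausdorff distance satisfies d_H(∂C₁, ∂C₂) ≤ c₂ (log(c₁ p²/η))^{−1/b}. -/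

import Mathlib

open MeasureTheory Metric Set

noncomputable section

abbrev E3 := EuclideanSpace ℝ (Fin 3)
abbrev E2 := EuclideanSpace ℝ (Fin 2)

/-- The open lower half-space `{x : x₃ < 0}`. -/
def lowerHalf : Set E3 := {x | x 2 < 0}

/-- The lower half-ball `B⁻_r(0) = {|x| < r, x₃ < 0}`. -/
def negBall (r : ℝ) : Set E3 := {x | ‖x‖ < r ∧ x 2 < 0}

/-- Jacobian matrix of a vector field: `(jac u x) i j = ∂uᵢ/∂xⱼ (x)`. -/
def jac (u : E3 → E3) (x : E3) : Matrix (Fin 3) (Fin 3) ℝ :=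
  fun i j => fderiv ℝ u x (EuclideanSpace.single j 1) i

/-- Symmetric part of the Jacobian (strain tensor) `∇̂u`. -/
def strain (u : E3 → E3) (x : E3) : Matrix (Fin 3) (Fin 3) ℝ :=
  fun i j => (jac u x i j + jac u x j i) / 2

/-- Squared Frobenius norm of a 3×3 matrix. -/
def frob2 (M : Matrix (Fin 3) (Fin 3) ℝ) : ℝ := ∑ i, ∑ j, (M i j)^2

/-- Divergence of a vector field. -/
def divg (u : E3 → E3) (x : E3) : ℝ := ∑ i, jac u x i i

/-- Projection on the first two coordinates. -/
def proj12 (x : E3) : E2 :=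
  (x 0) • EuclideanSpace.single 0 1 + (x 1) • EuclideanSpace.single 1 1

/-- Embedding of the plane `{x₃ = 0}` into `ℝ³`: `x' ↦ (x'₁, x'₂, 0)`. -/
def emb2 (x' : E2) : E3 :=
  (x' 0) • EuclideanSpace.single 0 1 + (x' 1) • EuclideanSpace.single 1 1

/-- Partial derivative of a scalar field in the k-th coordinate direction. -/
def pd (f : E3 → ℝ) (k : Fin 3) (x : E3) : ℝ := fderiv ℝ f x (EuclideanSpace.single k 1)

/-- `S` has boundary of Lipschitz class with constants r₀, E₀: at each boundary point `P`,
after a rigid change of coordinates sending `P` to `0`, the set is locally the open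
epigraph of a Lipschitz function `ψ` with `ψ 0 = 0` and Lipschitz constant at most `E₀`. -/
def HasLipschitzBoundary (r₀ E₀ : ℝ) (S : Set E3) : Prop :=
  ∀ P ∈ frontier S, ∃ (φ : E3 ≃ᵢ E3) (ψ : E2 → ℝ),
    φ P = 0 ∧ ψ 0 = 0 ∧ LipschitzOnWith (Real.toNNReal E₀) ψ (Metric.ball 0 r₀) ∧
    (φ '' S) ∩ Metric.ball 0 r₀ = {x ∈ Metric.ball (0 : E3) r₀ | ψ (proj12 x) < x 2}

/-- `S` has boundary of class C³ with constants r₀, E₀. -/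
def HasC3Boundary (r₀ E₀ : ℝ) (S : Set E3) : Prop :=
  ∀ P ∈ frontier S, ∃ (φ : E3 ≃ᵢ E3) (ψ : E2 → ℝ),
    φ P = 0 ∧ ψ 0 = 0 ∧ ContDiff ℝ 3 ψ ∧ fderiv ℝ ψ 0 = 0 ∧
    (∀ x' ∈ Metric.ball (0 : E2) r₀, ∀ k : ℕ, k ≤ 3 → ‖iteratedFDeriv ℝ k ψ x'‖ ≤ E₀) ∧
    (φ '' S) ∩ Metric.ball 0 r₀ = {x ∈ Metric.ball (0 : E3) r₀ | ψ (proj12 x) < x 2}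

/-- Geometric a priori assumptions on a cavity: bounded open set, closure inside the lower
half-space, connected complement in the half-space, contained in `B⁻_{2D₀}(0)`, at distance
at least `D₀` from the plane `{x₃ = 0}`, with diameter less than `D₀`. -/
def IsCavity (D₀ : ℝ) (C : Set E3) : Prop :=
  IsOpen C ∧ Bornology.IsBounded C ∧ closure C ⊆ lowerHalf ∧
  IsConnected (lowerHalf \ closure C) ∧ C ⊆ negBall (2*D₀) ∧
  (∀ x ∈ C, x 2 ≤ -D₀) ∧ Metric.diam C < D₀

/-- Lipschitz cavity with parameters r₀, E₀, D₀. -/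
def IsLipschitzCavity (r₀ E₀ D₀ : ℝ) (C : Set E3) : Prop :=
  IsCavity D₀ C ∧ HasLipschitzBoundary r₀ E₀ C

/-- C³ cavity with parameters r₀, E₀, D₀. -/
def IsC3Cavity (r₀ E₀ D₀ : ℝ) (C : Set E3) : Prop :=
  IsCavity D₀ C ∧ HasC3Boundary r₀ E₀ C

/-- Normalized solution `w = u − ū` of the cavity problem (with `ū(x) = (p/(3λ+2μ)) x`):
`w` is continuous up to the boundary plane, C¹ on `Ω = ℝ³₋ \ C̄`, `w + ū` lies in the
weighted class, and `w` satisfies the variational identity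
`∫_Ω ℂ∇̂w : ∇̂v = −p ∫_{ℝ²} v₃(x₁,x₂,0) dx₁dx₂` for all smooth compactly supported `v`. -/
def IsNormalizedSolution (lam mu p : ℝ) (C : Set E3) (w : E3 → E3) : Prop :=
  ContinuousOn w ({x : E3 | x 2 ≤ 0} \ closure C) ∧
  ContDiffOn ℝ 1 w (lowerHalf \ closure C) ∧
  IntegrableOn (fun x => ‖w x + (p / (3*lam+2*mu)) • x‖^2 / (1 + ‖x‖^2)) (lowerHalf \ closure C) ∧
  IntegrableOn
    (fun x => frob2 (fun i j => jac w x i j + (p/(3*lam+2*mu)) * (if i = j then 1 else 0)))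
    (lowerHalf \ closure C) ∧
  ∀ v : E3 → E3, ContDiff ℝ (⊤ : ℕ∞) v → HasCompactSupport v →
    ∫ x in lowerHalf \ closure C,
        (lam * divg w x * divg v x + 2 * mu * ∑ i, ∑ j, strain w x i j * strain v x i j)
      = -p * ∫ x' : E2, v (emb2 x') 2


end

open MeasureTheory Metric Set
noncomputable section
open scoped ContDiff Topology
open Filter

/-- basis vector -/
abbrev eb (k : Fin 3) : E3 := EuclideanSpace.single k (1 : ℝ)

/-- Laplacian -/
def lapl (f : E3 → ℝ) (x : E3) : ℝ := ∑ k, pd (pd f k) k x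

lemma pd_smooth {f : E3 → ℝ} (hf : ContDiff ℝ ∞ f) (k : Fin 3) : ContDiff ℝ ∞ (pd f k) := by
  unfold pd
  exact (hf.fderiv_right (m := ∞) (by simp)).clm_apply contDiff_const

lemma pd_diff {f : E3 → ℝ} (hf : ContDiff ℝ ∞ f) (x : E3) : DifferentiableAt ℝ f x :=
  hf.contDiffAt.differentiableAt (by simp)

lemma pd_comm {f : E3 → ℝ} (hf : ContDiff ℝ ∞ f) (i j : Fin 3) (x : E3) :
    pd (pd f i) j x = pd (pd f j) i x := by
  have hs : IsSymmSndFDerivAt ℝ f x :=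
    (hf.contDiffAt (x := x)).isSymmSndFDerivAt
      (by simp only [minSmoothness_of_isRCLikeNormedField]; exact WithTop.coe_le_coe.2 le_top)
  have hd : DifferentiableAt ℝ (fderiv ℝ f) x :=
    (hf.fderiv_right (m := ∞) (by simp)).contDiffAt.differentiableAt (by simp)
  have key : ∀ a b : Fin 3, pd (pd f a) b x = fderiv ℝ (fderiv ℝ f) x (eb b) (eb a) := by
    intro a b
    unfold pd
    rw [fderiv_clm_apply hd (by fun_prop)]
    simp
  rw [key, key]; exact hs _ _

lemma pd_add {f g : E3 → ℝ} {x : E3} (hf : DifferentiableAt ℝ f x) (hg : DifferentiableAt ℝ g x)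
    (k : Fin 3) : pd (fun y => f y + g y) k x = pd f k x + pd g k x := by
  unfold pd; rw [fderiv_fun_add hf hg]; rfl

lemma pd_sub {f g : E3 → ℝ} {x : E3} (hf : DifferentiableAt ℝ f x) (hg : DifferentiableAt ℝ g x)
    (k : Fin 3) : pd (fun y => f y - g y) k x = pd f k x - pd g k x := by
  unfold pd; rw [fderiv_fun_sub hf hg]; rfl

lemma pd_const_mul {f : E3 → ℝ} {x : E3} (hf : DifferentiableAt ℝ f x) (c : ℝ)
    (k : Fin 3) : pd (fun y => c * f y) k x = c * pd f k x := by
  unfold pd; rw [fderiv_const_mul hf]; rfl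

lemma pd_mul {f g : E3 → ℝ} {x : E3} (hf : DifferentiableAt ℝ f x) (hg : DifferentiableAt ℝ g x)
    (k : Fin 3) : pd (fun y => f y * g y) k x = pd f k x * g x + f x * pd g k x := by
  unfold pd; rw [fderiv_fun_mul hf hg]
  simp; ring

lemma pd_sum {ι : Type*} (s : Finset ι) {f : ι → E3 → ℝ} {x : E3}
    (hf : ∀ i ∈ s, DifferentiableAt ℝ (f i) x)
    (k : Fin 3) : pd (fun y => ∑ i ∈ s, f i y) k x = ∑ i ∈ s, pd (f i) k x := by
  unfold pd; rw [fderiv_fun_sum hf]; simp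

lemma pd_tsupport (f : E3 → ℝ) (k : Fin 3) : tsupport (pd f k) ⊆ tsupport f :=
  tsupport_fderiv_apply_subset ℝ _

lemma pd_compact {f : E3 → ℝ} (hf : HasCompactSupport f) (k : Fin 3) :
    HasCompactSupport (pd f k) := hf.fderiv_apply ℝ _

lemma lapl_smooth {f : E3 → ℝ} (hf : ContDiff ℝ ∞ f) : ContDiff ℝ ∞ (lapl f) := by
  unfold lapl
  exact ContDiff.sum fun k _ => pd_smooth (pd_smooth hf k) k

lemma lapl_tsupport (f : E3 → ℝ) : tsupport (lapl f) ⊆ tsupport f := by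
  apply closure_minimal _ (isClosed_tsupport f)
  intro x hx
  by_contra h
  apply hx
  unfold lapl
  apply Finset.sum_eq_zero
  intro k _
  by_contra h2
  exact h (pd_tsupport f k (pd_tsupport _ k (subset_tsupport _ h2)))

lemma lapl_compact {f : E3 → ℝ} (hf : HasCompactSupport f) :
    HasCompactSupport (lapl f) := by
  exact hf.of_isClosed_subset (isClosed_tsupport _) (lapl_tsupport f)

/-- continuity of products on an open set with compactly supported factor -/
lemma cont_mul_of_tsupport {U : Set E3} (hU : IsOpen U) {h φ : E3 → ℝ} (hh : ContinuousOn h U)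
    (hφ : Continuous φ) (hs : tsupport φ ⊆ U) : Continuous (fun x => h x * φ x) := by
  rw [continuous_iff_continuousAt]
  intro x
  by_cases hx : x ∈ tsupport φ
  · exact (hh.continuousAt (hU.mem_nhds (hs hx))).mul hφ.continuousAt
  · have : (fun x => h x * φ x) =ᶠ[𝓝 x] fun _ => 0 := by
      filter_upwards [(isClosed_tsupport φ).isOpen_compl.mem_nhds hx] with y hy
      rw [image_eq_zero_of_notMem_tsupport hy, mul_zero]
    exact this.continuousAt

lemma integrable_mul_of_tsupport {U : Set E3} (hU : IsOpen U) {h φ : E3 → ℝ}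
    (hh : ContinuousOn h U)
    (hφ : Continuous φ) (hc : HasCompactSupport φ) (hs : tsupport φ ⊆ U) :
    Integrable (fun x => h x * φ x) :=
  (cont_mul_of_tsupport hU hh hφ hs).integrable_of_hasCompactSupport hc.mul_left

lemma pd_contOn {U : Set E3} (hU : IsOpen U) {h : E3 → ℝ} (hh : ContDiffOn ℝ 1 h U) (k : Fin 3) :
    ContinuousOn (pd h k) U := by
  unfold pd
  exact (hh.continuousOn_fderiv_of_isOpen hU le_rfl).clm_apply continuousOn_const

/-- integration by parts -/
lemma ibp {U : Set E3} (hU : IsOpen U) {h φ : E3 → ℝ} (hh : ContDiffOn ℝ 1 h U)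
    (hφ : ContDiff ℝ ∞ φ) (hc : HasCompactSupport φ) (hs : tsupport φ ⊆ U) (k : Fin 3) :
    ∫ x, h x * pd φ k x = - ∫ x, pd h k x * φ x := by
  apply integral_mul_fderiv_eq_neg_fderiv_mul_of_integrable (v := eb k)
  · exact integrable_mul_of_tsupport hU (pd_contOn hU hh k) hφ.continuous hc hs
  · exact integrable_mul_of_tsupport hU hh.continuousOn (pd_smooth hφ k).continuous
      (pd_compact hc k) ((pd_tsupport φ k).trans hs)
  · exact integrable_mul_of_tsupport hU hh.continuousOn hφ.continuous hc hs
  · intro x hx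
    exact (hh.contDiffAt (hU.mem_nhds (hs hx))).differentiableAt (by simp)
  · intro x _; exact pd_diff hφ x

lemma integral_pd_zero {φ : E3 → ℝ} (hφ : ContDiff ℝ ∞ φ) (hc : HasCompactSupport φ) (k : Fin 3) :
    ∫ x, pd φ k x = 0 := by
  have := ibp isOpen_univ (h := fun _ => 1) contDiffOn_const hφ hc (subset_univ _) k
  simpa [pd] using this

/-- integrals restricted to a set containing the support -/
lemma setInt_eq {U : Set E3} {F : E3 → ℝ} (h : ∀ x, x ∉ U → F x = 0) :
    ∫ x in U, F x = ∫ x, F x := by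
  exact setIntegral_eq_integral_of_forall_compl_eq_zero h
end

open MeasureTheory Metric Set
noncomputable section
open scoped ContDiff Topology
open Filter

/-- radial Laplacian in the variable `q = |x|^2` -/
def rA (g : ℝ → ℝ) (q : ℝ) : ℝ := 6 * deriv g q + 4 * q * deriv (deriv g) q

lemma rA_smooth {g : ℝ → ℝ} (hg : ContDiff ℝ ∞ g) : ContDiff ℝ ∞ (rA g) := by
  have h1 : ContDiff ℝ ∞ (deriv g) := (contDiff_infty_iff_deriv.1 hg).2
  have h2 : ContDiff ℝ ∞ (deriv (deriv g)) := (contDiff_infty_iff_deriv.1 h1).2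
  unfold rA
  fun_prop

lemma pd_rad {g : ℝ → ℝ} (hg : ContDiff ℝ ∞ g) (k : Fin 3) (x : E3) :
    pd (fun y : E3 => g (‖y‖ ^ 2)) k x = 2 * x k * deriv g (‖x‖ ^ 2) := by
  have h1 : HasFDerivAt (fun y : E3 => ‖y‖ ^ 2) (2 • (innerSL ℝ x)) x :=
    (hasStrictFDerivAt_norm_sq x).hasFDerivAt
  have h2 : HasDerivAt g (deriv g (‖x‖ ^ 2)) (‖x‖ ^ 2) :=
    (hg.contDiffAt.differentiableAt (by simp)).hasDerivAt
  have h3 := h2.comp_hasFDerivAt x h1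
  unfold pd
  erw [h3.fderiv]
  simp [EuclideanSpace.inner_single_right]
  ring

lemma pd_coord (k j : Fin 3) (x : E3) : pd (fun y : E3 => y j) k x = if j = k then 1 else 0 := by
  have h : HasFDerivAt (fun y : E3 => y j) (EuclideanSpace.proj j : E3 →L[ℝ] ℝ) x :=
    (EuclideanSpace.proj j : E3 →L[ℝ] ℝ).hasFDerivAt
  unfold pd
  rw [h.fderiv]
  simp

lemma coord_diff (j : Fin 3) (x : E3) : DifferentiableAt ℝ (fun y : E3 => y j) x :=
  (EuclideanSpace.proj j : E3 →L[ℝ] ℝ).differentiableAt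

lemma lapl_rad {g : ℝ → ℝ} (hg : ContDiff ℝ ∞ g) :
    lapl (fun y : E3 => g (‖y‖ ^ 2)) = fun x => rA g (‖x‖ ^ 2) := by
  have h1 : ContDiff ℝ ∞ (deriv g) := (contDiff_infty_iff_deriv.1 hg).2
  funext x
  unfold lapl
  have hk : ∀ k, pd (fun y : E3 => g (‖y‖ ^ 2)) k = fun y => (2 * y k) * deriv g (‖y‖ ^ 2) :=
    fun k => funext fun y => pd_rad hg k y
  have hd : DifferentiableAt ℝ (fun y : E3 => deriv g (‖y‖ ^ 2)) x :=
    (h1.comp (contDiff_norm_sq ℝ)).contDiffAt.differentiableAt (by simp)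
  have : ∀ k : Fin 3, pd (pd (fun y : E3 => g (‖y‖ ^ 2)) k) k x
      = 2 * deriv g (‖x‖ ^ 2) + 4 * (x k) ^ 2 * deriv (deriv g) (‖x‖ ^ 2) := by
    intro k
    rw [hk, pd_mul ((coord_diff k x).const_mul 2) hd, pd_const_mul (coord_diff k x), pd_coord,
      pd_rad h1]
    simp; ring
  simp only [this]
  rw [Fin.sum_univ_three, rA, EuclideanSpace.norm_sq_eq, Fin.sum_univ_three]
  simp only [Real.norm_eq_abs, sq_abs]
  ring

/-- profile -/
def gp (q : ℝ) : ℝ := √q * Real.smoothTransition (4 * q - 1)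

lemma gp_smooth : ContDiff ℝ ∞ gp := by
  rw [contDiff_iff_contDiffAt]
  intro q
  by_cases hq : q < 1/4
  · have : gp =ᶠ[𝓝 q] fun _ => 0 := by
      filter_upwards [Iio_mem_nhds hq] with y hy
      simp only [gp]
      rw [Real.smoothTransition.zero_of_nonpos (by simp at hy; linarith), mul_zero]
    exact contDiffAt_const.congr_of_eventuallyEq this
  · unfold gp
    apply ContDiffAt.mul
    · exact Real.contDiffAt_sqrt (by intro h; rw [h] at hq; norm_num at hq)
    · exact Real.smoothTransition.contDiff.contDiffAt.comp q (by fun_prop)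

lemma gp_eq {q : ℝ} (hq : 1/2 ≤ q) : gp q = √q := by
  simp only [gp]
  rw [Real.smoothTransition.one_of_one_le (by linarith), mul_one]

lemma hasDeriv_inv_sqrt {q : ℝ} (hq : 0 < q) :
    HasDerivAt (fun q => (√q)⁻¹) (-((√q)⁻¹) ^ 3 / 2) q := by
  have h := (Real.hasDerivAt_sqrt hq.ne').inv (Real.sqrt_ne_zero'.2 hq)
  refine HasDerivAt.congr_deriv (f' := _) h ?_
  have : √q ≠ 0 := Real.sqrt_ne_zero'.2 hq
  field_simp

lemma rA_gp {q : ℝ} (hq : 1/2 < q) : rA gp q = 2 * (√q)⁻¹ ∧ deriv gp q = (√q)⁻¹ / 2 := by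
  have hd : ∀ q : ℝ, 1/2 < q → deriv gp q = (√q)⁻¹ / 2 := by
    intro q hq
    have : gp =ᶠ[𝓝 q] fun q => √q := by
      filter_upwards [Ioi_mem_nhds hq] with y hy using gp_eq (le_of_lt hy)
    rw [this.deriv_eq, (Real.hasDerivAt_sqrt (by linarith : q ≠ 0)).deriv]
    field_simp
  refine ⟨?_, hd q hq⟩
  have hdd : deriv (deriv gp) q = -((√q)⁻¹) ^ 3 / 4 := by
    have : deriv gp =ᶠ[𝓝 q] fun q => (√q)⁻¹ / 2 := by
      filter_upwards [Ioi_mem_nhds hq] with y hy using hd y hy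
    rw [this.deriv_eq, ((hasDeriv_inv_sqrt (by linarith)).div_const 2).deriv]
    ring
  have h0 : 0 < q := by linarith
  have hs : √q ≠ 0 := Real.sqrt_ne_zero'.2 h0
  have hq2 : q = √q ^ 2 := (Real.sq_sqrt h0.le).symm
  rw [rA, hd q hq, hdd]
  nth_rewrite 2 [hq2]
  field_simp
  norm_num

lemma deriv_rA_gp {q : ℝ} (hq : 1/2 < q) : deriv (rA gp) q = -((√q)⁻¹) ^ 3 := by
  have : rA gp =ᶠ[𝓝 q] fun q => 2 * (√q)⁻¹ := by
    filter_upwards [Ioi_mem_nhds hq] with y hy using (rA_gp hy).1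
  rw [this.deriv_eq, ((hasDeriv_inv_sqrt (by linarith)).const_mul 2).deriv]
  ring

lemma rA_rA_gp {q : ℝ} (hq : 1/2 < q) : rA (rA gp) q = 0 := by
  have h0 : 0 < q := by linarith
  have hdd : deriv (deriv (rA gp)) q = 3 / 2 * ((√q)⁻¹) ^ 5 := by
    have : deriv (rA gp) =ᶠ[𝓝 q] fun q => -((√q)⁻¹) ^ 3 := by
      filter_upwards [Ioi_mem_nhds hq] with y hy using deriv_rA_gp hy
    rw [this.deriv_eq, ((hasDeriv_inv_sqrt h0).fun_pow 3).fun_neg.deriv]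
    ring
  have hs : √q ≠ 0 := Real.sqrt_ne_zero'.2 h0
  have hq2 : q = √q ^ 2 := (Real.sq_sqrt h0.le).symm
  rw [rA, deriv_rA_gp hq, hdd]
  nth_rewrite 2 [hq2]
  field_simp
  norm_num

def K0 (x : E3) : ℝ := rA (rA gp) (‖x‖ ^ 2)

lemma K0_smooth : ContDiff ℝ ∞ K0 :=
  (rA_smooth (rA_smooth gp_smooth)).comp (contDiff_norm_sq ℝ)

lemma K0_zero {x : E3} (hx : 1 ≤ ‖x‖) : K0 x = 0 := by
  apply rA_rA_gp
  nlinarith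

lemma K0_compact : HasCompactSupport K0 := by
  apply HasCompactSupport.of_support_subset_isCompact (isCompact_closedBall (0 : E3) 1)
  intro x hx
  rw [mem_closedBall_zero_iff]
  by_contra h
  exact hx (K0_zero (not_le.1 h).le)

lemma K0_int : ∫ x, K0 x ≠ 0 := by
  have hsm := rA_smooth gp_smooth
  have hsm1 : ContDiff ℝ ∞ (deriv (rA gp)) := (contDiff_infty_iff_deriv.1 hsm).2
  have h := integral_fun_norm_addHaar (volume : Measure E3) (fun y => rA (rA gp) (y ^ 2))
  have hI : ∫ y in Ioi (0:ℝ), y ^ 2 * rA (rA gp) (y ^ 2)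
      = -2 - 2 * (0:ℝ) ^ 3 * deriv (rA gp) (0 ^ 2) := by
    apply integral_Ioi_of_hasDerivAt_of_tendsto (f := fun y => 2 * y ^ 3 * deriv (rA gp) (y ^ 2))
    · apply Continuous.continuousWithinAt
      have := hsm1.continuous
      fun_prop
    · intro y _
      have h1 : HasDerivAt (deriv (rA gp)) (deriv (deriv (rA gp)) (y ^ 2)) (y ^ 2) :=
        (hsm1.contDiffAt.differentiableAt (by simp)).hasDerivAt
      have h2 := HasDerivAt.comp (h := fun y : ℝ => y ^ 2) y h1 (hasDerivAt_pow 2 y)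
      have h3 := ((hasDerivAt_pow 3 y).const_mul 2).mul h2
      refine HasDerivAt.congr_deriv (f' := _) h3 ?_
      simp only [rA, Function.comp]
      push_cast; ring
    · apply Integrable.integrableOn
      apply Continuous.integrable_of_hasCompactSupport
      · have := (rA_smooth hsm).continuous
        fun_prop
      · apply HasCompactSupport.of_support_subset_isCompact (isCompact_Icc (a := (-1:ℝ)) (b := 1))
        intro y hy
        rw [mem_Icc, ← abs_le]
        by_contra hc
        push Not at hc
        apply hy
        simp only
        rw [rA_rA_gp, mul_zero]
        have : 1 < |y| ^ 2 := by nlinarith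
        rw [sq_abs] at this
        linarith
    · apply tendsto_const_nhds.congr'
      filter_upwards [eventually_gt_atTop 1] with y hy
      rw [deriv_rA_gp (by nlinarith), Real.sqrt_sq (by linarith)]
      field_simp
  have h3 : Module.finrank ℝ E3 = 3 := by simp
  rw [h3] at h
  simp only [smul_eq_mul, nsmul_eq_mul, show 3 - 1 = 2 from rfl, hI] at h
  unfold K0
  rw [h]
  have : 0 < (volume : Measure E3).real (ball 0 1) := by
    rw [measureReal_def]
    exact ENNReal.toReal_pos (measure_ball_pos _ _ one_pos).ne' measure_ball_lt_top.ne
  simp [this.ne']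

/-- normalized kernel -/
def KK (x : E3) : ℝ := (∫ x, K0 x)⁻¹ * K0 x

lemma KK_smooth : ContDiff ℝ ∞ KK := contDiff_const.mul K0_smooth
lemma KK_compact : HasCompactSupport KK := K0_compact.mul_left
lemma KK_zero {x : E3} (hx : 1 ≤ ‖x‖) : KK x = 0 := by simp [KK, K0_zero hx]
lemma KK_int : ∫ x, KK x = 1 := by
  unfold KK
  rw [integral_const_mul, inv_mul_cancel₀ K0_int]

lemma rA_scale {g : ℝ → ℝ} (hg : ContDiff ℝ ∞ g) (c a : ℝ) :
    rA (fun q => c * g (a * q)) = fun q => c * a * rA g (a * q) := by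
  have hd : ∀ (g : ℝ → ℝ), ContDiff ℝ ∞ g → ∀ c : ℝ, deriv (fun q => c * g (a * q)) =
      fun q => (c * a) * deriv g (a * q) := by
    intro g hg c
    funext q
    have h1 : HasDerivAt g (deriv g (a * q)) (a * q) :=
      (hg.contDiffAt.differentiableAt (by simp)).hasDerivAt
    have h2 : HasDerivAt (fun q : ℝ => a * q) a q := by simpa using (hasDerivAt_id q).const_mul a
    have := ((h1.comp q h2).const_mul c).deriv
    simp only [Function.comp_def] at this
    rw [this]; ring
  have h1 : ContDiff ℝ ∞ (deriv g) := (contDiff_infty_iff_deriv.1 hg).2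
  funext q
  simp only [rA]
  rw [hd g hg, hd _ h1]
  ring

lemma lapl_sub {f g : E3 → ℝ} (hf : ContDiff ℝ ∞ f) (hg : ContDiff ℝ ∞ g) :
    lapl (fun x => f x - g x) = fun x => lapl f x - lapl g x := by
  funext x
  unfold lapl
  rw [← Finset.sum_sub_distrib]
  apply Finset.sum_congr rfl
  intro k _
  have : pd (fun x => f x - g x) k = fun x => pd f k x - pd g k x :=
    funext fun y => pd_sub (pd_diff hf y) (pd_diff hg y) k
  rw [this, pd_sub (pd_diff (pd_smooth hf k) x) (pd_diff (pd_smooth hg k) x)]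

/-- scaled potential -/
def GG (r : ℝ) (x : E3) : ℝ := (∫ x, K0 x)⁻¹ * r * gp ((r ^ 2)⁻¹ * ‖x‖ ^ 2)

lemma GG_smooth (r : ℝ) : ContDiff ℝ ∞ (GG r) := by
  apply contDiff_const.mul
  exact gp_smooth.comp (contDiff_const.mul (contDiff_norm_sq ℝ))

lemma GG_lapl {r : ℝ} (hr : 0 < r) (x : E3) :
    lapl (lapl (GG r)) x = (r ^ 3)⁻¹ * KK (r⁻¹ • x) := by
  have hs : ∀ c a : ℝ, ∀ g : ℝ → ℝ, ContDiff ℝ ∞ g → ContDiff ℝ ∞ (fun q => c * g (a * q)) := by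
    intro c a g hg
    exact contDiff_const.mul (hg.comp (contDiff_const.mul contDiff_id))
  unfold GG
  rw [lapl_rad (hs _ _ _ gp_smooth), rA_scale gp_smooth, lapl_rad (hs _ _ _ (rA_smooth gp_smooth)),
    rA_scale (rA_smooth gp_smooth)]
  simp only [KK, K0]
  rw [norm_smul, mul_pow, norm_inv, Real.norm_of_nonneg hr.le, inv_pow]
  field_simp

lemma GG_big {r : ℝ} (hr : 0 < r) {x : E3} (hx : r ≤ ‖x‖) : GG r x = (∫ x, K0 x)⁻¹ * ‖x‖ := by
  unfold GG
  rw [gp_eq, Real.sqrt_mul (by positivity), Real.sqrt_inv, Real.sqrt_sq hr.le,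
    Real.sqrt_sq (norm_nonneg _)]
  · field_simp
  · rw [inv_mul_eq_div, le_div_iff₀ (by positivity)]
    nlinarith

end

open MeasureTheory Metric Set
noncomputable section
open scoped ContDiff Topology
open Filter

/-- functions reproduced by the kernel -/
def KRep (U : Set E3) (f : E3 → ℝ) : Prop :=
  ContinuousOn f U ∧ ∀ x r, 0 < r → closedBall x r ⊆ U → f x = ∫ z, f (x + r • z) * KK z

lemma KK_tsupport : tsupport KK ⊆ closedBall (0 : E3) 1 := by
  apply closure_minimal _ isClosed_closedBall
  intro x hx
  rw [mem_closedBall_zero_iff]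
  by_contra h
  exact hx (KK_zero (not_le.1 h).le)

lemma rep_scaled_int {U : Set E3} (hU : IsOpen U) {f φ : E3 → ℝ} (hf : ContinuousOn f U)
    (hφ : Continuous φ) {ρ : ℝ} (hs : tsupport φ ⊆ closedBall (0 : E3) ρ) {x : E3} {r : ℝ}
    (hr : 0 ≤ r)
    (hb : closedBall x (r * ρ) ⊆ U) :
    Continuous (fun z => f (x + r • z) * φ z) ∧ Integrable (fun z => f (x + r • z) * φ z) := by
  have hc : Continuous (fun z : E3 => x + r • z) := by fun_prop
  have hU' : IsOpen ((fun z : E3 => x + r • z) ⁻¹' U) := hU.preimage hc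
  have hf' : ContinuousOn (fun z : E3 => f (x + r • z)) ((fun z : E3 => x + r • z) ⁻¹' U) :=
    hf.comp hc.continuousOn (fun z hz => hz)
  have hs' : tsupport φ ⊆ ((fun z : E3 => x + r • z) ⁻¹' U) := by
    intro z hz
    apply hb
    have := hs hz
    rw [mem_closedBall_zero_iff] at this
    rw [mem_closedBall, dist_eq_norm, add_sub_cancel_left, norm_smul, Real.norm_of_nonneg hr]
    exact mul_le_mul_of_nonneg_left this hr
  exact ⟨cont_mul_of_tsupport hU' hf' hφ hs', integrable_mul_of_tsupport hU' hf' hφ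
    ((isCompact_closedBall _ _).of_isClosed_subset (isClosed_tsupport _) hs) hs'⟩

lemma int_scale (F : E3 → ℝ) (x : E3) {r : ℝ} (hr : 0 < r) :
    ∫ z, F (x + r • z) = (r ^ 3)⁻¹ * ∫ y, F y := by
  have h1 := Measure.integral_comp_smul (volume : Measure E3) (fun z => F (x + z)) r
  rw [h1, integral_add_left_eq_self F x]
  simp [abs_of_pos hr]

lemma lapl_trans (f : E3 → ℝ) (x : E3) : lapl (fun y => f (y - x)) = fun y => lapl f (y - x) := by
  have h : ∀ g : E3 → ℝ, ∀ k, pd (fun y => g (y - x)) k = fun y => pd g k (y - x) := by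
    intro g k; funext y; unfold pd; rw [fderiv_comp_sub]
  funext y
  unfold lapl
  simp only [h]

lemma rep_of_weak {U : Set E3} (hU : IsOpen U) {f : E3 → ℝ} (hf : ContinuousOn f U)
    (hw : ∀ Φ : E3 → ℝ, ContDiff ℝ ∞ Φ → HasCompactSupport Φ → tsupport Φ ⊆ U →
      ∫ x, f x * lapl (lapl Φ) x = 0) : KRep U f := by
  refine ⟨hf, fun x r hr hb => ?_⟩
  have key : ∀ s, 0 < s → s ≤ r → ∫ z, f (x + s • z) * KK z = ∫ z, f (x + r • z) * KK z := by
    intro s hs hsr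
    have hsm : ∀ t, ContDiff ℝ ∞ (fun y => GG t (y - x)) := fun t =>
      (GG_smooth t).comp (contDiff_id.sub contDiff_const)
    have hts : tsupport (fun y => GG r (y - x) - GG s (y - x)) ⊆ closedBall x r := by
      apply closure_minimal _ isClosed_closedBall
      intro y hy
      rw [mem_closedBall, dist_eq_norm]
      by_contra h
      push Not at h
      apply hy
      simp only
      rw [GG_big hr h.le, GG_big hs (hsr.trans h.le), sub_self]
    have h0 := hw (fun y => GG r (y - x) - GG s (y - x)) ((hsm r).sub (hsm s))
      ((isCompact_closedBall x r).of_isClosed_subset (isClosed_tsupport _) hts) (hts.trans hb)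
    have hsm2 : ∀ t, ContDiff ℝ ∞ (fun y => lapl (GG t) (y - x)) := fun t =>
      (lapl_smooth (GG_smooth t)).comp (contDiff_id.sub contDiff_const)
    rw [lapl_sub (hsm r) (hsm s), lapl_trans, lapl_trans, lapl_sub (hsm2 r) (hsm2 s), lapl_trans,
      lapl_trans] at h0
    have e1 : ∀ t, 0 < t → ∫ z, f (x + t • z) * KK z
        = ∫ y, f y * lapl (lapl (GG t)) (y - x) := by
      intro t ht
      have := int_scale (fun y => f y * lapl (lapl (GG t)) (y - x)) x ht
      have h2 : ∀ z : E3, f (x + t • z) * lapl (lapl (GG t)) (x + t • z - x)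
          = (t ^ 3)⁻¹ * (f (x + t • z) * KK z) := by
        intro z
        rw [GG_lapl ht, add_sub_cancel_left, smul_smul, inv_mul_cancel₀ ht.ne', one_smul]; ring
      simp only [h2, integral_const_mul] at this
      exact mul_left_cancel₀ (by positivity) this
    have hint : ∀ t, 0 < t → t ≤ r →
        Integrable (fun y => f y * lapl (lapl (GG t)) (y - x)) := by
      intro t ht htr
      apply integrable_mul_of_tsupport hU hf
      · exact (lapl_smooth (lapl_smooth (GG_smooth t))).continuous.comp
          (continuous_id.sub continuous_const)
      all_goals
        have : tsupport (fun y => lapl (lapl (GG t)) (y - x)) ⊆ closedBall x r := by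
          apply closure_minimal _ isClosed_closedBall
          intro y hy
          rw [mem_closedBall, dist_eq_norm]
          by_contra h
          push Not at h
          apply hy
          simp only
          rw [GG_lapl ht, KK_zero, mul_zero]
          rw [norm_smul, norm_inv, Real.norm_of_nonneg ht.le, inv_mul_eq_div, one_le_div ht]
          exact htr.trans h.le
      · exact (isCompact_closedBall x r).of_isClosed_subset (isClosed_tsupport _) this
      · exact this.trans hb
    rw [e1 s hs, e1 r hr]
    simp only [mul_sub] at h0
    rw [integral_sub (hint r hr le_rfl) (hint s hs hsr)] at h0
    linarith
  obtain ⟨B, hB⟩ := (isCompact_closedBall x r).exists_bound_of_continuousOn (hf.mono hb)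
  have hxU : x ∈ U := hb (mem_closedBall_self hr.le)
  have hlim : Tendsto (fun s : ℝ => ∫ z, f (x + s • z) * KK z) (𝓝[>] 0)
      (𝓝 (∫ z, f x * KK z)) := by
    apply tendsto_integral_filter_of_dominated_convergence (fun z => B * ‖KK z‖)
    · filter_upwards [Ioc_mem_nhdsGT hr] with s hs
      apply Continuous.aestronglyMeasurable
      apply (rep_scaled_int hU hf KK_smooth.continuous KK_tsupport hs.1.le _).1
      exact (closedBall_subset_closedBall (by linarith [hs.2])).trans hb
    · filter_upwards [Ioc_mem_nhdsGT hr] with s hs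
      refine Eventually.of_forall fun z => ?_
      rw [norm_mul]
      by_cases hz : 1 ≤ ‖z‖
      · rw [KK_zero hz]; simp
      · apply mul_le_mul_of_nonneg_right _ (norm_nonneg _)
        apply hB
        rw [mem_closedBall, dist_eq_norm, add_sub_cancel_left, norm_smul, Real.norm_of_nonneg hs.1.le]
        push Not at hz
        nlinarith [hs.1, hs.2, norm_nonneg z]
    · exact (KK_smooth.continuous.integrable_of_hasCompactSupport KK_compact).norm.const_mul B
    · refine Eventually.of_forall fun z => ?_
      apply Tendsto.mul_const
      have hfx : ContinuousAt f x := hf.continuousAt (hU.mem_nhds hxU)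
      have : Tendsto (fun s : ℝ => x + s • z) (𝓝[>] 0) (𝓝 x) := by
        have h : Continuous (fun s : ℝ => x + s • z) := by fun_prop
        have := h.tendsto 0
        simp only [zero_smul, add_zero] at this
        exact this.mono_left nhdsWithin_le_nhds
      exact hfx.tendsto.comp this
  rw [integral_const_mul, KK_int, mul_one] at hlim
  have hlim2 : Tendsto (fun s : ℝ => ∫ z, f (x + s • z) * KK z) (𝓝[>] 0)
      (𝓝 (∫ z, f (x + r • z) * KK z)) := by
    apply tendsto_const_nhds.congr'
    filter_upwards [Ioc_mem_nhdsGT hr] with s hs using (key s hs.1 hs.2).symm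
  exact tendsto_nhds_unique hlim hlim2

lemma KK_neg (x : E3) : KK (-x) = KK x := by simp [KK, K0]

/-- shifted representation: integral against a shifted kernel -/
lemma rep_shift {U : Set E3} {f : E3 → ℝ} (hf : KRep U f) {x h : E3} {r : ℝ} (hr : 0 < r)
    (hb : closedBall (x + r • h) r ⊆ U) :
    f (x + r • h) = ∫ z, f (x + r • z) * KK (z - h) := by
  rw [hf.2 _ r hr hb, ← integral_add_right_eq_self (fun z => f (x + r • z) * KK (z - h)) h]
  simp only [add_sub_cancel_right, smul_add]
  congr 1; funext z; congr 2; abel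

lemma rep_smooth {U : Set E3} (hU : IsOpen U) {f : E3 → ℝ} (hf : KRep U f) :
    ContDiffOn ℝ ∞ f U := by
  intro x hx
  apply ContDiffAt.contDiffWithinAt
  obtain ⟨R, hR, hb⟩ := Metric.nhds_basis_closedBall.mem_iff.1 (hU.mem_nhds hx)
  set r := R / 2 with hr
  have hr0 : 0 < r := by positivity
  set ft : E3 → ℝ := (closedBall x R).indicator f
  have hft : Integrable ft := by
    rw [integrable_indicator_iff measurableSet_closedBall]
    exact (hf.1.mono hb).integrableOn_compact (isCompact_closedBall _ _)
  set g : E3 → ℝ := fun y => (r ^ 3)⁻¹ * KK (r⁻¹ • y)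
  have hg : ContDiff ℝ ∞ g := contDiff_const.mul (KK_smooth.comp (contDiff_const_smul r⁻¹))
  have hgc : HasCompactSupport g := by
    apply HasCompactSupport.of_support_subset_isCompact (isCompact_closedBall (0 : E3) r)
    intro y hy
    rw [mem_closedBall_zero_iff]
    by_contra h
    push Not at h
    apply hy
    simp only [g]
    rw [KK_zero, mul_zero]
    rw [norm_smul, norm_inv, Real.norm_of_nonneg hr0.le, inv_mul_eq_div, one_le_div hr0]
    exact h.le
  have hconv := hgc.contDiff_convolution_right (n := ⊤) (ContinuousLinearMap.mul ℝ ℝ)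
    hft.locallyIntegrable hg (μ := volume)
  apply hconv.contDiffAt.congr_of_eventuallyEq
  filter_upwards [ball_mem_nhds x hr0] with y hy
  have hyb : closedBall y r ⊆ closedBall x R := by
    apply closedBall_subset_closedBall'
    rw [mem_ball] at hy
    linarith
  rw [hf.2 y r hr0 (hyb.trans hb)]
  have := int_scale (fun t => ft t * g (y - t)) y hr0
  simp only [convolution, ContinuousLinearMap.mul_apply']
  have h2 : ∀ z, ft (y + r • z) * g (y - (y + r • z))
      = (r ^ 3)⁻¹ * (f (y + r • z) * KK z) := by
    intro z
    simp only [g]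
    have : r⁻¹ • (y - (y + r • z)) = -z := by
      rw [sub_add_cancel_left, smul_neg, smul_smul, inv_mul_cancel₀ hr0.ne', one_smul]
    rw [this, KK_neg]
    by_cases hz : 1 ≤ ‖z‖
    · rw [KK_zero hz]; simp
    · have : ft (y + r • z) = f (y + r • z) := by
        apply indicator_of_mem
        apply hyb
        rw [mem_closedBall, dist_eq_norm, add_sub_cancel_left, norm_smul, Real.norm_of_nonneg hr0.le]
        push Not at hz
        nlinarith
      rw [this]; ring
  simp only [h2, integral_const_mul] at this
  exact mul_left_cancel₀ (by positivity) this

/-- directional derivative -/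
def dd (e : E3) (f : E3 → ℝ) (x : E3) : ℝ := fderiv ℝ f x e

lemma rep_diff {U : Set E3} (hU : IsOpen U) {f : E3 → ℝ} (hf : KRep U f) {x : E3} (hx : x ∈ U) :
    DifferentiableAt ℝ f x :=
  ((rep_smooth hU hf).contDiffAt (hU.mem_nhds hx)).differentiableAt (by simp)

lemma rep_line {U : Set E3} (hU : IsOpen U) {f : E3 → ℝ} (hf : KRep U f) {e x : E3} {t : ℝ}
    (hx : x + t • e ∈ U) : HasDerivAt (fun t : ℝ => f (x + t • e)) (dd e f (x + t • e)) t := by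
  have h1 : HasDerivAt (fun t : ℝ => x + t • e) e t := by
    simpa using ((hasDerivAt_id t).smul_const e).const_add x
  exact (rep_diff hU hf hx).hasFDerivAt.comp_hasDerivAt t h1

lemma dd_cont {U : Set E3} (hU : IsOpen U) {f : E3 → ℝ} (hf : KRep U f) (e : E3) :
    ContinuousOn (dd e f) U := by
  unfold dd
  exact ((rep_smooth hU hf).continuousOn_fderiv_of_isOpen hU (by simp)).clm_apply continuousOn_const

lemma rep_dd {U : Set E3} (hU : IsOpen U) {f : E3 → ℝ} (hf : KRep U f) (e : E3) :
    KRep U (dd e f) := by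
  refine ⟨dd_cont hU hf e, fun x r hr hb => ?_⟩
  obtain ⟨δ, hδ, hδb⟩ := (isCompact_closedBall x r).exists_cthickening_subset_open hU hb
  rw [cthickening_closedBall hδ.le hr.le] at hδb
  obtain ⟨ε, hε, hεδ⟩ : ∃ ε > 0, ε * ‖e‖ ≤ δ := ⟨δ / (‖e‖ + 1), by positivity, by
    rw [div_mul_eq_mul_div, div_le_iff₀ (by positivity)]; nlinarith [norm_nonneg e]⟩
  obtain ⟨B, hB⟩ := (isCompact_closedBall x (δ + r)).exists_bound_of_continuousOn
    ((dd_cont hU hf e).mono hδb)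
  have hin : ∀ t ∈ ball (0:ℝ) ε, ∀ z : E3, ‖z‖ ≤ 1 → x + r • z + t • e ∈ closedBall x (δ + r) := by
    intro t ht z hz
    rw [mem_ball_zero_iff] at ht
    rw [mem_closedBall, dist_eq_norm]
    have : x + r • z + t • e - x = r • z + t • e := by abel
    rw [this]
    refine (norm_add_le _ _).trans ?_
    rw [norm_smul, norm_smul, Real.norm_of_nonneg hr.le]
    nlinarith [norm_nonneg e, mul_le_mul_of_nonneg_right ht.le (norm_nonneg e),
      mul_le_mul_of_nonneg_left hz hr.le]
  have hsub : ∀ t ∈ ball (0:ℝ) ε, closedBall (x + t • e) r ⊆ U := by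
    intro t ht y hy
    apply hδb
    rw [mem_ball_zero_iff] at ht
    rw [mem_closedBall] at hy ⊢
    have h1 : dist (x + t • e) x ≤ δ := by
      rw [dist_eq_norm, add_sub_cancel_left, norm_smul]
      nlinarith [norm_nonneg e, mul_le_mul_of_nonneg_right ht.le (norm_nonneg e)]
    linarith [dist_triangle y (x + t • e) x]
  have hder := (hasDerivAt_integral_of_dominated_loc_of_deriv_le (μ := (volume : Measure E3))
    (F := fun (t : ℝ) z => f (x + t • e + r • z) * KK z)
    (F' := fun (t : ℝ) z => dd e f (x + r • z + t • e) * KK z) (x₀ := 0)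
    (bound := fun z => B * ‖KK z‖) (s := ball 0 ε) (ball_mem_nhds _ hε) ?_ ?_ ?_ ?_ ?_ ?_).2
  · have heq : (fun t : ℝ => ∫ z, f (x + t • e + r • z) * KK z) =ᶠ[𝓝 0]
        fun t => f (x + t • e) := by
      filter_upwards [ball_mem_nhds _ hε] with t ht
      exact (hf.2 _ r hr (hsub t ht)).symm
    have h1 := hder.congr_of_eventuallyEq heq.symm
    have h2 := rep_line hU hf (e := e) (x := x) (t := 0)
      (by simpa using hb (mem_closedBall_self hr.le))
    have := h2.unique h1
    simpa using this
  · filter_upwards [ball_mem_nhds _ hε] with t ht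
    exact (rep_scaled_int hU hf.1 KK_smooth.continuous KK_tsupport hr.le
      (by simpa using hsub t ht)).1.aestronglyMeasurable
  · exact (rep_scaled_int hU hf.1 KK_smooth.continuous KK_tsupport hr.le
      (by simpa using hb)).2
  · have := (rep_scaled_int (x := x) hU (dd_cont hU hf e) KK_smooth.continuous KK_tsupport hr.le
      (by simpa using hb)).1.aestronglyMeasurable (μ := volume)
    simpa using this
  · refine Eventually.of_forall fun z t ht => ?_
    rw [norm_mul]
    by_cases hz : 1 ≤ ‖z‖
    · rw [KK_zero hz]; simp
    · exact mul_le_mul_of_nonneg_right (hB _ (hin t ht z (not_le.1 hz).le)) (norm_nonneg _)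
  · exact (KK_smooth.continuous.integrable_of_hasCompactSupport KK_compact).norm.const_mul B
  · refine Eventually.of_forall fun z t ht => ?_
    by_cases hz : 1 ≤ ‖z‖
    · rw [KK_zero hz]; simpa using hasDerivAt_const t (0:ℝ)
    · apply HasDerivAt.mul_const
      have := rep_line hU hf (e := e) (x := x + r • z) (t := t)
        (hδb (hin t ht z (not_le.1 hz).le))
      refine this.congr_of_eventuallyEq (Eventually.of_forall fun t => ?_)
      simp only
      congr 1; abel

end

open MeasureTheory Metric Set
noncomputable section
open scoped ContDiff Topology
open Filter

lemma KK_shift_bound : ∃ A : ℝ, 1 ≤ A ∧ ∀ h : E3, ‖h‖ ≤ 1 → ∫ z, |KK (z - h) - KK z| ≤ A * ‖h‖ := by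
  obtain ⟨C, hC⟩ := KK_smooth.lipschitzWith_of_hasCompactSupport KK_compact (by simp)
  set V := (volume : Measure E3).real (closedBall (0:E3) 2)
  refine ⟨C * V + 1, ?_, fun h hh => ?_⟩
  · have : 0 ≤ (C:ℝ) * V := by positivity
    linarith
  have h1 : ∀ z, |KK (z - h) - KK z| ≤ (closedBall (0:E3) 2).indicator (fun _ => (C:ℝ) * ‖h‖) z := by
    intro z
    by_cases hz : z ∈ closedBall (0:E3) 2
    · rw [indicator_of_mem hz]
      have := hC.dist_le_mul (z - h) z
      simpa [Real.dist_eq] using this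
    · rw [indicator_of_notMem hz]
      rw [mem_closedBall_zero_iff] at hz
      push Not at hz
      rw [KK_zero (x := z) (by linarith), KK_zero (x := z - h) (by linarith [norm_sub_norm_le z h])]
      simp
  have hi : Integrable ((closedBall (0:E3) 2).indicator (fun _ => (C:ℝ) * ‖h‖)) := by
    rw [integrable_indicator_iff measurableSet_closedBall]
    exact integrableOn_const (measure_closedBall_lt_top.ne)
  calc ∫ z, |KK (z - h) - KK z| ≤ ∫ z, (closedBall (0:E3) 2).indicator (fun _ => (C:ℝ) * ‖h‖) z :=
        integral_mono_of_nonneg (Eventually.of_forall fun z => abs_nonneg _) hi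
          (Eventually.of_forall h1)
    _ = V * ((C:ℝ) * ‖h‖) := by
        rw [integral_indicator measurableSet_closedBall, setIntegral_const, smul_eq_mul]
    _ ≤ _ := by nlinarith [norm_nonneg h]

lemma KK_int1 : Integrable (fun z => KK z) :=
  KK_smooth.continuous.integrable_of_hasCompactSupport KK_compact

/-- interior derivative estimate -/
lemma deriv_est : ∃ A : ℝ, 1 ≤ A ∧ ∀ (U : Set E3) (f : E3 → ℝ) (x e : E3) (r S : ℝ), IsOpen U →
    KRep U f → 0 < r → closedBall x r ⊆ U → (∀ y ∈ closedBall x r, |f y| ≤ S) → ‖e‖ ≤ 1 →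
    |dd e f x| ≤ A / r * S := by
  obtain ⟨A, hA, hK⟩ := KK_shift_bound
  refine ⟨2 * A, by linarith, fun U f x e r S hU hf hr hb hS he => ?_⟩
  have hS0 : 0 ≤ S := (abs_nonneg _).trans (hS x (mem_closedBall_self hr.le))
  set ρ := r / 2 with hρ
  have hρ0 : 0 < ρ := by positivity
  have hsh : ∀ h : E3, ‖h‖ ≤ 1 → closedBall (x + ρ • h) ρ ⊆ U := by
    intro h hh
    refine Subset.trans (closedBall_subset_closedBall' ?_) hb
    rw [dist_eq_norm, add_sub_cancel_left, norm_smul, Real.norm_of_nonneg hρ0.le]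
    nlinarith
  have hint : ∀ h : E3, ‖h‖ ≤ 1 → Integrable (fun z => f (x + ρ • z) * KK (z - h)) := by
    intro h hh
    refine (rep_scaled_int (φ := fun z => KK (z - h)) (ρ := 2) hU hf.1
      (KK_smooth.continuous.comp (continuous_id.sub continuous_const)) ?_ hρ0.le ?_).2
    · apply closure_minimal _ isClosed_closedBall
      intro z hz
      rw [mem_closedBall_zero_iff]
      by_contra h'
      push Not at h'
      exact hz (KK_zero (by linarith [norm_sub_norm_le z h]))
    · rwa [show ρ * 2 = r by rw [hρ]; ring]
  have key : ∀ h : E3, ‖h‖ ≤ 1 → |f (x + ρ • h) - f x| ≤ S * (A * ‖h‖) := by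
    intro h hh
    have e0 := rep_shift hf (x := x) (h := 0) hρ0 (by simpa using hsh 0 (by simp))
    have e1 := rep_shift hf (x := x) (h := h) hρ0 (hsh h hh)
    rw [smul_zero, add_zero] at e0
    rw [e0, e1, ← integral_sub (hint h hh) (hint 0 (by simp))]
    have hi2 : Integrable (fun z => |KK (z - h) - KK z|) :=
      ((KK_int1.comp_sub_right h).sub KK_int1).abs
    calc _ ≤ ∫ z, S * |KK (z - h) - KK z| := by
          rw [← Real.norm_eq_abs]
          apply norm_integral_le_of_norm_le (hi2.const_mul S)
          refine Eventually.of_forall fun z => ?_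
          rw [sub_zero, ← mul_sub, norm_mul, Real.norm_eq_abs, Real.norm_eq_abs]
          by_cases hz : ‖z‖ ≤ 2
          · apply mul_le_mul_of_nonneg_right _ (abs_nonneg _)
            apply hS
            rw [mem_closedBall, dist_eq_norm, add_sub_cancel_left, norm_smul,
              Real.norm_of_nonneg hρ0.le]
            nlinarith
          · push Not at hz
            rw [KK_zero (x := z) (by linarith), KK_zero (x := z - h)
              (by linarith [norm_sub_norm_le z h])]
            simp
      _ ≤ _ := by
          rw [integral_const_mul]
          exact mul_le_mul_of_nonneg_left (hK h hh) hS0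
  have hn : ‖fderiv ℝ f x‖ ≤ 2 * A / r * S := by
    apply norm_fderiv_le_of_lip' ℝ (by positivity)
    filter_upwards [ball_mem_nhds x hρ0] with y hy
    rw [mem_ball, dist_eq_norm] at hy
    have h3 : ‖ρ⁻¹ • (y - x)‖ = ρ⁻¹ * ‖y - x‖ := by
      rw [norm_smul, norm_inv, Real.norm_of_nonneg hρ0.le]
    have := key (ρ⁻¹ • (y - x)) (by
      rw [h3, inv_mul_eq_div, div_le_one hρ0]; exact hy.le)
    rw [smul_smul, mul_inv_cancel₀ hρ0.ne', one_smul, add_sub_cancel, h3] at this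
    rw [Real.norm_eq_abs]
    refine this.trans (le_of_eq ?_)
    rw [hρ]; field_simp
  calc |dd e f x| ≤ ‖fderiv ℝ f x‖ * ‖e‖ := (fderiv ℝ f x).le_opNorm e
    _ ≤ ‖fderiv ℝ f x‖ := by nlinarith [norm_nonneg (fderiv ℝ f x)]
    _ ≤ _ := hn

lemma rep_iter {U : Set E3} (hU : IsOpen U) {f : E3 → ℝ} (hf : KRep U f) (e : E3) (k : ℕ) :
    KRep U ((dd e)^[k] f) := by
  induction k with
  | zero => exact hf
  | succ n ih => rw [Function.iterate_succ_apply']; exact rep_dd hU ih e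

/-- the constant satisfies the derivative estimate -/
def DE (A : ℝ) : Prop := 1 ≤ A ∧ ∀ (U : Set E3) (f : E3 → ℝ) (x e : E3) (r S : ℝ), IsOpen U →
    KRep U f → 0 < r → closedBall x r ⊆ U → (∀ y ∈ closedBall x r, |f y| ≤ S) → ‖e‖ ≤ 1 →
    |dd e f x| ≤ A / r * S

lemma iter_est {A : ℝ} (hA : DE A) {U : Set E3} (hU : IsOpen U) {e : E3} (he : ‖e‖ ≤ 1) {ρ : ℝ}
    (hρ : 0 < ρ) (k : ℕ) : ∀ (f : E3 → ℝ) (S : ℝ) (x : E3), KRep U f → closedBall x (k * ρ) ⊆ U →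
    (∀ y ∈ closedBall x (k * ρ), |f y| ≤ S) → |(dd e)^[k] f x| ≤ (A / ρ) ^ k * S := by
  induction k with
  | zero => intro f S x _ _ h; simpa using h x (by simp)
  | succ k ih =>
    intro f S x hf hb hS
    rw [Function.iterate_succ_apply]
    have hsub : ∀ y ∈ closedBall x (k * ρ), closedBall y ρ ⊆ closedBall x ((k+1 : ℕ) * ρ) := by
      intro y hy
      apply closedBall_subset_closedBall'
      rw [mem_closedBall] at hy
      push_cast
      linarith
    have := ih (dd e f) (A / ρ * S) x (rep_dd hU hf e)
      (Subset.trans (closedBall_subset_closedBall (by push_cast; linarith)) hb) (fun y hy =>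
        hA.2 U f y e ρ S hU hf hρ ((hsub y hy).trans hb) (fun z hz => hS z (hsub y hy hz)) he)
    refine this.trans (le_of_eq ?_)
    ring

lemma iter_est2 {A : ℝ} (hA : DE A) {U : Set E3} (hU : IsOpen U) {e : E3} (he : ‖e‖ ≤ 1) {r : ℝ}
    (hr : 0 < r) (k : ℕ) (f : E3 → ℝ) (S : ℝ) (x : E3) (hf : KRep U f) (hb : closedBall x r ⊆ U)
    (hS : ∀ y ∈ closedBall x r, |f y| ≤ S) : |(dd e)^[k] f x| ≤ (A * k / r) ^ k * S := by
  rcases Nat.eq_zero_or_pos k with rfl | hk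
  · simpa using hS x (mem_closedBall_self hr.le)
  · have hk' : (0:ℝ) < k := by exact_mod_cast hk
    have e : (k:ℝ) * (r / k) = r := by field_simp
    have := iter_est hA hU he (ρ := r / k) (by positivity) k f S x hf (by rwa [e]) (by rwa [e])
    refine this.trans (le_of_eq ?_)
    congr 2
    field_simp

lemma pow_self_le (k : ℕ) : (k:ℝ) ^ k / k.factorial ≤ 3 ^ k := by
  have h1 := Real.pow_div_factorial_le_exp (k:ℝ) (by positivity) k
  refine h1.trans ?_
  have h2 : Real.exp (k:ℝ) = Real.exp 1 ^ k := by rw [← Real.exp_nat_mul]; simp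
  rw [h2]
  exact pow_le_pow_left₀ (Real.exp_pos 1).le (by linarith [Real.exp_one_lt_d9]) k

lemma taylor_aux (n : ℕ) : ∀ (g : ℕ → ℝ → ℝ) (T B : ℝ), 0 ≤ T →
    (∀ k, ∀ t ∈ Icc 0 T, HasDerivAt (g k) (g (k+1) t) t) → (∀ t ∈ Icc 0 T, |g n t| ≤ B) →
    ∀ t ∈ Icc 0 T, |g 0 t - ∑ k ∈ Finset.range n, g k 0 * t ^ k / k.factorial|
      ≤ B * t ^ n / n.factorial := by
  induction n with
  | zero => intro g T B hT _ hB t ht; simpa using hB t ht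
  | succ n ih =>
    intro g T B hT hg hB
    have ih' := ih (fun k => g (k+1)) T B hT (fun k t ht => hg (k+1) t ht) hB
    intro t ht
    have hder : ∀ t ∈ Icc 0 T, HasDerivAt
        (fun t => g 0 t - ∑ k ∈ Finset.range (n+1), g k 0 * t ^ k / k.factorial)
        (g 1 t - ∑ k ∈ Finset.range n, g (k+1) 0 * t ^ k / k.factorial) t := by
      intro t ht
      apply (hg 0 t ht).sub
      have : ∀ k ∈ Finset.range (n+1), HasDerivAt (fun t => g k 0 * t ^ k / k.factorial)
          (g k 0 * (k * t ^ (k-1)) / k.factorial) t := by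
        intro k _
        exact ((hasDerivAt_pow k t).const_mul _).div_const _
      have h2 := HasDerivAt.fun_sum this
      convert h2 using 1
      rw [Finset.sum_range_succ']
      simp only [Nat.cast_zero, zero_mul, mul_zero, zero_div, add_zero]
      apply Finset.sum_congr rfl
      intro k _
      rw [Nat.factorial_succ]
      have : (k.factorial : ℝ) ≠ 0 := by positivity
      push_cast
      field_simp
    have hBd : ∀ t : ℝ, HasDerivAt (fun t : ℝ => B * t ^ (n+1) / (n+1).factorial)
        (B * t ^ n / n.factorial) t := by
      intro t
      have := ((hasDerivAt_pow (n+1) t).const_mul B).div_const ((n+1).factorial : ℝ)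
      have e : B * t ^ n / n.factorial
          = B * (((n+1 : ℕ) : ℝ) * t ^ (n + 1 - 1)) / ((n+1).factorial : ℝ) := by
        rw [Nat.factorial_succ]
        have : (n.factorial : ℝ) ≠ 0 := by positivity
        push_cast
        field_simp
      rw [e]; exact this
    have := image_norm_le_of_norm_deriv_right_le_deriv_boundary (a := 0) (b := T)
      (f := fun t => g 0 t - ∑ k ∈ Finset.range (n+1), g k 0 * t ^ k / k.factorial)
      (f' := fun t => (g 1 t - ∑ k ∈ Finset.range n, g (k+1) 0 * t ^ k / k.factorial))
      (B := fun t : ℝ => B * t ^ (n+1) / (n+1).factorial)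
      (B' := fun t => B * t ^ n / n.factorial)
      (fun t ht => (hder t ht).continuousAt.continuousWithinAt)
      (fun t ht => (hder t (Ico_subset_Icc_self ht)).hasDerivWithinAt)
      (by rw [Finset.sum_range_succ']; simp) hBd
      (fun t ht => ih' t (Ico_subset_Icc_self ht)) ht
    exact this

/-- three balls -/
lemma three_ball : ∃ L : ℝ, 4 ≤ L ∧ ∀ (U : Set E3) (f : E3 → ℝ) (x : E3) (r ε M : ℝ), IsOpen U →
    KRep U f → 0 < r → closedBall x (L * r) ⊆ U → (∀ y ∈ closedBall x r, |f y| ≤ ε) →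
    (∀ y ∈ closedBall x (L * r), |f y| ≤ M) →
    ∀ y ∈ closedBall x (2 * r), |f y| ≤ 2 * √(ε * M) := by
  obtain ⟨A, hA1, hA2⟩ := deriv_est
  have hA : DE A := ⟨hA1, hA2⟩
  set l := 12 * A with hl
  have hl12 : 12 ≤ l := by linarith
  refine ⟨l ^ 2, by nlinarith, fun U f x r ε M hU hf hr hb hε hM y hy => ?_⟩
  have hε0 : 0 ≤ ε := (abs_nonneg _).trans (hε x (mem_closedBall_self hr.le))
  have hM0 : 0 ≤ M := (abs_nonneg _).trans (hM x (mem_closedBall_self (by positivity)))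
  have hA0 : 0 < A := by linarith
  obtain ⟨e, t, he, ht, rfl⟩ : ∃ (e : E3) (t : ℝ), ‖e‖ ≤ 1 ∧ t ∈ Icc 0 (2 * r) ∧ y = x + t • e := by
    refine ⟨(2*r)⁻¹ • (y - x), 2 * r, ?_, ⟨by positivity, le_rfl⟩, ?_⟩
    · rw [mem_closedBall, dist_eq_norm] at hy
      rw [norm_smul, norm_inv, Real.norm_of_nonneg (by positivity), inv_mul_eq_div,
        div_le_one (by positivity)]
      exact hy
    · rw [smul_smul, mul_inv_cancel₀ (by positivity), one_smul, add_sub_cancel]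
  have hline : ∀ s ∈ Icc 0 (2 * r), closedBall (x + s • e) (l * r) ⊆ closedBall x (l ^ 2 * r) := by
    intro s hs
    apply closedBall_subset_closedBall'
    rw [dist_eq_norm, add_sub_cancel_left, norm_smul, Real.norm_of_nonneg hs.1]
    have : s * ‖e‖ ≤ 2 * r := by nlinarith [hs.1, hs.2, norm_nonneg e]
    nlinarith [mul_nonneg hr.le (mul_nonneg (by linarith : 0 ≤ l - 12) (by linarith : 0 ≤ l))]
  set Q := √(ε * M) with hQ
  have hQ0 : 0 ≤ Q := Real.sqrt_nonneg _
  have hcoef : ∀ k : ℕ, |(dd e)^[k] f x| * (2 * r) ^ k / k.factorial ≤ (1 / 2) ^ k * Q := by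
    intro k
    have h1 := iter_est2 hA hU he hr k f ε x hf
      (Subset.trans (closedBall_subset_closedBall (by nlinarith [mul_nonneg hr.le (by nlinarith : 0 ≤ l^2 - 1)])) hb) hε
    have h2 := iter_est2 hA hU he (r := l ^ 2 * r) (by positivity) k f M x hf hb hM
    have h3 : |(dd e)^[k] f x| ≤ (A * k / (l * r)) ^ k * Q := by
      apply abs_le_of_sq_le_sq _ (by positivity)
      · rw [mul_pow, hQ, Real.sq_sqrt (by positivity), ← sq_abs, sq]
        refine (mul_le_mul h1 h2 (abs_nonneg _) (by positivity)).trans (le_of_eq ?_)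
        rw [← pow_mul, mul_comm k 2, pow_mul]
        rw [show (A * ↑k / (l * r)) ^ 2 = (A * k / r) * (A * k / (l ^ 2 * r)) by
          field_simp]
        rw [mul_pow]; ring
    calc |(dd e)^[k] f x| * (2 * r) ^ k / k.factorial
        ≤ ((A * k / (l * r)) ^ k * Q) * (2 * r) ^ k / k.factorial := by gcongr
      _ = (1 / 6) ^ k * ((k:ℝ) ^ k / k.factorial) * Q := by
        have : A * k / (l * r) = (1/6) * k * (2 * r)⁻¹ := by rw [hl]; field_simp; ring
        rw [this, mul_pow, mul_pow, inv_pow]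
        field_simp
      _ ≤ (1 / 6) ^ k * 3 ^ k * Q := by
        gcongr
        exact pow_self_le k
      _ = _ := by rw [← mul_pow]; norm_num
  have hrem : ∀ n : ℕ, ∀ s ∈ Icc 0 (2 * r), |(dd e)^[n] f (x + s • e)| ≤ (A * n / (l * r)) ^ n * M := by
    intro n s hs
    exact iter_est2 hA hU he (by positivity) n f M _ hf ((hline s hs).trans hb)
      (fun y hy => hM y (hline s hs hy))
  have hmain : ∀ n : ℕ, |f (x + t • e)| ≤ 2 * Q + (1 / 2) ^ n * M := by
    intro n
    have hT := taylor_aux n (fun k s => (dd e)^[k] f (x + s • e)) (2 * r)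
      ((A * n / (l * r)) ^ n * M) (by positivity) (fun k s hs => by
        rw [Function.iterate_succ_apply']
        apply rep_line hU (rep_iter hU hf e k)
        exact hb (hline s hs (mem_closedBall_self (by positivity)))) (hrem n) t ht
    simp only [Function.iterate_zero, id_eq, zero_smul, add_zero] at hT
    have hR : (A * n / (l * r)) ^ n * M * t ^ n / n.factorial ≤ (1 / 2) ^ n * M := by
      calc (A * n / (l * r)) ^ n * M * t ^ n / n.factorial
          ≤ (A * n / (l * r)) ^ n * M * (2 * r) ^ n / n.factorial := by
            have := ht.1; have := ht.2; gcongr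
        _ = (1 / 6) ^ n * ((n:ℝ) ^ n / n.factorial) * M := by
          have : A * n / (l * r) = (1/6) * n * (2 * r)⁻¹ := by rw [hl]; field_simp; ring
          rw [this, mul_pow, mul_pow, inv_pow]
          field_simp
        _ ≤ (1 / 6) ^ n * 3 ^ n * M := by
          gcongr
          exact pow_self_le n
        _ = _ := by rw [← mul_pow]; norm_num
    have hS : |∑ k ∈ Finset.range n, (dd e)^[k] f x * t ^ k / k.factorial| ≤ 2 * Q := by
      calc _ ≤ ∑ k ∈ Finset.range n, |(dd e)^[k] f x * t ^ k / k.factorial| :=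
            Finset.abs_sum_le_sum_abs _ _
        _ ≤ ∑ k ∈ Finset.range n, (1 / 2) ^ k * Q := by
            apply Finset.sum_le_sum
            intro k _
            refine le_trans ?_ (hcoef k)
            rw [abs_div, abs_mul, abs_pow, abs_of_nonneg ht.1, Nat.abs_cast]
            have := ht.1; have := ht.2
            gcongr
        _ ≤ 2 * Q := by
            rw [← Finset.sum_mul]
            apply mul_le_mul_of_nonneg_right _ hQ0
            have := sum_geometric_two_le n
            simpa using this
    have := abs_sub_abs_le_abs_sub (f (x + t • e)) (∑ k ∈ Finset.range n, (dd e)^[k] f x * t ^ k / k.factorial)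
    linarith
  have hlim : Tendsto (fun n : ℕ => 2 * Q + (1 / 2 : ℝ) ^ n * M) atTop (𝓝 (2 * Q + 0 * M)) :=
    ((tendsto_pow_atTop_nhds_zero_of_lt_one (by norm_num) (by norm_num)).mul_const M).const_add _
  simp only [zero_mul, add_zero] at hlim
  exact ge_of_tendsto' hlim hmain

end

open MeasureTheory Metric Set
noncomputable section
open scoped ContDiff Topology
open Filter

/-- the domain -/
def Om (C : Set E3) : Set E3 := lowerHalf \ closure C

lemma Om_open (C : Set E3) : IsOpen (Om C) := by
  apply IsOpen.sdiff _ isClosed_closure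
  exact isOpen_lt (by fun_prop) continuous_const

/-- component -/
def wc (w : E3 → E3) (i : Fin 3) (x : E3) : ℝ := w x i

lemma wc_jac {w : E3 → E3} {x : E3} (h : DifferentiableAt ℝ w x) (i j : Fin 3) :
    jac w x i j = pd (wc w i) j x := by
  unfold jac pd wc
  have := (EuclideanSpace.proj i : E3 →L[ℝ] ℝ).hasFDerivAt.comp x h.hasFDerivAt
  have h2 : fderiv ℝ (fun x => w x i) x = _ := this.fderiv
  rw [h2]; rfl

lemma wc_contDiffOn {w : E3 → E3} {U : Set E3} (h : ContDiffOn ℝ 1 w U) (i : Fin 3) :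
    ContDiffOn ℝ 1 (wc w i) U :=
  (EuclideanSpace.proj i : E3 →L[ℝ] ℝ).contDiff.comp_contDiffOn h

/-- vector field from components -/
def vf (φ : Fin 3 → E3 → ℝ) (x : E3) : E3 := WithLp.toLp 2 (fun i => φ i x)

lemma vf_smooth {φ : Fin 3 → E3 → ℝ} (h : ∀ i, ContDiff ℝ ∞ (φ i)) : ContDiff ℝ ∞ (vf φ) := by
  rw [contDiff_euclidean]
  exact h

lemma vf_compact {φ : Fin 3 → E3 → ℝ} (h : ∀ i, HasCompactSupport (φ i)) :
    HasCompactSupport (vf φ) := by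
  have hK : IsCompact (⋃ i, tsupport (φ i)) := isCompact_iUnion h
  apply HasCompactSupport.of_support_subset_isCompact hK
  intro x hx
  by_contra hn
  apply hx
  simp only [mem_iUnion, not_exists] at hn
  ext i
  exact image_eq_zero_of_notMem_tsupport (f := φ i) (hn i)

lemma vf_jac {φ : Fin 3 → E3 → ℝ} (h : ∀ i, ContDiff ℝ ∞ (φ i)) (x : E3) (i j : Fin 3) :
    jac (vf φ) x i j = pd (φ i) j x :=
  wc_jac ((vf_smooth h).contDiffAt.differentiableAt (by simp)) i j

/-- stress entries -/
def sig (lam mu : ℝ) (φ : Fin 3 → E3 → ℝ) (i j : Fin 3) (x : E3) : ℝ :=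
  (if i = j then lam * ∑ k, pd (φ k) k x else 0) + mu * (pd (φ i) j x + pd (φ j) i x)

lemma weak_scalar {lam mu p : ℝ} {C : Set E3} {w : E3 → E3}
    (hw : IsNormalizedSolution lam mu p C w) (φ : Fin 3 → E3 → ℝ) (h : ∀ i, ContDiff ℝ ∞ (φ i))
    (hc : ∀ i, HasCompactSupport (φ i)) :
    ∫ x in Om C, ∑ i, ∑ j, pd (wc w i) j x * sig lam mu φ i j x = -p * ∫ x' : E2, φ 2 (emb2 x') := by
  have h1 := hw.2.2.2.2 (vf φ) (vf_smooth h) (vf_compact hc)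
  have h2 : ∀ x' : E2, vf φ (emb2 x') 2 = φ 2 (emb2 x') := fun x' => rfl
  simp only [h2] at h1
  rw [← h1]
  apply setIntegral_congr_fun (Om_open C).measurableSet
  intro x hx
  have hd : DifferentiableAt ℝ w x :=
    (hw.2.1.contDiffAt ((Om_open C).mem_nhds hx)).differentiableAt (by simp)
  simp only [divg, strain, vf_jac h, wc_jac hd, sig, Fin.sum_univ_three]
  simp
  ring

lemma lapl_pd {f : E3 → ℝ} (hf : ContDiff ℝ ∞ f) (k : Fin 3) : lapl (pd f k) = pd (lapl f) k := by
  funext x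
  have : lapl f = fun y => ∑ i, pd (pd f i) i y := rfl
  rw [this, pd_sum _ (fun i _ => pd_diff (pd_smooth (pd_smooth hf i) i) x)]
  unfold lapl
  apply Finset.sum_congr rfl
  intro i _
  rw [show pd (pd f k) i = pd (pd f i) k from funext (pd_comm hf k i)]
  rw [pd_comm (pd_smooth hf i)]

lemma pd_lin {f g : E3 → ℝ} (hf : ContDiff ℝ ∞ f) (hg : ContDiff ℝ ∞ g) (a b : ℝ) (k : Fin 3) :
    pd (fun y => a * f y - b * g y) k = fun y => a * pd f k y - b * pd g k y := by
  funext x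
  rw [pd_sub ((pd_diff hf x).const_mul a) ((pd_diff hg x).const_mul b), pd_const_mul (pd_diff hf x),
    pd_const_mul (pd_diff hg x)]

lemma sig_smooth {lam mu : ℝ} {φ : Fin 3 → E3 → ℝ} (h : ∀ i, ContDiff ℝ ∞ (φ i)) (i j : Fin 3) :
    ContDiff ℝ ∞ (sig lam mu φ i j) := by
  unfold sig
  refine ContDiff.add ?_ (contDiff_const.mul ((pd_smooth (h i) j).add (pd_smooth (h j) i)))
  split_ifs
  · exact contDiff_const.mul (ContDiff.sum fun k _ => pd_smooth (h k) k)
  · exact contDiff_const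

lemma sig_tsupport {lam mu : ℝ} {φ : Fin 3 → E3 → ℝ} {K : Set E3} (hK : IsClosed K)
    (h : ∀ i, tsupport (φ i) ⊆ K) (i j : Fin 3) :
    tsupport (sig lam mu φ i j) ⊆ K := by
  apply closure_minimal _ hK
  intro x hx
  by_contra hn
  apply hx
  have : ∀ i j, pd (φ i) j x = 0 := fun i j =>
    image_eq_zero_of_notMem_tsupport (fun hh => hn (h i (pd_tsupport _ _ hh)))
  simp [sig, this]

lemma weak_biharm {lam mu p : ℝ} (hmu : 0 < mu) (hlam : 0 < 3 * lam + 2 * mu) {C : Set E3}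
    {w : E3 → E3} (hw : IsNormalizedSolution lam mu p C w) (m : Fin 3) (Φ : E3 → ℝ)
    (hΦ : ContDiff ℝ ∞ Φ) (hc : HasCompactSupport Φ) (hs : tsupport Φ ⊆ Om C) :
    ∫ x, wc w m x * lapl (lapl Φ) x = 0 := by
  set a : Fin 3 → ℝ := fun k => if k = m then lam + 2 * mu else 0 with ha
  set b := lam + mu with hb
  set φ : Fin 3 → E3 → ℝ := fun k x => a k * lapl Φ x - b * pd (pd Φ m) k x with hφ
  have hL := lapl_smooth hΦ
  have hP : ∀ k, ContDiff ℝ ∞ (pd (pd Φ m) k) := fun k => pd_smooth (pd_smooth hΦ m) k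
  have hφs : ∀ k, ContDiff ℝ ∞ (φ k) := fun k =>
    (contDiff_const.mul hL).sub (contDiff_const.mul (hP k))
  have hφt : ∀ k, tsupport (φ k) ⊆ tsupport Φ := by
    intro k
    apply closure_minimal _ (isClosed_tsupport _)
    intro x hx
    by_contra hn
    apply hx
    simp only [φ]
    rw [image_eq_zero_of_notMem_tsupport (f := lapl Φ) (fun hh => hn (lapl_tsupport _ hh)),
      image_eq_zero_of_notMem_tsupport (f := pd (pd Φ m) k)
        (fun hh => hn (pd_tsupport _ _ (pd_tsupport _ _ hh)))]
    simp
  have hφc : ∀ k, HasCompactSupport (φ k) := fun k =>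
    hc.of_isClosed_subset (isClosed_tsupport _) (hφt k)
  have h1 := weak_scalar hw φ hφs hφc
  have h0 : ∀ x' : E2, φ 2 (emb2 x') = 0 := by
    intro x'
    apply image_eq_zero_of_notMem_tsupport
    intro hh
    have := (hs (hφt 2 hh)).1
    simp [lowerHalf, emb2] at this
  simp only [h0, integral_zero, mul_zero] at h1
  have hst : ∀ i j, tsupport (sig lam mu φ i j) ⊆ tsupport Φ :=
    sig_tsupport (isClosed_tsupport _) hφt
  have hsc : ∀ i j, HasCompactSupport (sig lam mu φ i j) := fun i j =>
    hc.of_isClosed_subset (isClosed_tsupport _) (hst i j)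
  have hwi : ∀ i, ContDiffOn ℝ 1 (wc w i) (Om C) := fun i => wc_contDiffOn hw.2.1 i
  rw [setInt_eq (fun x hx => by
    apply Finset.sum_eq_zero; intro i _; apply Finset.sum_eq_zero; intro j _
    rw [image_eq_zero_of_notMem_tsupport (f := sig lam mu φ i j)
      (fun hh => hx (hs (hst i j hh))), mul_zero])] at h1
  have hI : ∀ i j, Integrable (fun x => pd (wc w i) j x * sig lam mu φ i j x) := fun i j =>
    integrable_mul_of_tsupport (Om_open C) (pd_contOn (Om_open C) (hwi i) j)
      (sig_smooth hφs i j).continuous (hsc i j) ((hst i j).trans hs)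
  have hI2 : ∀ i j, Integrable (fun x => wc w i x * pd (sig lam mu φ i j) j x) := fun i j =>
    integrable_mul_of_tsupport (Om_open C) (hwi i).continuousOn
      (pd_smooth (sig_smooth hφs i j) j).continuous (pd_compact (hsc i j) j)
      ((pd_tsupport _ _).trans ((hst i j).trans hs))
  rw [integral_finsetSum _ (fun i _ => integrable_finsetSum _ (fun j _ => hI i j))] at h1
  have h3 : ∑ i, ∑ j, ∫ x, wc w i x * pd (sig lam mu φ i j) j x = 0 := by
    have : ∀ i j, ∫ x, wc w i x * pd (sig lam mu φ i j) j x
        = - ∫ x, pd (wc w i) j x * sig lam mu φ i j x := fun i j =>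
      ibp (Om_open C) (hwi i) (sig_smooth hφs i j) (hsc i j) ((hst i j).trans hs) j
    simp only [this, Finset.sum_neg_distrib]
    rw [neg_eq_zero, ← h1]
    apply Finset.sum_congr rfl
    intro i _
    rw [integral_finsetSum _ (fun j _ => hI i j)]
  have h4 : ∀ i, ∑ j, ∫ x, wc w i x * pd (sig lam mu φ i j) j x
      = ∫ x, wc w i x * (mu * a i * lapl (lapl Φ) x) := by
    intro i
    rw [← integral_finsetSum _ (fun j _ => hI2 i j)]
    congr 1; funext x
    rw [← Finset.mul_sum]
    congr 1
    -- pointwise identity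
    have hdiv : (fun x => ∑ k, pd (φ k) k x) = fun x => mu * pd (lapl Φ) m x := by
      funext y
      have e1 : ∀ k, pd (φ k) k y = a k * pd (lapl Φ) k y - b * pd (pd (pd Φ m) k) k y := fun k =>
        congrFun (pd_lin hL (hP k) (a k) b k) y
      simp only [e1, Finset.sum_sub_distrib, ← Finset.mul_sum]
      have e2 : ∑ k, pd (pd (pd Φ m) k) k y = pd (lapl Φ) m y := congrFun (lapl_pd hΦ m) y
      rw [e2]
      simp only [ha, ite_mul, zero_mul, Finset.sum_ite_eq', Finset.mem_univ, if_true, hb]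
      ring
    have hσ : ∀ j, pd (sig lam mu φ i j) j x = (if i = j then lam * mu * pd (pd (lapl Φ) m) j x else 0)
        + mu * (pd (pd (φ i) j) j x + pd (pd (φ j) j) i x) := by
      intro j
      have hd1 : DifferentiableAt ℝ (fun y => mu * (pd (φ i) j y + pd (φ j) i y)) x :=
        ((pd_diff (pd_smooth (hφs i) j) x).add (pd_diff (pd_smooth (hφs j) i) x)).const_mul _
      have e1 : sig lam mu φ i j = fun y => (if i = j then lam * (mu * pd (lapl Φ) m y) else 0)
          + mu * (pd (φ i) j y + pd (φ j) i y) := by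
        funext y
        unfold sig
        rw [show ∑ k, pd (φ k) k y = mu * pd (lapl Φ) m y from congrFun hdiv y]
      have e3 : pd (fun y => mu * (pd (φ i) j y + pd (φ j) i y)) j x
          = mu * (pd (pd (φ i) j) j x + pd (pd (φ j) j) i x) := by
        rw [pd_const_mul (f := fun y => pd (φ i) j y + pd (φ j) i y)
          ((pd_diff (pd_smooth (hφs i) j) x).add (pd_diff (pd_smooth (hφs j) i) x)),
          pd_add (pd_diff (pd_smooth (hφs i) j) x) (pd_diff (pd_smooth (hφs j) i) x),
          pd_comm (hφs j) i j]
      rw [e1]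
      by_cases hij : i = j
      · simp only [hij, if_true] at *
        rw [pd_add (((pd_diff (pd_smooth hL m) x).const_mul _).const_mul _) hd1, e3,
          pd_const_mul ((pd_diff (pd_smooth hL m) x).const_mul _),
          pd_const_mul (pd_diff (pd_smooth hL m) x)]
        ring
      · simp only [hij, if_false, zero_add]
        exact e3
    simp only [hσ, Finset.sum_add_distrib, ← Finset.mul_sum, Finset.sum_ite_eq, Finset.mem_univ,
      if_true]
    have e4 : ∑ j, pd (pd (φ j) j) i x = mu * pd (pd (lapl Φ) m) i x := by
      rw [← pd_sum _ (fun j _ => pd_diff (pd_smooth (hφs j) j) x), hdiv,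
        pd_const_mul (pd_diff (pd_smooth hL m) x)]
    have e5 : ∑ j, pd (pd (φ i) j) j x = a i * lapl (lapl Φ) x - b * pd (pd (lapl Φ) m) i x := by
      have : ∀ j, pd (pd (φ i) j) j x = a i * pd (pd (lapl Φ) j) j x
          - b * pd (pd (pd (pd Φ m) i) j) j x := by
        intro j
        have q : pd (φ i) j = _ := pd_lin hL (hP i) (a i) b j
        rw [q, pd_lin (pd_smooth hL j) (pd_smooth (hP i) j)]
      simp only [this, Finset.sum_sub_distrib, ← Finset.mul_sum]
      have q2 : ∑ j, pd (pd (pd (pd Φ m) i) j) j x = pd (pd (lapl Φ) m) i x := by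
        have := congrFun (lapl_pd (pd_smooth hΦ m) i) x
        rw [lapl_pd hΦ m] at this
        exact this
      rw [q2]; rfl
    rw [e4, e5, hb]; ring
  simp only [h4, ha] at h3
  have h5 : ∀ i, ∫ x, wc w i x * (mu * (if i = m then lam + 2 * mu else 0) * lapl (lapl Φ) x)
      = if i = m then mu * (lam + 2 * mu) * ∫ x, wc w m x * lapl (lapl Φ) x else 0 := by
    intro i
    split_ifs with h
    · subst h
      rw [← integral_const_mul]
      congr 1; funext x; ring
    · simp
  simp only [h5, Finset.sum_ite_eq', Finset.mem_univ, if_true] at h3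
  have : mu * (lam + 2 * mu) ≠ 0 := by
    have : 0 < lam + 2 * mu := by linarith
    positivity
  exact (mul_eq_zero.1 h3).resolve_left this

lemma wc_rep {lam mu p : ℝ} (hmu : 0 < mu) (hlam : 0 < 3 * lam + 2 * mu) {C : Set E3}
    {w : E3 → E3} (hw : IsNormalizedSolution lam mu p C w) (m : Fin 3) : KRep (Om C) (wc w m) :=
  rep_of_weak (Om_open C) (wc_contDiffOn hw.2.1 m).continuousOn (weak_biharm hmu hlam hw m)

lemma rep_smul {U : Set E3} {f : E3 → ℝ} (hf : KRep U f) (c : ℝ) : KRep U (fun x => c * f x) := by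
  refine ⟨continuousOn_const.mul hf.1, fun x r hr hb => ?_⟩
  simp only [mul_assoc, integral_const_mul]
  rw [← hf.2 x r hr hb]

/-- the normalized scalar -/
def ff (p : ℝ) (w : E3 → E3) (x : E3) : ℝ := p⁻¹ * pd (wc w 0) 0 x

lemma ff_rep {lam mu p : ℝ} (hmu : 0 < mu) (hlam : 0 < 3 * lam + 2 * mu) {C : Set E3}
    {w : E3 → E3} (hw : IsNormalizedSolution lam mu p C w) : KRep (Om C) (ff p w) :=
  rep_smul (rep_dd (Om_open C) (wc_rep hmu hlam hw 0) (eb 0)) _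

end

open MeasureTheory Metric Set
noncomputable section
open scoped ContDiff Topology Manifold
open Filter

lemma trans_L2 {S G : E3 → ℝ} (hS : MemLp S 2 volume) (hG : MemLp G 2 volume) (ν : E3) :
    Tendsto (fun t : ℝ => ∫ x, S x * G (x + t • ν)) (𝓝 0) (𝓝 (∫ x, S x * G x)) := by
  haveI : Fact ((1:ENNReal) ≤ 2) := ⟨by norm_num⟩
  let g : ℝ → C(E3, E3) := fun t => ⟨fun x => x + t • ν, by fun_prop⟩
  have hg : Continuous g := by
    apply ContinuousMap.continuous_of_continuous_uncurry
    simp only [g, Function.uncurry]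
    change Continuous fun a : ℝ × E3 => a.2 + a.1 • ν
    fun_prop
  have hmp : ∀ t, MeasurePreserving (g t) (volume : Measure E3) volume := fun t =>
    measurePreserving_add_right volume (t • ν)
  have h1 := Tendsto.compMeasurePreservingLp (f := fun _ : ℝ => hG.toLp G) (l := 𝓝 (0:ℝ))
    tendsto_const_nhds (hg.tendsto 0) hmp (hmp 0) (by norm_num)
  have h2 : Tendsto (fun t => inner ℝ (hS.toLp S) (Lp.compMeasurePreserving (g t) (hmp t) (hG.toLp G)))
      (𝓝 0) (𝓝 (inner ℝ (hS.toLp S) (Lp.compMeasurePreserving (g 0) (hmp 0) (hG.toLp G)))) :=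
    tendsto_const_nhds.inner h1
  have h3 : ∀ t, inner ℝ (hS.toLp S) (Lp.compMeasurePreserving (g t) (hmp t) (hG.toLp G))
      = ∫ x, S x * G (x + t • ν) := by
    intro t
    rw [Lp.toLp_compMeasurePreserving, L2.inner_def]
    apply integral_congr_ae
    filter_upwards [hS.coeFn_toLp, (hG.comp_measurePreserving (hmp t)).coeFn_toLp] with x hx hy
    rw [hx, hy]
    simp [g, mul_comm]
  simp only [h3] at h2
  simpa using h2

lemma smooth_ury {s t : Set E3} (hs : IsClosed s) (ht : IsClosed t) (hd : Disjoint s t) :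
    ∃ η : E3 → ℝ, ContDiff ℝ ∞ η ∧ (∀ᶠ x in 𝓝ˢ s, η x = 0) ∧ (∀ᶠ x in 𝓝ˢ t, η x = 1) := by
  obtain ⟨f, h0, h1, -⟩ := exists_contMDiffMap_zero_one_nhds_of_isClosed 𝓘(ℝ, E3) (n := ⊤) hs ht hd
  exact ⟨f, f.contMDiff.contDiff, h0, h1⟩

lemma memLp_bdd_mul {Ω : Set E3} {b F : E3 → ℝ} (hb : Continuous b) (hc : HasCompactSupport b)
    (hF : MemLp F 2 (volume.restrict Ω)) : MemLp (fun x => b x * F x) 2 (volume.restrict Ω) := by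
  obtain ⟨C, hC⟩ := hb.bounded_above_of_compact_support hc
  refine hF.of_le_mul (c := C) (hb.aestronglyMeasurable.mul hF.1) (Eventually.of_forall fun x => ?_)
  rw [norm_mul]
  exact mul_le_mul_of_nonneg_right (hC x) (norm_nonneg _)

/-- data for the density argument -/
structure DD (Ω : Set E3) (S : Fin 3 → E3 → ℝ) (h : E3 → ℝ) : Prop where
  op : IsOpen Ω
  hS : ∀ j, MemLp (S j) 2 (volume.restrict Ω)
  hS0 : ∀ φ : E3 → ℝ, ContDiff ℝ ∞ φ → HasCompactSupport φ →
    ∑ j, ∫ x in Ω, S j x * pd φ j x = 0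
  hh : ContDiffOn ℝ ∞ h Ω
  hh1 : ∀ j, MemLp (pd h j) 2 (volume.restrict Ω)
  hh0 : MemLp (fun x => h x / √(1 + ‖x‖^2)) 2 (volume.restrict Ω)

lemma DD.diff {Ω : Set E3} {S : Fin 3 → E3 → ℝ} {h : E3 → ℝ} (D : DD Ω S h) {x : E3} (hx : x ∈ Ω) :
    DifferentiableAt ℝ h x := (D.hh.contDiffAt (D.op.mem_nhds hx)).differentiableAt (by simp)

lemma DD.pdmul {Ω : Set E3} {S : Fin 3 → E3 → ℝ} {h : E3 → ℝ} (D : DD Ω S h) {ζ : E3 → ℝ}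
    (hζ : ContDiff ℝ ∞ ζ) {x : E3} (hx : x ∈ Ω) (j : Fin 3) :
    pd (fun x => ζ x * h x) j x = pd ζ j x * h x + ζ x * pd h j x :=
  pd_mul (pd_diff hζ x) (D.diff hx) j

lemma DD.memLp {Ω : Set E3} {S : Fin 3 → E3 → ℝ} {h : E3 → ℝ} (D : DD Ω S h) {ζ : E3 → ℝ}
    (hζ : ContDiff ℝ ∞ ζ) (hc : HasCompactSupport ζ) (j : Fin 3) :
    MemLp (pd (fun x => ζ x * h x) j) 2 (volume.restrict Ω) := by
  have h1 : MemLp (fun x => (pd ζ j x * √(1 + ‖x‖^2)) * (h x / √(1 + ‖x‖^2))) 2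
      (volume.restrict Ω) := by
    apply memLp_bdd_mul ((pd_smooth hζ j).continuous.mul (by fun_prop)) ((pd_compact hc j).mul_right)
      D.hh0
  have h2 : MemLp (fun x => ζ x * pd h j x) 2 (volume.restrict Ω) :=
    memLp_bdd_mul hζ.continuous hc (D.hh1 j)
  apply (h1.add h2).ae_eq
  filter_upwards [self_mem_ae_restrict D.op.measurableSet] with x hx
  rw [D.pdmul hζ hx]
  have : √(1 + ‖x‖^2) ≠ 0 := by positivity
  simp only [Pi.add_apply]
  field_simp

lemma dens_local {Ω : Set E3} {S : Fin 3 → E3 → ℝ} {h : E3 → ℝ} (D : DD Ω S h) {P ν : E3}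
    {δ τ : ℝ} (hτ : 0 < τ) (hcone : ∀ x ∈ closure Ω ∩ ball P δ, ∀ t ∈ Ioo 0 τ, x + t • ν ∈ Ω)
    {ζ : E3 → ℝ} (hζ : ContDiff ℝ ∞ ζ) (hc : HasCompactSupport ζ) (hs : tsupport ζ ⊆ ball P δ) :
    ∑ j, ∫ x in Ω, S j x * pd (fun x => ζ x * h x) j x = 0 := by
  set K := tsupport ζ with hK
  set g : E3 → ℝ := fun x => ζ x * h x with hg
  obtain ⟨ε, hε, hεb⟩ := hc.exists_cthickening_subset_open isOpen_ball hs
  have hgz : ∀ y, y ∉ K → g =ᶠ[𝓝 y] fun _ => 0 := by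
    intro y hy
    filter_upwards [(isClosed_tsupport ζ).isOpen_compl.mem_nhds hy] with z hz
    simp only [g]
    rw [image_eq_zero_of_notMem_tsupport hz, zero_mul]
  have hgs : ∀ y, y ∈ Ω ∪ Kᶜ → ContDiffAt ℝ ∞ g y := by
    rintro y (hy | hy)
    · exact hζ.contDiffAt.mul (D.hh.contDiffAt (D.op.mem_nhds hy))
    · exact contDiffAt_const.congr_of_eventuallyEq (hgz y hy)
  have hpz : ∀ j y, y ∉ K → pd g j y = 0 := by
    intro j y hy
    unfold pd
    rw [(hgz y hy).fderiv_eq]; simp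
  set G : Fin 3 → E3 → ℝ := fun j => Ω.indicator (pd g j) with hG
  have hGL : ∀ j, MemLp (G j) 2 volume := fun j =>
    (memLp_indicator_iff_restrict D.op.measurableSet).2 (D.memLp hζ hc j)
  have hSL : ∀ j, MemLp (Ω.indicator (S j)) 2 volume := fun j =>
    (memLp_indicator_iff_restrict D.op.measurableSet).2 (D.hS j)
  have key : ∀ᶠ t in 𝓝[>] (0:ℝ), ∑ j, ∫ x, Ω.indicator (S j) x * G j (x + t • ν) = 0 := by
    have hpos : 0 < min τ (ε / (‖ν‖ + 1)) := by positivity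
    filter_upwards [Ioo_mem_nhdsGT hpos] with t ht
    have ht1 : t ∈ Ioo 0 τ := ⟨ht.1, ht.2.trans_le (min_le_left _ _)⟩
    have ht2 : t * ‖ν‖ ≤ ε := by
      have := ht.2.trans_le (min_le_right _ _)
      rw [lt_div_iff₀ (by positivity)] at this
      nlinarith [ht.1]
    set U := (fun x : E3 => x + t • ν) ⁻¹' (Ω ∪ Kᶜ) with hU
    have hUo : IsOpen U := (D.op.union (isClosed_tsupport ζ).isOpen_compl).preimage (by fun_prop)
    have hΩU : closure Ω ⊆ U := by
      intro x hx
      by_cases hb : x ∈ ball P δ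
      · exact Or.inl (hcone x ⟨hx, hb⟩ t ht1)
      · right
        intro hxK
        apply hb
        apply hεb
        apply mem_cthickening_of_dist_le x (x + t • ν) ε K hxK
        rw [dist_eq_norm, sub_add_cancel_left, norm_neg, norm_smul, Real.norm_of_nonneg ht.1.le]
        exact ht2
    obtain ⟨η, hη, hη0, hη1⟩ := smooth_ury hUo.isClosed_compl (isClosed_closure (s := Ω))
      (disjoint_compl_left_iff_subset.2 hΩU)
    rw [eventually_nhdsSet_iff_forall] at hη0 hη1
    set v : E3 → ℝ := fun x => η x * g (x + t • ν) with hv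
    have hvs : ContDiff ℝ ∞ v := by
      rw [contDiff_iff_contDiffAt]
      intro x
      by_cases hx : x ∈ U
      · exact hη.contDiffAt.mul ((hgs _ hx).comp x (f := fun x : E3 => x + t • ν)
          (contDiffAt_id.add contDiffAt_const))
      · apply (contDiffAt_const (c := (0:ℝ))).congr_of_eventuallyEq
        filter_upwards [hη0 x hx] with z hz
        simp only [v]; rw [hz, zero_mul]
    have hvc : HasCompactSupport v := by
      apply HasCompactSupport.of_support_subset_isCompact
        (hc.image (f := fun x : E3 => x - t • ν) (by fun_prop))
      intro x hx
      refine ⟨x + t • ν, ?_, by simp⟩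
      by_contra hn
      apply hx
      simp only [v, g]
      rw [image_eq_zero_of_notMem_tsupport hn]; simp
    rw [← D.hS0 v hvs hvc]
    apply Finset.sum_congr rfl
    intro j _
    rw [← integral_indicator D.op.measurableSet]
    congr 1; funext x
    by_cases hx : x ∈ Ω
    · rw [indicator_of_mem hx, indicator_of_mem hx]
      congr 1
      have e1 : pd v j x = pd g j (x + t • ν) := by
        have : v =ᶠ[𝓝 x] fun x => g (x + t • ν) := by
          filter_upwards [hη1 x (subset_closure hx)] with z hz
          simp only [v]; rw [hz, one_mul]
        unfold pd
        rw [this.fderiv_eq, fderiv_comp_add_right]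
      rw [e1]
      rcases hΩU (subset_closure hx) with hy | hy
      · exact indicator_of_mem hy _
      · rw [hpz j _ hy]
        simp only [G]
        by_cases hyΩ : x + t • ν ∈ Ω
        · rw [indicator_of_mem hyΩ, hpz j _ hy]
        · rw [indicator_of_notMem hyΩ]
    · rw [indicator_of_notMem hx, indicator_of_notMem hx, zero_mul]
  have hlim : Tendsto (fun t : ℝ => ∑ j, ∫ x, Ω.indicator (S j) x * G j (x + t • ν)) (𝓝[>] 0)
      (𝓝 (∑ j, ∫ x, Ω.indicator (S j) x * G j x)) :=
    (tendsto_finset_sum _ fun j _ => trans_L2 (hSL j) (hGL j) ν).mono_left nhdsWithin_le_nhds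
  have h0 : ∑ j, ∫ x, Ω.indicator (S j) x * G j x = 0 :=
    tendsto_nhds_unique hlim (tendsto_const_nhds.congr' (key.mono fun t ht => ht.symm))
  rw [← h0]
  apply Finset.sum_congr rfl
  intro j _
  rw [← integral_indicator D.op.measurableSet]
  congr 1; funext x
  by_cases hx : x ∈ Ω
  · simp [hx, G]
  · simp [hx]

/-- local cone condition -/
def ConeCond (Ω : Set E3) : Prop := ∀ P : E3, ∃ (ν : E3) (δ τ : ℝ), 0 < δ ∧ 0 < τ ∧
  ∀ x ∈ closure Ω ∩ ball P δ, ∀ t ∈ Ioo 0 τ, x + t • ν ∈ Ω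

lemma DD.int {Ω : Set E3} {S : Fin 3 → E3 → ℝ} {h : E3 → ℝ} (D : DD Ω S h) {ζ : E3 → ℝ}
    (hζ : ContDiff ℝ ∞ ζ) (hc : HasCompactSupport ζ) (j : Fin 3) :
    Integrable (fun x => S j x * pd (fun x => ζ x * h x) j x) (volume.restrict Ω) :=
  (D.hS j).integrable_mul (D.memLp hζ hc j)

lemma dens_compact {Ω : Set E3} {S : Fin 3 → E3 → ℝ} {h : E3 → ℝ} (D : DD Ω S h) (hC : ConeCond Ω)
    {ζ : E3 → ℝ} (hζ : ContDiff ℝ ∞ ζ) (hc : HasCompactSupport ζ) :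
    ∑ j, ∫ x in Ω, S j x * pd (fun x => ζ x * h x) j x = 0 := by
  have := IsCompact.induction_on (s := tsupport ζ) hc
    (p := fun s => ∃ U, IsOpen U ∧ s ⊆ U ∧ ∀ ζ : E3 → ℝ, ContDiff ℝ ∞ ζ → HasCompactSupport ζ →
      tsupport ζ ⊆ U → ∑ j, ∫ x in Ω, S j x * pd (fun x => ζ x * h x) j x = 0) ?_ ?_ ?_ ?_
  · obtain ⟨U, -, hU, h⟩ := this
    exact h ζ hζ hc hU
  · refine ⟨∅, isOpen_empty, le_rfl, fun ζ hζ _ hs => ?_⟩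
    have : ζ = fun _ => 0 := by
      funext x
      apply image_eq_zero_of_notMem_tsupport
      intro hx; exact hs hx
    subst this
    simp [pd]
  · rintro s t hst ⟨U, hU, h1, h2⟩
    exact ⟨U, hU, hst.trans h1, h2⟩
  · rintro s t ⟨U, hU, hsU, h1⟩ ⟨V, hV, htV, h2⟩
    refine ⟨U ∪ V, hU.union hV, union_subset_union hsU htV, fun ζ hζ hc hs => ?_⟩
    obtain ⟨η, hη, hη0, hη1⟩ := smooth_ury (s := tsupport ζ \ U) (t := tsupport ζ \ V)
      ((isClosed_tsupport ζ).sdiff hU) ((isClosed_tsupport ζ).sdiff hV) (by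
        rw [disjoint_left]
        rintro x ⟨hx, hxU⟩ ⟨_, hxV⟩
        rcases hs hx with h | h
        · exact hxU h
        · exact hxV h)
    rw [eventually_nhdsSet_iff_forall] at hη0 hη1
    have hs1 : tsupport (fun x => η x * ζ x) ⊆ U := by
      intro x hx
      by_contra hn
      have hxζ : x ∈ tsupport ζ := (tsupport_mul_subset_right (f := η) (g := ζ)) hx
      have := hη0 x ⟨hxζ, hn⟩
      apply notMem_tsupport_iff_eventuallyEq.2 _ hx
      filter_upwards [this] with z hz
      simp [hz]
    have hs2 : tsupport (fun x => (1 - η x) * ζ x) ⊆ V := by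
      intro x hx
      by_contra hn
      have hxζ : x ∈ tsupport ζ := (tsupport_mul_subset_right (f := fun x => 1 - η x) (g := ζ)) hx
      have := hη1 x ⟨hxζ, hn⟩
      apply notMem_tsupport_iff_eventuallyEq.2 _ hx
      filter_upwards [this] with z hz
      simp [hz]
    have hsm1 : ContDiff ℝ ∞ (fun x => η x * ζ x) := hη.mul hζ
    have hsm2 : ContDiff ℝ ∞ (fun x => (1 - η x) * ζ x) := (contDiff_const.sub hη).mul hζ
    have hc1 : HasCompactSupport (fun x => η x * ζ x) := hc.mul_left
    have hc2 : HasCompactSupport (fun x => (1 - η x) * ζ x) := hc.mul_left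
    have e1 := h1 _ hsm1 hc1 hs1
    have e2 := h2 _ hsm2 hc2 hs2
    rw [← add_zero (0:ℝ)]
    nth_rewrite 1 [← e1]
    rw [← e2, ← Finset.sum_add_distrib]
    apply Finset.sum_congr rfl
    intro j _
    rw [← integral_add (D.int hsm1 hc1 j) (D.int hsm2 hc2 j)]
    apply setIntegral_congr_fun D.op.measurableSet
    intro x hx
    have d := D.diff hx
    simp only
    rw [← mul_add, ← pd_add (f := fun x => η x * ζ x * h x) (g := fun x => (1 - η x) * ζ x * h x)
      ((pd_diff hsm1 x).mul d) ((pd_diff hsm2 x).mul d)]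
    congr 2
    funext y; ring
  · intro P _
    obtain ⟨ν, δ, τ, hδ, hτ, hcone⟩ := hC P
    exact ⟨ball P δ, mem_nhdsWithin_of_mem_nhds (ball_mem_nhds P hδ), ball P δ, isOpen_ball, le_rfl,
      fun ζ hζ hc hs => dens_local D hτ hcone hζ hc hs⟩

lemma pd_scale {θ : E3 → ℝ} (hθ : ContDiff ℝ ∞ θ) (c : ℝ) (j : Fin 3) (x : E3) :
    pd (fun y => θ (c • y)) j x = c * pd θ j (c • x) := by
  unfold pd
  have h1 : HasFDerivAt (fun y : E3 => c • y) (c • ContinuousLinearMap.id ℝ E3) x :=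
    (c • ContinuousLinearMap.id ℝ E3).hasFDerivAt
  have h2 := ((pd_diff hθ (c • x)).hasFDerivAt.comp x h1).fderiv
  have h3 : fderiv ℝ (fun y => θ (c • y)) x = _ := h2
  rw [h3]
  simp

theorem density {Ω : Set E3} {S : Fin 3 → E3 → ℝ} {h : E3 → ℝ} (D : DD Ω S h) (hC : ConeCond Ω) :
    ∑ j, ∫ x in Ω, S j x * pd h j x = 0 := by
  let θ : ContDiffBump (0 : E3) := ⟨1, 2, by norm_num, by norm_num⟩
  have hθ : ContDiff ℝ ∞ θ := θ.contDiff
  have hθc : HasCompactSupport θ := θ.hasCompactSupport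
  have hB : ∀ j, ∃ B : ℝ, ∀ x, ‖pd θ j x‖ ≤ B := fun j =>
    (pd_smooth hθ j).continuous.bounded_above_of_compact_support (pd_compact hθc j)
  choose B hB using hB
  set c : ℕ → ℝ := fun n => ((n:ℝ) + 1)⁻¹ with hc
  have hc0 : ∀ n, 0 < c n := fun n => by positivity
  have hcl : Tendsto c atTop (𝓝 0) := by
    simpa [hc, one_div] using tendsto_one_div_add_atTop_nhds_zero_nat (𝕜 := ℝ)
  have hsm : ∀ n, ContDiff ℝ ∞ (fun y => θ (c n • y)) := fun n =>
    hθ.comp (contDiff_const_smul (c n))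
  have hcs : ∀ n, HasCompactSupport (fun y => θ (c n • y)) := fun n =>
    hθc.comp_homeomorph (Homeomorph.smulOfNeZero (c n) (hc0 n).ne')
  have h0 : ∀ n, ∑ j, ∫ x in Ω, S j x * pd (fun y => θ (c n • y) * h y) j x = 0 := fun n =>
    dens_compact D hC (hsm n) (hcs n)
  have hlim : ∀ j, Tendsto (fun n => ∫ x in Ω, S j x * pd (fun y => θ (c n • y) * h y) j x) atTop
      (𝓝 (∫ x in Ω, S j x * pd h j x)) := by
    intro j
    apply tendsto_integral_of_dominated_convergence
      (fun x => 3 * |B j| * ‖S j x * (h x / √(1 + ‖x‖^2))‖ + ‖S j x * pd h j x‖)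
    · intro n; exact (D.int (hsm n) (hcs n) j).1
    · exact (((D.hS j).integrable_mul D.hh0).norm.const_mul _).add
        (((D.hS j).integrable_mul (D.hh1 j)).norm)
    · intro n
      filter_upwards [self_mem_ae_restrict D.op.measurableSet] with x hx
      rw [D.pdmul (hsm n) hx, mul_add]
      refine (norm_add_le _ _).trans (add_le_add ?_ ?_)
      · rw [pd_scale hθ, norm_mul, norm_mul, norm_mul, norm_mul, norm_div]
        have hq : ‖c n‖ * ‖pd θ j (c n • x)‖ ≤ 3 * |B j| / √(1 + ‖x‖^2) := by
          rw [Real.norm_of_nonneg (hc0 n).le]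
          by_cases h2 : 2 < ‖c n • x‖
          · have : pd θ j (c n • x) = 0 := by
              apply image_eq_zero_of_notMem_tsupport
              intro hh
              have := pd_tsupport _ _ hh
              rw [θ.tsupport_eq, mem_closedBall_zero_iff] at this
              exact absurd this (not_le.2 h2)
            rw [this, norm_zero, mul_zero]; positivity
          · push Not at h2
            rw [norm_smul, Real.norm_of_nonneg (hc0 n).le] at h2
            have h3 : c n * √(1 + ‖x‖^2) ≤ 3 := by
              have h4 : √(1 + ‖x‖^2) ≤ 1 + ‖x‖ := by
                rw [Real.sqrt_le_left (by positivity)]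
                nlinarith [norm_nonneg x]
              have h5 : c n ≤ 1 := by
                simp only [hc]
                apply inv_le_one_of_one_le₀
                have : (0:ℝ) ≤ n := by positivity
                linarith
              nlinarith [hc0 n]
            rw [le_div_iff₀ (by positivity)]
            have h6 := (hB j (c n • x)).trans (le_abs_self _)
            calc c n * ‖pd θ j (c n • x)‖ * √(1 + ‖x‖^2)
                = (c n * √(1 + ‖x‖^2)) * ‖pd θ j (c n • x)‖ := by ring
              _ ≤ 3 * |B j| := by gcongr
        calc ‖S j x‖ * (‖c n‖ * ‖pd θ j (c n • x)‖ * ‖h x‖)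
            ≤ ‖S j x‖ * (3 * |B j| / √(1 + ‖x‖^2) * ‖h x‖) := by gcongr
          _ = _ := by
            rw [Real.norm_of_nonneg (Real.sqrt_nonneg _)]
            ring
      · rw [norm_mul, norm_mul, norm_mul]
        have : ‖θ (c n • x)‖ ≤ 1 := by
          rw [Real.norm_of_nonneg θ.nonneg]; exact θ.le_one
        apply mul_le_mul_of_nonneg_left _ (norm_nonneg _)
        nlinarith [norm_nonneg (pd h j x)]
    · filter_upwards [self_mem_ae_restrict D.op.measurableSet] with x hx
      apply tendsto_const_nhds.congr'
      have : Tendsto (fun n => c n * (‖x‖ + 1)) atTop (𝓝 (0 * (‖x‖ + 1))) := hcl.mul_const _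
      rw [zero_mul] at this
      filter_upwards [this.eventually (gt_mem_nhds zero_lt_one)] with n hn
      have hnear : (fun y => θ (c n • y) * h y) =ᶠ[𝓝 x] h := by
        filter_upwards [ball_mem_nhds x zero_lt_one] with y hy
        rw [θ.one_of_mem_closedBall, one_mul]
        rw [mem_closedBall_zero_iff, norm_smul, Real.norm_of_nonneg (hc0 n).le]
        rw [mem_ball, dist_eq_norm] at hy
        have : ‖y‖ ≤ ‖x‖ + 1 := by linarith [norm_le_norm_add_norm_sub x y, norm_sub_rev x y]
        change c n * ‖y‖ ≤ 1
        nlinarith [hc0 n]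
      unfold pd
      rw [hnear.fderiv_eq]
  have hs := tendsto_finset_sum Finset.univ (fun j _ => hlim j)
  simp only [h0] at hs
  exact (tendsto_nhds_unique hs tendsto_const_nhds)

end


open MeasureTheory Metric Set
noncomputable section
open scoped ContDiff Topology
open Filter

lemma div_half (φ : Fin 3 → E3 → ℝ) (h : ∀ i, ContDiff ℝ ∞ (φ i))
    (hc : ∀ i, HasCompactSupport (φ i)) :
    ∫ x in lowerHalf, ∑ i, pd (φ i) i x = ∫ x' : E2, φ 2 (emb2 x') := by
  have hR : ∀ i, ∃ R : ℝ, ∀ x, R ≤ ‖x‖ → φ i x = 0 := by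
    intro i
    obtain ⟨R, hR⟩ := (hc i).isCompact.isBounded.subset_ball 0
    refine ⟨R, fun x hx => image_eq_zero_of_notMem_tsupport fun hx' => ?_⟩
    have := hR hx'
    rw [mem_ball_zero_iff] at this
    linarith
  choose R0 hR0 using hR
  obtain ⟨R, hRpos, hR⟩ : ∃ R : ℝ, 0 < R ∧ ∀ i x, R ≤ ‖x‖ → φ i x = 0 := by
    refine ⟨1 + ∑ i, |R0 i|, by positivity, fun i x hx => hR0 i x (le_trans ?_ hx)⟩
    have : |R0 i| ≤ ∑ i, |R0 i| := Finset.single_le_sum (f := fun i => |R0 i|) (fun _ _ => abs_nonneg _) (Finset.mem_univ i)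
    linarith [le_abs_self (R0 i)]
  have hRc : ∀ i (x : E3) j, R ≤ |x j| → φ i x = 0 := fun i x j hx =>
    hR i x (hx.trans (by simpa using PiLp.norm_apply_le x j))
  have hRp : ∀ i k (x : E3) j, R < |x j| → pd (φ i) k x = 0 := by
    intro i k x j hx
    have : φ i =ᶠ[𝓝 x] fun _ => 0 := by
      have : ∀ᶠ y : E3 in 𝓝 x, R < |y j| := by
        have hcont : Continuous (fun y : E3 => |y j|) := by fun_prop
        exact hcont.continuousAt.eventually (lt_mem_nhds hx)
      filter_upwards [this] with y hy
      exact hRc i y j hy.le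
    unfold pd
    rw [this.fderiv_eq]; simp
  let L : (Fin 3 → ℝ) →L[ℝ] E3 := (EuclideanSpace.equiv (Fin 3) ℝ).symm.toContinuousLinearMap
  let a : Fin 3 → ℝ := fun _ => -R
  let b : Fin 3 → ℝ := ![R, R, 0]
  have hL : ∀ x i, L x i = x i := fun x i => rfl
  have hab : a ≤ b := by
    intro i; fin_cases i <;> simp [a, b] <;> linarith
  have hLs : ∀ i, L (Pi.single i 1) = eb i := by
    intro i; ext j; rw [hL]; simp [Pi.single_apply]
  have key := integral_divergence_of_hasFDerivAt_off_countable' a b hab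
    (fun i x => φ i (L x)) (fun i x => (fderiv ℝ (φ i) (L x)).comp L) ∅ countable_empty
    (fun i => ((h i).continuous.comp L.continuous).continuousOn)
    (fun x _ i => ((pd_diff (h i) (L x)).hasFDerivAt).comp x L.hasFDerivAt)
    (by
      apply Continuous.integrableOn_Icc
      apply continuous_finsetSum
      intro i _
      have := ((pd_smooth (h i) i).continuous.comp L.continuous)
      simp only [ContinuousLinearMap.comp_apply, hLs]
      exact this)
  simp only [ContinuousLinearMap.comp_apply, hLs] at key
  have hside : ∀ i : Fin 3, ∀ t : ℝ, R ≤ |t| → ∀ y : Fin 2 → ℝ, φ i (L (i.insertNth t y)) = 0 := by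
    intro i t ht y
    apply hRc i _ i
    rw [hL]; simpa using ht
  have hRa : R ≤ |(-R)| := by rw [abs_neg]; exact le_abs_self R
  have hRb : R ≤ |R| := le_abs_self R
  rw [Fin.sum_univ_three] at key
  simp only [a, b, Matrix.cons_val_zero, Matrix.cons_val_one, hside 0 R hRb,
    hside 1 R hRb, hside 0 (-R) hRa, hside 1 (-R) hRa, hside 2 (-R) hRa, integral_zero, sub_zero,
    zero_add] at key
  have e1 : ∫ x in lowerHalf, ∑ i, pd (φ i) i x = ∫ x in Icc a b, ∑ i, pd (φ i) i (L x) := by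
    have hmp := (PiLp.volume_preserving_toLp (Fin 3))
    have h1 : ∫ x in lowerHalf, ∑ i, pd (φ i) i x
        = ∫ x in (L ⁻¹' lowerHalf), ∑ i, pd (φ i) i (L x) :=
      (hmp.setIntegral_preimage_emb (MeasurableEquiv.toLp 2 (Fin 3 → ℝ)).measurableEmbedding _ _).symm
    rw [h1]
    have hlow : L ⁻¹' lowerHalf = {x | x 2 < 0} := rfl
    have hae : (L ⁻¹' lowerHalf : Set (Fin 3 → ℝ)) =ᵐ[volume] {x | x 2 ≤ 0} := by
      rw [hlow]
      have hz : volume {x : Fin 3 → ℝ | x 2 = 0} = 0 := by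
        have := MeasureTheory.Measure.pi_hyperplane (fun _ : Fin 3 => (volume : Measure ℝ)) 2 0
        simpa [volume_pi] using this
      have hz' : ∀ᵐ x : Fin 3 → ℝ, x 2 ≠ 0 := by
        rw [ae_iff]; simpa using hz
      filter_upwards [hz'] with x hx
      apply propext
      show x 2 < 0 ↔ x 2 ≤ 0
      exact ⟨le_of_lt, fun h => lt_of_le_of_ne h hx⟩
    rw [setIntegral_congr_set hae]
    apply setIntegral_eq_of_subset_of_forall_sdiff_eq_zero
    · exact measurableSet_le (measurable_pi_apply 2) measurable_const
    · intro x hx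
      have := hx.2 2
      simpa [b] using this
    · rintro x ⟨hx, hx2⟩
      have : ∃ j, R < |x j| := by
        by_contra hn
        push Not at hn
        apply hx2
        refine ⟨fun j => (abs_le.1 (hn j)).1, fun j => ?_⟩
        have h3 := fun j => (abs_le.1 (hn j)).2
        have hx' : x 2 ≤ 0 := hx
        fin_cases j
        · exact h3 0
        · exact h3 1
        · exact hx'
      obtain ⟨j, hj⟩ := this
      apply Finset.sum_eq_zero
      intro i _
      exact hRp i i (L x) j hj
  rw [e1]
  refine key.trans ?_
  have hmp2 := (PiLp.volume_preserving_toLp (Fin 2))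
  have h2 : ∫ x' : E2, φ 2 (emb2 x') = ∫ y : Fin 2 → ℝ, φ 2 (emb2 (WithLp.toLp 2 y)) :=
    (hmp2.integral_comp (MeasurableEquiv.toLp 2 (Fin 2 → ℝ)).measurableEmbedding (fun x' => φ 2 (emb2 x'))).symm
  rw [h2]
  have h3 : ∀ y : Fin 2 → ℝ, emb2 (WithLp.toLp 2 y) = L ((2 : Fin 3).insertNth 0 y) := by
    intro y
    ext j
    rw [hL]
    have e : (2 : Fin 3) = Fin.last 2 := rfl
    rw [e, Fin.insertNth_last']
    fin_cases j <;> simp [emb2, Fin.snoc]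
  simp only [h3]
  apply setIntegral_eq_integral_of_forall_compl_eq_zero
  intro y hy
  have : ∃ j, R < |y j| := by
    by_contra hn
    push Not at hn
    apply hy
    refine ⟨fun j => (abs_le.1 (hn j)).1, fun j => ?_⟩
    have h3 := fun j => (abs_le.1 (hn j)).2
    fin_cases j
    · exact h3 0
    · exact h3 1
  obtain ⟨j, hj⟩ := this
  apply hRc 2 _ ((2 : Fin 3).succAbove j)
  rw [hL]
  have : (Matrix.vecCons R ![R, 0] 2 : ℝ) = 0 := rfl
  simpa using hj.le

end


open MeasureTheory Metric Set
noncomputable section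
open scoped ContDiff Topology
open Filter

def tz (D : ℝ) : E3 := (-4 * D) • eb 2

def tbump {D : ℝ} (hD : 0 < D) : ContDiffBump (tz D) :=
  ⟨3.5 * D, 3.9 * D, by positivity, by nlinarith⟩

def tpsi {D : ℝ} (hD : 0 < D) (x : E3) : ℝ := tbump hD x * (‖x‖ ^ 2 / 4)

def tau {D : ℝ} (hD : 0 < D) (i j : Fin 3) (x : E3) : ℝ :=
  (if i = j then lapl (tpsi hD) x else 0) - pd (pd (tpsi hD) i) j x

lemma tpsi_smooth {D : ℝ} (hD : 0 < D) : ContDiff ℝ ∞ (tpsi hD) :=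
  (tbump hD).contDiff.mul ((contDiff_norm_sq ℝ).div_const 4)

lemma tpsi_supp {D : ℝ} (hD : 0 < D) : tsupport (tpsi hD) ⊆ closedBall (tz D) (3.9 * D) := by
  have : tsupport (tpsi hD) ⊆ tsupport (tbump hD) :=
    tsupport_mul_subset_left (f := tbump hD) (g := fun x => ‖x‖^2/4)
  rwa [(tbump hD).tsupport_eq] at this

lemma tau_smooth {D : ℝ} (hD : 0 < D) (i j : Fin 3) : ContDiff ℝ ∞ (tau hD i j) := by
  unfold tau
  have h := tpsi_smooth hD
  split_ifs
  · exact (lapl_smooth h).sub (pd_smooth (pd_smooth h i) j)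
  · exact contDiff_const.sub (pd_smooth (pd_smooth h i) j)

lemma tau_zero {D : ℝ} (hD : 0 < D) (i j : Fin 3) {x : E3} (hx : x ∉ closedBall (tz D) (3.9 * D)) :
    tau hD i j x = 0 := by
  have h0 : x ∉ tsupport (tpsi hD) := fun h => hx (tpsi_supp hD h)
  have h1 : lapl (tpsi hD) x = 0 :=
    image_eq_zero_of_notMem_tsupport (fun h => h0 (lapl_tsupport _ h))
  have h2 : pd (pd (tpsi hD) i) j x = 0 :=
    image_eq_zero_of_notMem_tsupport (fun h => h0 (pd_tsupport _ _ (pd_tsupport _ _ h)))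
  simp [tau, h1, h2]

lemma tau_low {D : ℝ} (hD : 0 < D) (i j : Fin 3) {x : E3} (hx : x ∉ lowerHalf) :
    tau hD i j x = 0 := by
  apply tau_zero
  intro h
  apply hx
  rw [mem_closedBall, dist_eq_norm] at h
  have h1 := (PiLp.norm_apply_le (x - tz D) 2).trans h
  have h2 : (x - tz D) 2 = x 2 + 4 * D := by simp [tz]
  rw [h2, Real.norm_eq_abs] at h1
  have := (abs_le.1 h1).2
  show x 2 < 0
  linarith

lemma tau_compact {D : ℝ} (hD : 0 < D) (i j : Fin 3) : HasCompactSupport (tau hD i j) :=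
  HasCompactSupport.intro (isCompact_closedBall (tz D) (3.9 * D)) fun _ hx => tau_zero hD i j hx

lemma tau_symm {D : ℝ} (hD : 0 < D) (i j : Fin 3) (x : E3) : tau hD i j x = tau hD j i x := by
  unfold tau
  rw [pd_comm (tpsi_smooth hD)]
  simp only [eq_comm]

lemma tau_one {D : ℝ} (hD : 0 < D) (i j : Fin 3) {x : E3} (hx : ‖x‖ ≤ 2 * D) (hx2 : x 2 ≤ -D) :
    tau hD i j x = if i = j then 1 else 0 := by
  have hb : x ∈ ball (tz D) (3.5 * D) := by
    rw [mem_ball, dist_eq_norm]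
    apply lt_of_pow_lt_pow_left₀ 2 (by positivity)
    have e : ‖x - tz D‖^2 = ‖x‖^2 + 8 * D * x 2 + 16 * D^2 := by
      rw [EuclideanSpace.norm_sq_eq, EuclideanSpace.norm_sq_eq]
      simp only [Fin.sum_univ_three, Real.norm_eq_abs, sq_abs]
      simp [tz]
      ring
    rw [e]
    nlinarith [norm_nonneg x]
  have hev : ∀ y ∈ ball (tz D) (3.5 * D), tpsi hD y = ‖y‖^2 / 4 := by
    intro y hy
    have : tbump hD y = 1 := (tbump hD).one_of_mem_closedBall (ball_subset_closedBall hy)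
    simp [tpsi, this]
  have hp1 : ∀ k, ∀ y ∈ ball (tz D) (3.5 * D), pd (tpsi hD) k y = y k / 2 := by
    intro k y hy
    have : tpsi hD =ᶠ[𝓝 y] fun y => ‖y‖^2 / 4 := by
      filter_upwards [isOpen_ball.mem_nhds hy] with z hz using hev z hz
    unfold pd
    rw [this.fderiv_eq]
    have h := ((hasStrictFDerivAt_norm_sq y).hasFDerivAt.const_mul (1/4:ℝ)).fderiv
    have h' : (fun y : E3 => ‖y‖^2/4) = fun y => 1/4 * ‖y‖^2 := by funext y; ring
    rw [h', h]
    simp [PiLp.inner_apply]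
    ring
  have hp2 : ∀ k l, pd (pd (tpsi hD) k) l x = if k = l then 1/2 else 0 := by
    intro k l
    have : pd (tpsi hD) k =ᶠ[𝓝 x] fun y => 1/2 * y k := by
      filter_upwards [isOpen_ball.mem_nhds hb] with z hz
      rw [hp1 k z hz]; ring
    have h3 : pd (pd (tpsi hD) k) l x = pd (fun y => 1/2 * y k) l x := by
      unfold pd
      unfold pd at this
      rw [this.fderiv_eq]
    rw [h3, pd_const_mul (coord_diff k x), pd_coord]
    split_ifs <;> norm_num
  unfold tau lapl
  simp only [hp2, Fin.sum_univ_three]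
  split_ifs <;> norm_num

lemma tau_div {D : ℝ} (hD : 0 < D) (i : Fin 3) {φ : E3 → ℝ} (hφ : ContDiff ℝ ∞ φ)
    (hc : HasCompactSupport φ) : ∫ x, ∑ j, tau hD i j x * pd φ j x = 0 := by
  have hs := tpsi_smooth hD
  have hi : ∀ {g : E3 → ℝ} (_ : ContDiff ℝ ∞ g) (k : Fin 3), Integrable (fun x => g x * pd φ k x) :=
    fun hg k => integrable_mul_of_tsupport isOpen_univ hg.continuous.continuousOn
      (pd_smooth hφ k).continuous (pd_compact hc k) (subset_univ _)
  have hi0 : ∀ {g : E3 → ℝ} (_ : ContDiff ℝ ∞ g), Integrable (fun x => g x * φ x) :=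
    fun hg => integrable_mul_of_tsupport isOpen_univ hg.continuous.continuousOn
      hφ.continuous hc (subset_univ _)
  have e : ∀ x, ∑ j, tau hD i j x * pd φ j x
      = lapl (tpsi hD) x * pd φ i x - ∑ j, pd (pd (tpsi hD) i) j x * pd φ j x := by
    intro x
    simp only [tau, sub_mul, Finset.sum_sub_distrib, ite_mul, zero_mul, Finset.sum_ite_eq,
      Finset.mem_univ, if_true]
  simp only [e]
  have hh : ∀ {g : E3 → ℝ} (_ : ContDiff ℝ ∞ g) (k : Fin 3), ∫ x, g x * pd φ k x = - ∫ x, pd g k x * φ x :=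
    fun hg k => ibp isOpen_univ (hg.of_le (by norm_cast)).contDiffOn hφ hc (subset_univ _) k
  rw [integral_sub (hi (lapl_smooth hs) i)
    (integrable_finsetSum _ fun j _ => hi (pd_smooth (pd_smooth hs i) j) j),
    integral_finsetSum _ fun j _ => hi (pd_smooth (pd_smooth hs i) j) j]
  rw [hh (lapl_smooth hs), ← lapl_pd hs]
  simp only [hh (pd_smooth (pd_smooth hs i) _)]
  rw [Finset.sum_neg_distrib, ← integral_finsetSum _ fun j _ =>
    hi0 (pd_smooth (pd_smooth (pd_smooth hs i) j) j)]
  simp only [lapl, Finset.sum_mul]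
  ring

end


open MeasureTheory Metric Set
noncomputable section
open scoped ContDiff Topology
open Filter

structure Chart (r E : ℝ) (S : Set E3) (P : E3) (φ : E3 ≃ᵢ E3) (ψ : E2 → ℝ) : Prop where
  h0 : φ P = 0
  hψ0 : ψ 0 = 0
  lip : ∀ x ∈ ball (0:E2) r, ∀ y ∈ ball (0:E2) r, |ψ x - ψ y| ≤ E * ‖x - y‖
  mem : ∀ z, ‖φ z‖ < r → (z ∈ S ↔ ψ (proj12 (φ z)) < φ z 2)

lemma chart_exists {r E : ℝ} {S : Set E3} (h : HasC3Boundary r E S) {P : E3}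
    (hP : P ∈ frontier S) : ∃ φ ψ, Chart r E S P φ ψ := by
  obtain ⟨φ, ψ, h1, h2, h3, _, h5, h6⟩ := h P hP
  refine ⟨φ, ψ, h1, h2, ?_, ?_⟩
  · intro x hx y hy
    have := (convex_ball (0:E2) r).norm_image_sub_le_of_norm_fderiv_le (𝕜 := ℝ) (f := ψ) (C := E)
      (fun z _ => (h3.differentiable (by norm_num)) z) (fun z hz => by
        have := h5 z hz 1 (by norm_num)
        rwa [← norm_iteratedFDeriv_fderiv, norm_iteratedFDeriv_zero] at this) hy hx
    simpa using this
  · intro z hz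
    have hz' : φ z ∈ ball (0:E3) r := by simpa using hz
    constructor
    · intro hzS
      have : φ z ∈ (φ '' S) ∩ ball 0 r := ⟨⟨z, hzS, rfl⟩, hz'⟩
      rw [h6] at this
      exact this.2
    · intro hlt
      have : φ z ∈ (φ '' S) ∩ ball 0 r := by rw [h6]; exact ⟨hz', hlt⟩
      obtain ⟨y, hy, hyz⟩ := this.1
      rwa [← φ.injective hyz]

lemma proj12_norm (x : E3) : ‖proj12 x‖ ≤ ‖x‖ := by
  rw [EuclideanSpace.norm_eq, EuclideanSpace.norm_eq]
  apply Real.sqrt_le_sqrt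
  simp [proj12, Fin.sum_univ_three, Fin.sum_univ_two]
  positivity

lemma proj12_sub (x y : E3) : proj12 x - proj12 y = proj12 (x - y) := by
  simp only [proj12, PiLp.sub_apply, sub_smul]; abel

lemma coord_abs (x : E3) (i : Fin 3) : |x i| ≤ ‖x‖ := by
  simpa using PiLp.norm_apply_le x i

lemma eb_norm (k : Fin 3) : ‖eb k‖ = 1 := by simp [eb]

lemma proj12_eb2 (t : ℝ) (x : E3) : proj12 (x + t • eb 2) = proj12 x := by
  simp [proj12, eb]

/-- moving by `t` in the chart vertical direction -/
def mv (φ : E3 ≃ᵢ E3) (t : ℝ) (x : E3) : E3 := φ.symm (φ x + t • eb 2)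

lemma mv_apply (φ : E3 ≃ᵢ E3) (t : ℝ) (x : E3) : φ (mv φ t x) = φ x + t • eb 2 := by simp [mv]

lemma phi_dist (φ : E3 ≃ᵢ E3) (x y : E3) : ‖φ x - φ y‖ = ‖x - y‖ := by
  rw [← dist_eq_norm, ← dist_eq_norm, φ.dist_eq]

lemma mv_dist (φ : E3 ≃ᵢ E3) (s t : ℝ) (x : E3) : ‖mv φ s x - mv φ t x‖ = |s - t| := by
  rw [← phi_dist φ, mv_apply, mv_apply, add_sub_add_left_eq_sub, ← sub_smul, norm_smul, eb_norm]
  simp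

lemma mv_zero (φ : E3 ≃ᵢ E3) (x : E3) : mv φ 0 x = x := by simp [mv]

lemma mv_dist0 (φ : E3 ≃ᵢ E3) (t : ℝ) (x : E3) : ‖mv φ t x - x‖ = |t| := by
  have := mv_dist φ t 0 x
  rwa [mv_zero, sub_zero] at this

lemma mv_lin (φ : E3 ≃ᵢ E3) : ∃ ν : E3, ‖ν‖ = 1 ∧ ∀ t x, mv φ t x = x + t • ν := by
  let A := φ.symm.toRealAffineIsometryEquiv
  refine ⟨A.linearIsometryEquiv (eb 2), ?_, ?_⟩
  · rw [LinearIsometryEquiv.norm_map, eb_norm]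
  · intro t x
    have h := A.map_vadd (φ x) (t • eb 2)
    have hA : ∀ z, A z = φ.symm z := fun z => rfl
    rw [hA, hA] at h
    simp only [vadd_eq_add, φ.symm_apply_apply, map_smul] at h
    rw [mv, add_comm (φ x), h, add_comm]

lemma Chart.norm_eq {r E : ℝ} {S : Set E3} {P : E3} {φ : E3 ≃ᵢ E3} {ψ : E2 → ℝ}
    (c : Chart r E S P φ ψ) (x : E3) : ‖φ x‖ = ‖x - P‖ := by
  have := phi_dist φ x P
  rwa [c.h0, sub_zero] at this

lemma Chart.down {r E : ℝ} {S : Set E3} {P : E3} {φ : E3 ≃ᵢ E3} {ψ : E2 → ℝ}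
    (c : Chart r E S P φ ψ) (hE : 0 < E) {x y : E3} {t : ℝ} (hx : x ∉ S)
    (hxr : ‖x - P‖ < r) (hy : ‖y - mv φ (-t) x‖ * (1 + E) ≤ t) (hyr : ‖y - P‖ < r) : y ∉ S := by
  rw [c.mem y (by rwa [c.norm_eq])]
  rw [c.mem x (by rwa [c.norm_eq])] at hx
  push Not at hx ⊢
  rw [← c.norm_eq] at hxr hyr
  rw [← phi_dist φ, mv_apply] at hy
  set b := φ y
  set a := φ x
  have h1 : ‖proj12 b - proj12 a‖ ≤ ‖b - (a + -t • eb 2)‖ := by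
    rw [← proj12_eb2 (-t) a, proj12_sub]; exact proj12_norm _
  have h2 := c.lip (proj12 b) (by simpa using (proj12_norm b).trans_lt hyr) (proj12 a)
    (by simpa using (proj12_norm a).trans_lt hxr)
  have h3 := coord_abs (b - (a + -t • eb 2)) 2
  have h4 : (b - (a + -t • eb 2)) 2 = b 2 - a 2 + t := by simp [eb]; ring
  rw [h4] at h3
  have h5 := (abs_le.1 h2).1
  have h6 := (abs_le.1 h3).2
  nlinarith

lemma Chart.up {r E : ℝ} {S : Set E3} {P : E3} {φ : E3 ≃ᵢ E3} {ψ : E2 → ℝ}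
    (c : Chart r E S P φ ψ) (hE : 0 < E) {y : E3} {t : ℝ} (hr : 0 < r)
    (hy : ‖y - mv φ t P‖ * (1 + E) < t) (hyr : ‖y - P‖ < r) : y ∈ S := by
  rw [c.mem y (by rwa [c.norm_eq])]
  rw [← c.norm_eq] at hyr
  rw [← phi_dist φ, mv_apply, c.h0, zero_add] at hy
  set b := φ y
  have h1 : ‖proj12 b - 0‖ ≤ ‖b - t • eb 2‖ := by
    have : (0 : E2) = proj12 (t • eb 2) := by simp [proj12, eb]
    rw [this, proj12_sub]; exact proj12_norm _
  have h2 := c.lip (proj12 b) (by simpa using (proj12_norm b).trans_lt hyr) 0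
    (by simpa using hr)
  rw [c.hψ0] at h2
  have h3 := coord_abs (b - t • eb 2) 2
  have h4 : (b - t • eb 2) 2 = b 2 - t := by simp [eb]
  rw [h4] at h3
  have h5 := (abs_le.1 h2).2
  have h6 := (abs_le.1 h3).1
  nlinarith

lemma cl_low {D : ℝ} {C : Set E3} (hC : ∀ x ∈ C, x 2 ≤ -D) : ∀ x ∈ closure C, x 2 ≤ -D := by
  have : IsClosed {x : E3 | x 2 ≤ -D} := isClosed_le (by fun_prop) continuous_const
  intro x hx
  exact closure_minimal hC this hx

lemma cl_norm {D : ℝ} {C : Set E3} (hC : C ⊆ negBall (2 * D)) : ∀ x ∈ closure C, ‖x‖ ≤ 2 * D := by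
  have : IsClosed {x : E3 | ‖x‖ ≤ 2 * D} := isClosed_le (by fun_prop) continuous_const
  intro x hx
  exact closure_minimal (fun y hy => (hC hy).1.le) this hx

lemma notMem_cl {S : Set E3} {x : E3} {s : ℝ} (hs : 0 < s) (h : ∀ y, ‖y - x‖ < s → y ∉ S) :
    x ∉ closure S := by
  intro hx
  obtain ⟨y, hy, hd⟩ := Metric.mem_closure_iff.1 hx s hs
  exact h y (by rwa [← dist_eq_norm, dist_comm]) hy

lemma cone_Om {r E D : ℝ} (hr : 0 < r) (hE : 0 < E) (hD : 0 < D) {C : Set E3}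
    (hC : IsC3Cavity r E D C) : ConeCond (Om C) := by
  obtain ⟨⟨hop, _, hcl, _, hneg, hlow, _⟩, hb⟩ := hC
  intro P
  by_cases h1 : P ∈ closure (Om C)
  swap
  · obtain ⟨δ, hδ, hs⟩ := Metric.isOpen_iff.1 isClosed_closure.isOpen_compl P h1
    exact ⟨0, δ, 1, hδ, one_pos, fun x hx => absurd hx.1 (hs hx.2)⟩
  by_cases h2 : P ∈ Om C
  · obtain ⟨δ, hδ, hs⟩ := Metric.isOpen_iff.1 (Om_open C) P h2
    refine ⟨0, δ, 1, hδ, one_pos, fun x hx t _ => ?_⟩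
    simpa using hs hx.2
  have hle : ∀ x ∈ closure (Om C), x 2 ≤ 0 := by
    have : IsClosed {x : E3 | x 2 ≤ 0} := isClosed_le (by fun_prop) continuous_const
    intro x hx
    exact closure_minimal (fun y hy => by
      have h : y 2 < 0 := hy.1
      exact h.le) this hx
  have hnC : ∀ x ∈ closure (Om C), x ∉ C := by
    have : IsClosed (Cᶜ) := hop.isClosed_compl
    intro x hx
    exact closure_minimal (fun y hy hyC => hy.2 (subset_closure hyC)) this hx
  have hco : ∀ x y : E3, x 2 ≤ y 2 + ‖x - y‖ := by
    intro x y
    have := (abs_le.1 (coord_abs (x - y) 2)).2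
    simp at this
    linarith
  by_cases h3 : P 2 = 0
  · refine ⟨-eb 2, D/2, D/4, by positivity, by positivity, ?_⟩
    rintro x ⟨hx, hxP⟩ t ⟨ht0, ht⟩
    have e : (x + t • -eb 2) 2 = x 2 - t := by simp [eb]; ring
    have hx0 := hle x hx
    rw [mem_ball, dist_eq_norm, norm_sub_rev] at hxP
    have := hco P x
    constructor
    · show (x + t • -eb 2) 2 < 0
      rw [e]; linarith
    · intro hc
      have := cl_low hlow _ hc
      rw [e] at this
      linarith
  · have hP0 : P 2 < 0 := lt_of_le_of_ne (hle P h1) h3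
    have hPc : P ∈ closure C := by
      by_contra hn; exact h2 ⟨hP0, hn⟩
    have hPf : P ∈ frontier C := ⟨hPc, by rw [hop.interior_eq]; exact hnC P h1⟩
    obtain ⟨φ, ψ, c⟩ := chart_exists hb hPf
    obtain ⟨ν, hν, hmv⟩ := mv_lin φ
    set δ := min (r/4) (D/4)
    have hδr : δ ≤ r/4 := min_le_left _ _
    have hδD : δ ≤ D/4 := min_le_right _ _
    have hδ : 0 < δ := by positivity
    refine ⟨-ν, δ, δ, hδ, hδ, ?_⟩
    rintro x ⟨hx, hxP⟩ t ⟨ht0, ht⟩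
    have e : x + t • -ν = mv φ (-t) x := by rw [hmv]; simp
    rw [mem_ball, dist_eq_norm] at hxP
    have hd : ‖mv φ (-t) x - x‖ = t := by rw [mv_dist0, abs_neg, abs_of_pos ht0]
    have hd2 : ‖mv φ (-t) x - P‖ < 2 * δ := by
      have := norm_sub_le_norm_sub_add_norm_sub (mv φ (-t) x) x P
      linarith
    rw [e]
    constructor
    · show mv φ (-t) x 2 < 0
      have := hco (mv φ (-t) x) P
      have := cl_low hlow P hPc
      linarith
    · apply notMem_cl (s := t / (1 + E)) (by positivity)
      intro y hy
      have hy' : ‖y - mv φ (-t) x‖ * (1 + E) ≤ t := by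
        rw [lt_div_iff₀ (by positivity)] at hy; exact hy.le
      apply c.down hE (hnC x hx) (by linarith) hy'
      have : t / (1 + E) ≤ t := div_le_self ht0.le (by linarith)
      have := norm_sub_le_norm_sub_add_norm_sub y (mv φ (-t) x) P
      linarith

end


open MeasureTheory Metric Set
noncomputable section
open scoped ContDiff Topology
open Filter

def uc (c : ℝ) (w : E3 → E3) (i : Fin 3) (x : E3) : ℝ := wc w i x + c * x i

lemma uc_smooth {lam mu p : ℝ} (hmu : 0 < mu) (hlam : 0 < 3 * lam + 2 * mu) {C : Set E3}
    {w : E3 → E3} (hw : IsNormalizedSolution lam mu p C w) (c : ℝ) (i : Fin 3) :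
    ContDiffOn ℝ ∞ (uc c w i) (Om C) :=
  (rep_smooth (Om_open C) (wc_rep hmu hlam hw i)).add
    (contDiff_const.mul (by fun_prop : ContDiff ℝ ∞ fun x : E3 => x i)).contDiffOn

lemma wc_diff {lam mu p : ℝ} {C : Set E3} {w : E3 → E3} (hw : IsNormalizedSolution lam mu p C w)
    {x : E3} (hx : x ∈ Om C) (i : Fin 3) : DifferentiableAt ℝ (wc w i) x :=
  ((wc_contDiffOn hw.2.1 i).contDiffAt ((Om_open C).mem_nhds hx)).differentiableAt (by simp)

lemma uc_pd {lam mu p : ℝ} {C : Set E3} {w : E3 → E3} (hw : IsNormalizedSolution lam mu p C w)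
    (c : ℝ) {x : E3} (hx : x ∈ Om C) (i j : Fin 3) :
    pd (uc c w i) j x = pd (wc w i) j x + c * (if i = j then 1 else 0) := by
  unfold uc
  rw [pd_add (wc_diff hw hx i) ((coord_diff i x).const_mul c), pd_const_mul (coord_diff i x), pd_coord]

lemma uc_pd_mem {lam mu p : ℝ} (hmu : 0 < mu) (hlam : 0 < 3 * lam + 2 * mu) {C : Set E3}
    {w : E3 → E3} (hw : IsNormalizedSolution lam mu p C w) (i j : Fin 3) :
    MemLp (pd (uc (p / (3*lam+2*mu)) w i) j) 2 (volume.restrict (Om C)) := by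
  have hcont : ContinuousOn (pd (uc (p / (3*lam+2*mu)) w i) j) (Om C) :=
    pd_contOn (Om_open C) ((uc_smooth hmu hlam hw _ i).of_le (by norm_cast)) j
  have hm := hcont.aestronglyMeasurable (μ := volume) (Om_open C).measurableSet
  rw [memLp_two_iff_integrable_sq hm]
  apply Integrable.mono' hw.2.2.2.1 (hm.pow 2)
  filter_upwards [self_mem_ae_restrict (Om_open C).measurableSet] with x hx
  have hd : DifferentiableAt ℝ w x :=
    (hw.2.1.contDiffAt ((Om_open C).mem_nhds hx)).differentiableAt (by simp)
  rw [Pi.pow_apply, uc_pd hw _ hx, ← wc_jac hd, Real.norm_of_nonneg (sq_nonneg _)]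
  unfold frob2
  refine le_trans ?_ (Finset.single_le_sum (f := fun i => ∑ j, (jac w x i j + (p/(3*lam+2*mu)) * (if i = j then 1 else 0))^2) (fun _ _ => by positivity) (Finset.mem_univ i))
  exact Finset.single_le_sum (f := fun j => (jac w x i j + (p/(3*lam+2*mu)) * (if i = j then 1 else 0))^2) (fun _ _ => by positivity) (Finset.mem_univ j)

lemma uc_mem0 {lam mu p : ℝ} (hmu : 0 < mu) (hlam : 0 < 3 * lam + 2 * mu) {C : Set E3}
    {w : E3 → E3} (hw : IsNormalizedSolution lam mu p C w) (i : Fin 3) :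
    MemLp (fun x => uc (p / (3*lam+2*mu)) w i x / √(1 + ‖x‖^2)) 2 (volume.restrict (Om C)) := by
  have hcont : ContinuousOn (fun x => uc (p / (3*lam+2*mu)) w i x / √(1 + ‖x‖^2)) (Om C) := by
    apply (uc_smooth hmu hlam hw _ i).continuousOn.div (by fun_prop)
    intro x _
    positivity
  have hm := hcont.aestronglyMeasurable (μ := volume) (Om_open C).measurableSet
  rw [memLp_two_iff_integrable_sq hm]
  apply Integrable.mono' hw.2.2.1 (hm.pow 2)
  filter_upwards with x
  rw [Pi.pow_apply, Real.norm_of_nonneg (sq_nonneg _), div_pow, Real.sq_sqrt (by positivity)]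
  have := coord_abs (w x + (p / (3*lam+2*mu)) • x) i
  rw [← sq_abs]
  have e : uc (p / (3*lam+2*mu)) w i x = (w x + (p / (3*lam+2*mu)) • x) i := by simp [uc, wc]
  rw [e]
  gcongr

def TT (lam mu p : ℝ) {D : ℝ} (hD : 0 < D) (w : E3 → E3) (i j : Fin 3) (x : E3) : ℝ :=
  sig lam mu (uc (p / (3*lam+2*mu)) w) i j x - p * tau hD i j x

lemma sig_mem {lam mu p : ℝ} (hmu : 0 < mu) (hlam : 0 < 3 * lam + 2 * mu) {C : Set E3}
    {w : E3 → E3} (hw : IsNormalizedSolution lam mu p C w) (i j : Fin 3) :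
    MemLp (sig lam mu (uc (p / (3*lam+2*mu)) w) i j) 2 (volume.restrict (Om C)) := by
  unfold sig
  apply MemLp.add
  · split_ifs
    · exact (memLp_finsetSum _ fun k _ => uc_pd_mem hmu hlam hw k k).const_mul lam
    · exact MemLp.zero
  · exact ((uc_pd_mem hmu hlam hw i j).add (uc_pd_mem hmu hlam hw j i)).const_mul mu

lemma tau_mem {D : ℝ} (hD : 0 < D) (i j : Fin 3) (Ω : Set E3) :
    MemLp (tau hD i j) 2 (volume.restrict Ω) :=
  ((tau_smooth hD i j).continuous.memLp_of_hasCompactSupport (tau_compact hD i j)).restrict Ω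

lemma TT_mem {lam mu p : ℝ} (hmu : 0 < mu) (hlam : 0 < 3 * lam + 2 * mu) {C : Set E3}
    {w : E3 → E3} (hw : IsNormalizedSolution lam mu p C w) {D : ℝ} (hD : 0 < D) (i j : Fin 3) :
    MemLp (TT lam mu p hD w i j) 2 (volume.restrict (Om C)) :=
  (sig_mem hmu hlam hw i j).sub ((tau_mem hD i j _).const_mul p)

lemma TT_weak {lam mu p : ℝ} (hmu : 0 < mu) (hlam : 0 < 3 * lam + 2 * mu) {C : Set E3}
    {w : E3 → E3} (hw : IsNormalizedSolution lam mu p C w) {D : ℝ} (hD : 0 < D)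
    (hC : IsCavity D C) (i : Fin 3) {φ : E3 → ℝ} (hφ : ContDiff ℝ ∞ φ) (hc : HasCompactSupport φ) :
    ∑ j, ∫ x in Om C, TT lam mu p hD w i j x * pd φ j x = 0 := by
  obtain ⟨hop, _, hcl, _, hneg, hlow, _⟩ := hC
  have hpm : ∀ j, MemLp (pd φ j) 2 (volume.restrict (Om C)) := fun j =>
    ((pd_smooth hφ j).continuous.memLp_of_hasCompactSupport (pd_compact hc j)).restrict _
  have hTi : ∀ j, Integrable (fun x => TT lam mu p hD w i j x * pd φ j x) (volume.restrict (Om C)) :=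
    fun j => (TT_mem hmu hlam hw hD i j).integrable_mul (hpm j)
  rw [← integral_finsetSum _ fun j _ => hTi j]
  let Φ : Fin 3 → E3 → ℝ := fun k => if k = i then φ else fun _ => 0
  have hΦ : ∀ k, ContDiff ℝ ∞ (Φ k) := by
    intro k; simp only [Φ]; split_ifs
    · exact hφ
    · exact contDiff_const
  have hΦc : ∀ k, HasCompactSupport (Φ k) := by
    intro k; simp only [Φ]; split_ifs
    · exact hc
    · exact HasCompactSupport.zero
  have hpΦ : ∀ k j x, pd (Φ k) j x = if k = i then pd φ j x else 0 := by
    intro k j x; simp only [Φ]; split_ifs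
    · rfl
    · simp [pd]
  have hweak := weak_scalar hw Φ hΦ hΦc
  rw [← div_half Φ hΦ hΦc] at hweak
  have hdiv : ∀ x, ∑ k, pd (Φ k) k x = pd φ i x := by intro x; simp [hpΦ]
  simp only [hdiv] at hweak
  let G : E3 → ℝ := fun x => (∑ j, tau hD i j x * pd φ j x) - pd φ i x
  have hτc : Continuous (fun x => ∑ j, tau hD i j x * pd φ j x) :=
    continuous_finsetSum _ fun j _ => (tau_smooth hD i j).continuous.mul (pd_smooth hφ j).continuous
  have hτi : Integrable (fun x => ∑ j, tau hD i j x * pd φ j x) :=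
    integrable_finsetSum _ fun j _ => integrable_mul_of_tsupport isOpen_univ
      (tau_smooth hD i j).continuous.continuousOn
      (pd_smooth hφ j).continuous (pd_compact hc j) (subset_univ _)
  have hpi : Integrable (pd φ i) :=
    (pd_smooth hφ i).continuous.integrable_of_hasCompactSupport (pd_compact hc i)
  have hGi : Integrable G := hτi.sub hpi
  have hG0 : ∀ x ∈ closure C, G x = 0 := by
    intro x hx
    simp only [G, tau_one hD i _ (cl_norm hneg x hx) (cl_low hlow x hx)]
    simp
  have hlowm : MeasurableSet lowerHalf := (isOpen_lt (by fun_prop : Continuous fun x : E3 => x 2) continuous_const).measurableSet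
  have hGΩ : ∫ x in Om C, G x = ∫ x in lowerHalf, G x := by
    symm
    apply setIntegral_eq_of_subset_of_forall_sdiff_eq_zero hlowm
    · intro x hx; exact hx.1
    · rintro x ⟨hx, hx2⟩
      apply hG0
      by_contra hn
      exact hx2 ⟨hx, hn⟩
  have hGl : ∫ x in lowerHalf, G x = - ∫ x in lowerHalf, pd φ i x := by
    simp only [G]
    rw [integral_sub hτi.integrableOn hpi.integrableOn]
    rw [setIntegral_eq_integral_of_forall_compl_eq_zero (s := lowerHalf), tau_div hD i hφ hc, zero_sub]
    intro x hx
    simp [tau_low hD _ _ hx]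
  have hpt : ∫ x in Om C, ∑ k, ∑ j, pd (wc w k) j x * sig lam mu Φ k j x
      = ∫ x in Om C, (∑ j, TT lam mu p hD w i j x * pd φ j x + p * G x) := by
    apply setIntegral_congr_fun (Om_open C).measurableSet
    intro x hx
    have hp : p / (3*lam+2*mu) * (3*lam+2*mu) = p := by field_simp
    have e1 : ∀ j, TT lam mu p hD w i j x = (if i = j then lam*∑ k, pd (wc w k) k x else 0)
        + mu * (pd (wc w i) j x + pd (wc w j) i x) + p * (if i = j then 1 else 0)
        - p * tau hD i j x := by
      intro j
      unfold TT sig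
      simp only [uc_pd hw _ hx, Fin.sum_univ_three]
      split_ifs with h1 h2 h2
      · simp; linear_combination hp
      · exact absurd h1.symm h2
      · exact absurd h2.symm h1
      · ring
    simp only [e1, G, sig, hpΦ, Fin.sum_univ_three]
    fin_cases i <;> simp <;> ring
  rw [hpt, integral_add (integrable_finsetSum _ fun j _ => hTi j) (hGi.integrableOn.const_mul p),
    integral_const_mul, hGΩ, hGl] at hweak
  linarith

lemma TT_energy {r E lam mu p : ℝ} (hr : 0 < r) (hE : 0 < E)
    (hmu : 0 < mu) (hlam : 0 < 3 * lam + 2 * mu) {C : Set E3}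
    {w : E3 → E3} (hw : IsNormalizedSolution lam mu p C w) {D : ℝ} (hD : 0 < D)
    (hC : IsC3Cavity r E D C) :
    ∫ x in Om C, ∑ i, ∑ j, TT lam mu p hD w i j x * pd (uc (p / (3*lam+2*mu)) w i) j x = 0 := by
  have hi : ∀ i j, Integrable (fun x => TT lam mu p hD w i j x * pd (uc (p / (3*lam+2*mu)) w i) j x) (volume.restrict (Om C)) :=
    fun i j => (TT_mem hmu hlam hw hD i j).integrable_mul (uc_pd_mem hmu hlam hw i j)
  rw [integral_finsetSum _ fun i _ => integrable_finsetSum _ fun j _ => hi i j]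
  apply Finset.sum_eq_zero
  intro i _
  rw [integral_finsetSum _ fun j _ => hi i j]
  exact density ⟨Om_open C, TT_mem hmu hlam hw hD i, fun φ h1 h2 => TT_weak hmu hlam hw hD hC.1 i h1 h2,
    uc_smooth hmu hlam hw _ i, uc_pd_mem hmu hlam hw i, uc_mem0 hmu hlam hw i⟩ (cone_Om hr hE hD hC)

lemma coer {lam mu : ℝ} (hmu : 0 < mu) (hlam : 0 < 3 * lam + 2 * mu) :
    ∃ m, 0 < m ∧ ∀ e : Fin 3 → Fin 3 → ℝ,
      m * ∑ i, ∑ j, (e i j)^2 ≤ lam * (∑ i, e i i)^2 + 2 * mu * ∑ i, ∑ j, (e i j)^2 := by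
  have htr : ∀ e : Fin 3 → Fin 3 → ℝ, (∑ i, e i i)^2 ≤ 3 * ∑ i, ∑ j, (e i j)^2 := by
    intro e
    simp only [Fin.sum_univ_three]
    nlinarith [sq_nonneg (e 0 0 - e 1 1), sq_nonneg (e 0 0 - e 2 2), sq_nonneg (e 1 1 - e 2 2),
      sq_nonneg (e 0 1), sq_nonneg (e 0 2), sq_nonneg (e 1 0), sq_nonneg (e 1 2), sq_nonneg (e 2 0),
      sq_nonneg (e 2 1)]
  rcases le_total 0 lam with h | h
  · refine ⟨2 * mu, by positivity, fun e => ?_⟩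
    have := mul_nonneg h (sq_nonneg (∑ i, e i i))
    linarith
  · refine ⟨3 * lam + 2 * mu, hlam, fun e => ?_⟩
    have := mul_le_mul_of_nonpos_left (htr e) h
    linarith

theorem energy {r E lam mu D : ℝ} (hr : 0 < r) (hE : 0 < E)
    (hmu : 0 < mu) (hlam : 0 < 3 * lam + 2 * mu) (hD : 0 < D) :
    ∃ K : ℝ, 0 < K ∧ ∀ (C : Set E3) (p : ℝ) (w : E3 → E3), 0 < p → IsC3Cavity r E D C →
      IsNormalizedSolution lam mu p C w →
      IntegrableOn (fun x => (ff p w x + 1 / (3*lam+2*mu))^2) (Om C) ∧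
      ∫ x in Om C, (ff p w x + 1 / (3*lam+2*mu))^2 ≤ K := by
  obtain ⟨m, hm, hcoer⟩ := coer hmu hlam
  let τ2 : E3 → ℝ := fun x => ∑ i, ∑ j, (tau hD i j x)^2
  have hτi : Integrable τ2 := integrable_finsetSum _ fun i _ => integrable_finsetSum _ fun j _ => by
    have := tau_mem hD i j univ
    rw [Measure.restrict_univ] at this
    exact this.integrable_sq
  have hτ0 : ∀ x, 0 ≤ τ2 x := fun x => by positivity
  refine ⟨m⁻¹ ^ 2 * (∫ x, τ2 x) + 1, by
    have := integral_nonneg (μ := volume) (f := τ2) hτ0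
    positivity, ?_⟩
  intro C p w hp hC hw
  have hpd : ∀ x ∈ Om C, (ff p w x + 1 / (3*lam+2*mu))^2
      = (p⁻¹)^2 * (pd (uc (p / (3*lam+2*mu)) w 0) 0 x)^2 := by
    intro x hx
    rw [uc_pd hw _ hx, ff]
    simp only [if_true]
    field_simp
  have hi0 : Integrable (fun x => (p⁻¹)^2 * (pd (uc (p / (3*lam+2*mu)) w 0) 0 x)^2)
    (volume.restrict (Om C)) := (uc_pd_mem hmu hlam hw 0 0).integrable_sq.const_mul _
  refine ⟨(integrableOn_congr_fun hpd (Om_open C).measurableSet).2 hi0, ?_⟩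
  rw [setIntegral_congr_fun (Om_open C).measurableSet hpd]
  have hen := TT_energy hr hE hmu hlam hw hD hC
  have hi : ∀ i j, Integrable (fun x => TT lam mu p hD w i j x * pd (uc (p / (3*lam+2*mu)) w i) j x) (volume.restrict (Om C)) :=
    fun i j => (TT_mem hmu hlam hw hD i j).integrable_mul (uc_pd_mem hmu hlam hw i j)
  have hle : ∫ x in Om C, (p^2 * m / 2 * ((p⁻¹)^2 * (pd (uc (p / (3*lam+2*mu)) w 0) 0 x)^2)
      - p^2 / (2*m) * τ2 x) ≤
      ∫ x in Om C, ∑ i, ∑ j, TT lam mu p hD w i j x * pd (uc (p / (3*lam+2*mu)) w i) j x := by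
    apply integral_mono ((hi0.const_mul _).sub (hτi.integrableOn.const_mul _))
      (integrable_finsetSum _ fun i _ => integrable_finsetSum _ fun j _ => hi i j)
    intro x
    simp only [Pi.sub_apply]
    generalize hd : (fun i j => pd (uc (p / (3*lam+2*mu)) w i) j x) = d
    have hd' : ∀ i j, pd (uc (p / (3*lam+2*mu)) w i) j x = d i j := fun i j => by rw [← hd]
    simp only [TT, sig, hd', τ2]
    have hts := fun i j => tau_symm hD i j x
    generalize ht : (fun i j => tau hD i j x) = t at hts ⊢
    have ht' : ∀ i j, tau hD i j x = t i j := fun i j => by rw [← ht]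
    simp only [ht'] at hts ⊢
    let e : Fin 3 → Fin 3 → ℝ := fun i j => (d i j + d j i) / 2
    have h1 := hcoer e
    have h2 : ∑ i, ∑ j, ((if i = j then lam * ∑ k, d k k else 0) + mu * (d i j + d j i) - p * t i j) * d i j
        = lam * (∑ i, e i i)^2 + 2 * mu * ∑ i, ∑ j, (e i j)^2 - ∑ i, ∑ j, p * t i j * e i j := by
      simp only [Fin.sum_univ_three, e]
      simp
      rw [hts 1 0, hts 2 0, hts 2 1]
      ring
    have h3 : ∑ i, ∑ j, p * t i j * e i j ≤ ∑ i, ∑ j, (m / 2 * (e i j)^2 + p^2 / (2*m) * (t i j)^2) := by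
      apply Finset.sum_le_sum; intro i _
      apply Finset.sum_le_sum; intro j _
      have : 0 ≤ (2*m)⁻¹ * (m * e i j - p * t i j)^2 := by positivity
      have e2 : (2*m)⁻¹ * (m * e i j - p * t i j)^2 = m / 2 * (e i j)^2 + p^2 / (2*m) * (t i j)^2 - p * t i j * e i j := by
        field_simp; ring
      linarith
    simp only [Finset.sum_add_distrib, ← Finset.mul_sum] at h3
    have h4 : (d 0 0)^2 ≤ ∑ i, ∑ j, (e i j)^2 := by
      have a := Finset.single_le_sum (f := fun i => ∑ j, (e i j)^2) (fun _ _ => by positivity) (Finset.mem_univ 0)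
      have b := Finset.single_le_sum (f := fun j => (e 0 j)^2) (fun _ _ => by positivity) (Finset.mem_univ 0)
      have c : e 0 0 = d 0 0 := by simp only [e]; ring
      rw [← c]
      exact b.trans a
    rw [h2]
    have h5 : p^2 * m / 2 * ((p⁻¹)^2 * (d 0 0)^2) = m / 2 * (d 0 0)^2 := by field_simp
    rw [h5]
    have h6 := mul_le_mul_of_nonneg_left h4 hm.le
    linarith
  rw [hen, integral_sub (hi0.const_mul _) (hτi.integrableOn.const_mul _), 
    integral_const_mul (p^2*m/2), integral_const_mul (p^2/(2*m))] at hle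
  have hτle : ∫ x in Om C, τ2 x ≤ ∫ x, τ2 x :=
    setIntegral_le_integral hτi (Eventually.of_forall hτ0)
  set I := ∫ x in Om C, (p⁻¹)^2 * (pd (uc (p / (3*lam+2*mu)) w 0) 0 x)^2
  set J := ∫ x in Om C, τ2 x
  have h7 : I ≤ m⁻¹^2 * J := by
    have : p^2 * m / 2 * I ≤ p^2 * m / 2 * (m⁻¹^2 * J) := by
      have e : p^2 * m / 2 * (m⁻¹^2 * J) = p^2 / (2*m) * J := by field_simp
      rw [e]; linarith
    exact le_of_mul_le_mul_left this (by positivity)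
  have h8 : m⁻¹^2 * J ≤ m⁻¹^2 * ∫ x, τ2 x := by gcongr
  linarith

end


open MeasureTheory Metric Set
noncomputable section
open scoped ContDiff Topology
open Filter

def AK : ℝ := 1 + ∫ z, (KK z)^2

lemma AK_pos : 0 < AK := by
  have : 0 ≤ ∫ z, (KK z)^2 := integral_nonneg fun z => sq_nonneg _
  unfold AK; linarith

lemma sup_est {U : Set E3} {f : E3 → ℝ} (hf : KRep U f) {y : E3} {r ε : ℝ} (hr : 0 < r)
    (hr1 : r ≤ 1) (hb : closedBall y r ⊆ U) (hε : 0 < ε)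
    (hi : ∫ x in closedBall y r, (f x)^2 ≤ ε) : |f y| ≤ AK * (r⁻¹)^3 * √ε := by
  set F : E3 → ℝ := indicator (closedBall y r) fun x => (f x)^2 with hF
  have hFi : Integrable F := by
    apply IntegrableOn.integrable_indicator _ measurableSet_closedBall
    exact ((hf.1.mono hb).pow 2).integrableOn_compact (isCompact_closedBall y r)
  have hF2 : Integrable fun z => F (y + r • z) :=
    (hFi.comp_add_left y).comp_smul hr.ne'
  have hKi : Integrable fun z => (KK z)^2 := by
    have e : (fun z => (KK z)^2) = fun z => KK z * KK z := by funext z; rw [sq]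
    rw [e]
    exact integrable_mul_of_tsupport isOpen_univ KK_smooth.continuous.continuousOn
      KK_smooth.continuous KK_compact (subset_univ _)
  have hs : 0 < √ε := Real.sqrt_pos.2 hε
  have h1 : |f y| ≤ ∫ z, ((√ε)⁻¹ / 2 * F (y + r • z) + √ε / 2 * (KK z)^2) := by
    rw [hf.2 y r hr hb, ← Real.norm_eq_abs]
    apply norm_integral_le_of_norm_le ((hF2.const_mul _).add (hKi.const_mul _))
    filter_upwards with z
    rw [Real.norm_eq_abs]
    show _ ≤ (√ε)⁻¹ / 2 * F (y + r • z) + √ε / 2 * (KK z)^2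
    have hF0 : 0 ≤ F (y + r • z) := by
      rw [hF]; exact indicator_nonneg (fun _ _ => sq_nonneg _) _
    by_cases hz : 1 ≤ ‖z‖
    · rw [KK_zero hz]; simp; positivity
    · have hm : y + r • z ∈ closedBall y r := by
        rw [mem_closedBall, dist_eq_norm, add_sub_cancel_left, norm_smul, Real.norm_of_nonneg hr.le]
        nlinarith
      have hFe : F (y + r • z) = (f (y + r • z))^2 := by rw [hF, indicator_of_mem hm]
      rw [hFe, abs_mul]
      have h3 : 0 ≤ (√ε)⁻¹ / 2 * (|f (y + r • z)| - √ε * |KK z|)^2 := by positivity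
      have h4 : (√ε)⁻¹ / 2 * (|f (y + r • z)| - √ε * |KK z|)^2
        = (√ε)⁻¹ / 2 * |f (y + r • z)|^2 + √ε / 2 * |KK z|^2 - |f (y + r • z)| * |KK z| := by
        field_simp; ring
      rw [sq_abs, sq_abs] at h4
      linarith
  rw [integral_add (hF2.const_mul _) (hKi.const_mul _), integral_const_mul, integral_const_mul,
    int_scale F y hr, hF, integral_indicator measurableSet_closedBall] at h1
  set I := ∫ x in closedBall y r, (f x)^2
  set k := ∫ z, (KK z)^2
  have hk : 0 ≤ k := integral_nonneg fun z => sq_nonneg _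
  have hrr : 1 ≤ (r⁻¹)^3 := one_le_pow₀ ((one_le_inv₀ hr).2 hr1)
  have h5 : (√ε)⁻¹ * I ≤ √ε := by
    rw [inv_mul_le_iff₀ hs, Real.mul_self_sqrt hε.le]; exact hi
  have h6 : AK = 1 + k := rfl
  rw [h6]
  rw [← inv_pow] at h1
  have h7 : (r⁻¹)^3 * ((√ε)⁻¹ * I) ≤ (r⁻¹)^3 * √ε := by gcongr
  have h8 : √ε * k ≤ (r⁻¹)^3 * (√ε * k) := le_mul_of_one_le_left (by positivity) hrr
  have h9 : 0 ≤ (r⁻¹)^3 * √ε := by positivity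
  have h10 : 0 ≤ (r⁻¹)^3 * (√ε * k) := by positivity
  nlinarith

lemma KRep_add_const {U : Set E3} {f : E3 → ℝ} (hU : IsOpen U) (hf : KRep U f) (c : ℝ) :
    KRep U (fun x => f x + c) := by
  refine ⟨hf.1.add continuousOn_const, fun x r hr hb => ?_⟩
  have h1 := (rep_scaled_int hU hf.1 KK_smooth.continuous KK_tsupport hr.le (x := x) (by simpa using hb)).2
  have h2 : Integrable KK := KK_smooth.continuous.integrable_of_hasCompactSupport KK_compact
  simp only [add_mul]
  rw [integral_add h1 (h2.const_mul c), integral_const_mul, KK_int, ← hf.2 x r hr hb, mul_one]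

/-- data about the function `f` used in the propagation argument -/
structure FD (Ω : Set E3) (f : E3 → ℝ) (c K : ℝ) : Prop where
  op : IsOpen Ω
  rep : KRep Ω f
  int : IntegrableOn (fun x => (f x + c)^2) Ω
  le : ∫ x in Ω, (f x + c)^2 ≤ K
  c0 : 0 < c
  K0 : 0 < K

def MM (c K m : ℝ) : ℝ := c + AK * ((m / 4)⁻¹)^3 * (1 + √K)

lemma FD.bd {Ω : Set E3} {f : E3 → ℝ} {c K : ℝ} (F : FD Ω f c K) {m ρ : ℝ} {x y : E3} (hm : 0 < m)
    (hm1 : m ≤ 1) (hmρ : m ≤ ρ) (hx : ball x ρ ⊆ Ω) (hy : y ∈ closedBall x (ρ / 2)) :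
    |f y| ≤ MM c K m := by
  have hsub : closedBall y (m/4) ⊆ Ω := by
    refine Subset.trans ?_ hx
    intro z hz
    rw [mem_closedBall] at hz hy
    rw [mem_ball]
    have := dist_triangle z y x
    linarith
  have h := sup_est (KRep_add_const F.op F.rep c) (by positivity : 0 < m/4) (by linarith) hsub F.K0
    (le_trans (setIntegral_mono_set F.int (Eventually.of_forall fun _ => sq_nonneg _)
      hsub.eventuallyLE) F.le)
  have h2 : |f y| ≤ |f y + c| + c := by
    have := abs_sub (f y + c) c
    rw [add_sub_cancel_right, abs_of_pos F.c0] at this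
    exact this
  have h3 : AK * ((m / 4)⁻¹)^3 * √K ≤ AK * ((m / 4)⁻¹)^3 * (1 + √K) := by
    have := AK_pos
    gcongr; linarith
  unfold MM
  linarith

lemma MM_ge {c K m : ℝ} (hm : 0 < m) : c ≤ MM c K m := by
  have := AK_pos
  unfold MM
  have : 0 ≤ AK * ((m / 4)⁻¹)^3 * (1 + √K) := by positivity
  linarith

def Sm (f : E3 → ℝ) (M a : ℝ) (n : ℕ) (x : E3) (r : ℝ) : Prop :=
  ∀ y ∈ closedBall x r, |f y| ≤ 4 * M * a ^ ((1/2 : ℝ)^n)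

lemma Sm.mono {f : E3 → ℝ} {M a : ℝ} {n : ℕ} {x y : E3} {r s : ℝ} (h : Sm f M a n x r)
    (hs : s + dist y x ≤ r) : Sm f M a n y s := by
  intro z hz
  apply h
  rw [mem_closedBall] at hz ⊢
  linarith [dist_triangle z y x]

lemma Sm.succ {f : E3 → ℝ} {M a : ℝ} {n m : ℕ} {x : E3} {r : ℝ} (h : Sm f M a n x r) (hM : 0 ≤ M)
    (ha : 0 < a) (ha1 : a ≤ 1) (hnm : n ≤ m) : Sm f M a m x r := by
  intro z hz
  refine (h z hz).trans ?_
  have : a ^ ((1/2 : ℝ)^n) ≤ a ^ ((1/2 : ℝ)^m) := by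
    apply Real.rpow_le_rpow_of_exponent_ge ha ha1
    exact pow_le_pow_of_le_one (by norm_num) (by norm_num) hnm
  gcongr

def LL : ℝ := three_ball.choose
lemma LL_ge : 4 ≤ LL := three_ball.choose_spec.1

lemma Sm.step {U : Set E3} {f : E3 → ℝ} {M a : ℝ} {n : ℕ} {x : E3} {r ρ : ℝ} (h : Sm f M a n x r)
    (hU : IsOpen U) (hf : KRep U f) (hM : 0 < M) (ha : 0 < a) (hr : 0 < r) (hρ : LL * r ≤ ρ / 2)
    (hρ0 : 0 < ρ)
    (hb : ball x ρ ⊆ U) (hbd : ∀ y ∈ closedBall x (ρ/2), |f y| ≤ M) : Sm f M a (n+1) x (2*r) := by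
  have hsub : closedBall x (LL * r) ⊆ closedBall x (ρ/2) := closedBall_subset_closedBall hρ
  have hsub2 : closedBall x (ρ/2) ⊆ ball x ρ := closedBall_subset_ball (by linarith)
  intro y hy
  refine (three_ball.choose_spec.2 U f x r _ M hU hf hr ((hsub.trans hsub2).trans hb) h
    (fun z hz => hbd z (hsub hz)) y hy).trans (le_of_eq ?_)
  have e : 4 * M * a ^ ((1/2 : ℝ)^n) * M = (2 * M * a ^ ((1/2:ℝ)^(n+1)))^2 := by
    rw [mul_pow, mul_pow, ← Real.rpow_natCast (a ^ _) 2, ← Real.rpow_mul ha.le]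
    have : (1/2:ℝ)^(n+1) * ((2:ℕ):ℝ) = (1/2)^n := by push_cast; rw [pow_succ]; ring
    rw [this]; ring
  rw [e, Real.sqrt_sq (by positivity)]
  ring

/-- growth of the ball of smallness along a curve in a cone-like free region -/
lemma log_phase {U : Set E3} {f : E3 → ℝ} {M a : ℝ} (hU : IsOpen U) (hf : KRep U f) (hM : 0 < M)
    (ha : 0 < a) {κ s T : ℝ} (hκ : 0 < κ) (hκ1 : κ ≤ 1) (hs : 0 < s) (hT : 0 ≤ T)
    {γ : ℝ → E3} (hγ : ∀ t ∈ Icc 0 T, ∀ t' ∈ Icc 0 T, dist (γ t) (γ t') ≤ |t - t'|)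
    (hfree : ∀ t ∈ Icc 0 T, ball (γ t) (κ * (s + t)) ⊆ U)
    (hbd : ∀ t ∈ Icc 0 T, ∀ y ∈ closedBall (γ t) (κ * (s + t) / 2), |f y| ≤ M) {n : ℕ}
    (h0 : Sm f M a n (γ 0) (κ * s / (2 * LL))) (N : ℕ) (hN : s + T ≤ s * (1 + κ / (4 * LL))^N) :
    Sm f M a (n + N) (γ T) (κ * (s + T) / (2 * LL)) := by
  have hL := LL_ge
  have hL0 : 0 < LL := by linarith
  set q := κ / (4 * LL) with hq
  have hq0 : 0 < q := by positivity
  have hq1 : q ≤ 1 := by rw [hq, div_le_one (by positivity)]; linarith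
  set τ : ℕ → ℝ := fun k => min (s * (1 + q)^k - s) T with hτ
  have h1q : ∀ k : ℕ, 1 ≤ (1 + q)^k := fun k => one_le_pow₀ (by linarith)
  have hτm : ∀ k, τ k ∈ Icc 0 T := fun k => ⟨le_min (by nlinarith [h1q k]) hT, min_le_right _ _⟩
  have hτs : ∀ k, τ k ≤ τ (k+1) := by
    intro k
    apply min_le_min _ le_rfl
    have : (1 + q)^k ≤ (1+q)^(k+1) := pow_le_pow_right₀ (by linarith) (by omega)
    nlinarith
  have hτd : ∀ k, τ (k+1) - τ k ≤ q * (s + τ k) := by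
    intro k
    rcases min_cases (s * (1 + q)^k - s) T with ⟨h, _⟩ | ⟨h, _⟩
    · have e : τ k = s * (1 + q)^k - s := h
      have e2 : τ (k+1) ≤ s * (1 + q)^(k+1) - s := min_le_left _ _
      rw [e]
      have : s * (1 + q)^(k+1) = s * (1+q)^k + q * (s * (1+q)^k) := by ring
      linarith
    · have e : τ k = T := h
      have := (hτm (k+1)).2
      have : 0 ≤ q * (s + τ k) := by have := (hτm k).1; positivity
      linarith
  have key : ∀ k, Sm f M a (n + k) (γ (τ k)) (κ * (s + τ k) / (2 * LL)) := by
    intro k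
    induction k with
    | zero =>
      have : τ 0 = 0 := by simp [hτ, hT]
      rw [this]; simpa using h0
    | succ k ih =>
      have hp : 0 < s + τ k := by have := (hτm k).1; linarith
      have h2 := ih.step (ρ := κ * (s + τ k)) hU hf hM ha (by positivity)
        (by apply le_of_eq; field_simp) (by positivity) (hfree _ (hτm k)) (hbd _ (hτm k))
      rw [← add_assoc]
      apply h2.mono
      have h3 := hγ _ (hτm (k+1)) _ (hτm k)
      rw [abs_of_nonneg (by linarith [hτs k])] at h3
      have h4 := hτd k
      have h5 : κ * (s + τ (k+1)) / (2 * LL) ≤ κ * ((s + τ k) * (1 + q)) / (2 * LL) := by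
        gcongr; linarith
      have h6 : κ * ((s + τ k) * (1 + q)) / (2 * LL) = 2 * q * ((s + τ k) * (1 + q)) := by
        rw [hq]; field_simp; ring
      have h7 : 2 * (κ * (s + τ k) / (2 * LL)) = 4 * q * (s + τ k) := by
        rw [hq]; field_simp
      have hq4 : q ≤ 1/2 := by rw [hq, div_le_iff₀ (by positivity)]; linarith
      have h8 : q * q * (s + τ k) ≤ 1/2 * q * (s + τ k) := by gcongr
      rw [h7]
      nlinarith
  have hTN : τ N = T := min_eq_right (by linarith)
  have := key N
  rwa [hTN] at this

lemma log_count {q : ℝ} (hq : 0 < q) : ∃ B : ℕ, 0 < B ∧ ∀ X : ℝ, 1 ≤ X → ∃ N : ℕ, X ≤ (1 + q)^N ∧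
    (2:ℝ)^N ≤ ((1 + q) * X)^B := by
  obtain ⟨B, hB⟩ := pow_unbounded_of_one_lt 2 (by linarith : 1 < 1 + q)
  refine ⟨B + 1, by omega, fun X hX => ?_⟩
  obtain ⟨n, h1, h2⟩ := exists_nat_pow_near hX (by linarith : 1 < 1 + q)
  refine ⟨n + 1, h2.le, ?_⟩
  have hB' : 2 ≤ (1 + q)^(B+1) := hB.le.trans (pow_le_pow_right₀ (by linarith) (by omega))
  calc (2:ℝ)^(n+1) ≤ ((1 + q)^(B+1))^(n+1) := by gcongr
    _ = ((1+q)^(n+1))^(B+1) := by rw [← pow_mul, ← pow_mul, mul_comm]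
    _ ≤ ((1 + q) * X)^(B+1) := by
      gcongr
      rw [pow_succ, mul_comm]
      gcongr

end


open MeasureTheory Metric Set
noncomputable section
open scoped ContDiff Topology
open Filter

/-- the ball of radius `h` around `a` is free of cavity and in the half space -/
def Fre (C : Set E3) (a : E3) (h : ℝ) : Prop := a 2 + h ≤ 0 ∧ ∀ y, ‖y - a‖ < h → y ∉ C

lemma co_le (x y : E3) : x 2 ≤ y 2 + ‖x - y‖ := by
  have := (abs_le.1 (coord_abs (x - y) 2)).2
  simp at this
  linarith

lemma ball_notMem_cl {C : Set E3} {a : E3} {h : ℝ} (H : ∀ y, ‖y - a‖ < h → y ∉ C) {y : E3}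
    (hy : ‖y - a‖ < h) : y ∉ closure C := by
  apply notMem_cl (s := h - ‖y - a‖) (by linarith)
  intro z hz
  apply H
  have := norm_sub_le_norm_sub_add_norm_sub z y a
  linarith

lemma Fre.sub {C : Set E3} {a : E3} {h : ℝ} (H : Fre C a h) : ball a h ⊆ Om C := by
  intro y hy
  rw [mem_ball, dist_eq_norm] at hy
  refine ⟨?_, ball_notMem_cl H.2 hy⟩
  show y 2 < 0
  linarith [co_le y a, H.1]

lemma Fre.mono {C : Set E3} {a b : E3} {h k : ℝ} (H : Fre C a h) (hk : k + ‖b - a‖ ≤ h) : Fre C b k := by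
  refine ⟨by linarith [co_le b a, H.1], fun y hy => H.2 y ?_⟩
  have := norm_sub_le_norm_sub_add_norm_sub y b a
  linarith

lemma pre_frontier {t s : Set E3} (ht : IsPreconnected t) (h1 : (t ∩ s).Nonempty)
    (h2 : (t ∩ sᶜ).Nonempty) : (t ∩ frontier s).Nonempty := by
  by_contra hn
  have hn' : ∀ z ∈ t, z ∈ closure s → z ∈ interior s := by
    intro z hz hc
    by_contra hi
    exact hn ⟨z, hz, hc, hi⟩
  obtain ⟨a, ha, has⟩ := h1
  obtain ⟨b, hb, hbs⟩ := h2
  obtain ⟨z, _, hz1, hz2⟩ := ht (interior s) (closure s)ᶜ isOpen_interior isClosed_closure.isOpen_compl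
    (fun z hz => by
      by_cases h : z ∈ closure s
      · exact Or.inl (hn' z hz h)
      · exact Or.inr h) ⟨a, ha, hn' a ha (subset_closure has)⟩
    ⟨b, hb, fun hc => hbs (interior_subset (hn' b hb hc))⟩
  exact hz2 (subset_closure (interior_subset hz1))

lemma near_chart {r E : ℝ} {C : Set E3} (hb : HasC3Boundary r E C) {x : E3} {R : ℝ} (hx : x ∉ C)
    (h : ¬ ∀ y, ‖y - x‖ < R → y ∉ C) :
    ∃ Q φ ψ, ‖x - Q‖ < R ∧ Q ∈ closure C ∧ Chart r E C Q φ ψ := by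
  push Not at h
  obtain ⟨y, hy, hyC⟩ := h
  have hR : 0 < R := (norm_nonneg _).trans_lt hy
  obtain ⟨Q, hQ1, hQ2⟩ := pre_frontier (convex_ball x R).isPreconnected
    ⟨y, by rwa [mem_ball, dist_eq_norm], hyC⟩ ⟨x, mem_ball_self hR, hx⟩
  obtain ⟨φ, ψ, c⟩ := chart_exists hb hQ2
  refine ⟨Q, φ, ψ, ?_, hQ2.1, c⟩
  rw [mem_ball, dist_eq_norm, norm_sub_rev] at hQ1
  exact hQ1

lemma Chart.shift1 {r E : ℝ} {C : Set E3} {Q : E3} {φ : E3 ≃ᵢ E3} {ψ : E2 → ℝ}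
    (c : Chart r E C Q φ ψ) (hE : 0 < E) {x : E3} {s t : ℝ} (ht : 0 ≤ t)
    (hx : ∀ y, ‖y - x‖ < s → y ∉ C) (hr : ‖x - Q‖ + s + 2 * t ≤ r) :
    ∀ y, ‖y - mv φ (-t) x‖ < s → y ∉ C := by
  intro y hy
  obtain ⟨ν, hν, hmv⟩ := mv_lin φ
  have e : mv φ t y - x = y - mv φ (-t) x := by rw [hmv, hmv, neg_smul]; abel
  have h1 : ‖mv φ t y - x‖ < s := by rwa [e]
  have h2 : mv φ (-t) (mv φ t y) = y := by rw [hmv, hmv, neg_smul]; abel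
  have h3 : ‖mv φ t y - Q‖ < r := by
    have := norm_sub_le_norm_sub_add_norm_sub (mv φ t y) x Q
    linarith
  apply c.down hE (hx _ h1) h3 (t := t)
  · rw [h2]; simpa using ht
  · have h4 := norm_sub_le_norm_sub_add_norm_sub y (mv φ (-t) x) Q
    have h5 := norm_sub_le_norm_sub_add_norm_sub (mv φ (-t) x) x Q
    rw [mv_dist0, abs_neg, abs_of_nonneg ht] at h5
    linarith

lemma Chart.shift2 {r E : ℝ} {C : Set E3} {Q : E3} {φ : E3 ≃ᵢ E3} {ψ : E2 → ℝ}
    (c : Chart r E C Q φ ψ) (hE : 0 < E) {x : E3} {t : ℝ} (ht : 0 ≤ t)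
    (hx : x ∉ C) (hxr : ‖x - Q‖ < r) (hr : ‖x - Q‖ + 2 * t ≤ r) :
    ∀ y, ‖y - mv φ (-t) x‖ < t / (1 + E) → y ∉ C := by
  intro y hy
  have hy2 : ‖y - mv φ (-t) x‖ * (1 + E) < t := by rwa [lt_div_iff₀ (by linarith)] at hy
  apply c.down hE hx hxr hy2.le
  have h4 := norm_sub_le_norm_sub_add_norm_sub y (mv φ (-t) x) Q
  have h5 := norm_sub_le_norm_sub_add_norm_sub (mv φ (-t) x) x Q
  rw [mv_dist0, abs_neg, abs_of_nonneg ht] at h5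
  have : ‖y - mv φ (-t) x‖ < t := by nlinarith [norm_nonneg (y - mv φ (-t) x)]
  linarith

/-- the curve lemma -/
lemma curve {r E D : ℝ} (hE : 0 < E) {C : Set E3}
    (hC : IsC3Cavity r E D C) {x : E3} {s τ : ℝ} (hx2 : x 2 ≤ -D) (hs : 0 < s) (hsτ : s ≤ τ)
    (hτr : 8 * τ ≤ r) (hτD : 8 * τ ≤ D) (hfr : ∀ y, ‖y - x‖ < s → y ∉ C) :
    ∃ γ : ℝ → E3, γ 0 = x ∧ (∀ t t', dist (γ t) (γ t') ≤ |t - t'|) ∧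
      ∀ t ∈ Icc 0 τ, Fre C (γ t) (1 / (2 * (1 + E)) * (s + t)) := by
  obtain ⟨⟨hop, _, hcl, _, hneg, hlow, _⟩, hb⟩ := hC
  have hE1 : 1 / (2 * (1 + E)) ≤ 1/2 := by
    apply one_div_le_one_div_of_le <;> linarith
  have hE0 : 0 < 1 / (2 * (1 + E)) := by positivity
  set κ := 1 / (2 * (1 + E)) with hκ
  have hxC : x ∉ C := hfr x (by simpa using hs)
  by_cases hcase : ∀ y, ‖y - x‖ < 2 * κ * τ → y ∉ C
  · refine ⟨fun _ => x, rfl, fun t t' => by simp, fun t ht => ⟨?_, fun y hy => hcase y ?_⟩⟩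
    · nlinarith [ht.1, ht.2]
    · nlinarith [ht.1, ht.2]
  · obtain ⟨Q, φ, ψ, hQ, hQC, c⟩ := near_chart hb hxC hcase
    have hQτ : ‖x - Q‖ < τ := by nlinarith
    refine ⟨fun t => mv φ (-t) x, by simp [mv_zero], fun t t' => ?_, fun t ht => ⟨?_, ?_⟩⟩
    · rw [dist_eq_norm, mv_dist, neg_sub_neg, abs_sub_comm]
    · have := co_le (mv φ (-t) x) x
      rw [mv_dist0, abs_neg, abs_of_nonneg ht.1] at this
      nlinarith [ht.1, ht.2]
    · intro y hy
      have hκ2 : κ * (1 + E) = 1/2 := by rw [hκ]; field_simp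
      rcases le_total s t with hst | hst
      · apply c.shift2 hE ht.1 hxC (by linarith) (by linarith [ht.2])
        refine hy.trans_le ?_
        rw [le_div_iff₀ (by linarith)]
        nlinarith
      · apply c.shift1 hE ht.1 hfr (by linarith [ht.2])
        refine hy.trans_le ?_
        nlinarith

def StepR (C : Set E3) (h δ : ℝ) (a b : E3) : Prop := Fre C a h ∧ Fre C b h ∧ ‖b - a‖ ≤ δ

lemma chain_symm {C : Set E3} {h δ : ℝ} {a b : E3} (H : Relation.ReflTransGen (StepR C h δ) a b) :
    Relation.ReflTransGen (StepR C h δ) b a := by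
  induction H with
  | refl => exact Relation.ReflTransGen.refl
  | tail _ H ih => exact ih.head ⟨H.2.1, H.1, by rw [norm_sub_rev]; exact H.2.2⟩

lemma seg_chain {C : Set E3} {h δ : ℝ} (hδ : 0 < δ) {a b : E3}
    (H : ∀ t ∈ Icc (0:ℝ) 1, Fre C (a + t • (b - a)) h) : Relation.ReflTransGen (StepR C h δ) a b := by
  obtain ⟨n, hn⟩ := exists_nat_gt (‖b - a‖ / δ)
  have hn0 : (0:ℝ) < n := (by positivity : 0 ≤ ‖b - a‖ / δ).trans_lt hn
  rw [div_lt_iff₀ hδ] at hn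
  have key : ∀ k : ℕ, k ≤ n → Relation.ReflTransGen (StepR C h δ) a (a + ((k:ℝ)/n) • (b - a)) := by
    intro k
    induction k with
    | zero => intro _; simpa using Relation.ReflTransGen.refl
    | succ k ih =>
      intro hk
      have hk' : ((k:ℝ) + 1) ≤ n := by exact_mod_cast hk
      refine (ih (by omega)).tail ⟨H _ ⟨by positivity, ?_⟩, H _ ⟨by positivity, ?_⟩, ?_⟩
      · rw [div_le_one hn0]; linarith
      · rw [div_le_one hn0]; push_cast; exact hk'
      · rw [add_sub_add_left_eq_sub, ← sub_smul, norm_smul]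
        have : (((k+1:ℕ):ℝ) / n - (k:ℝ)/n) = 1 / n := by push_cast; field_simp; ring
        rw [this, Real.norm_of_nonneg (by positivity), one_div, inv_mul_le_iff₀ hn0]
        linarith
  have := key n le_rfl
  rwa [div_self hn0.ne', one_smul, add_sub_cancel] at this

lemma local_conn {r E D σ h δ : ℝ} (hE : 0 < E) {C : Set E3} (hδ : 0 < δ)
    (hC : IsC3Cavity r E D C) (hσ : 0 < σ) (hσr : 30 * (1 + E) * σ ≤ r) (hσD : 30 * (1 + E) * σ ≤ D)
    (hh : 0 < h) (hhσ : h ≤ σ) {x a b : E3} (hx : x ∈ Om C) (ha : Fre C a h) (hb : Fre C b h)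
    (hax : ‖a - x‖ ≤ 2 * σ) (hbx : ‖b - x‖ ≤ 2 * σ) : Relation.ReflTransGen (StepR C h δ) a b := by
  obtain ⟨⟨hop, _, hcl, _, hneg, hlow, _⟩, hbd⟩ := hC
  have hxC : x ∉ C := fun h => hx.2 (subset_closure h)
  have hab : ‖b - a‖ ≤ 4 * σ := by
    have := norm_sub_le_norm_sub_add_norm_sub b x a
    rw [norm_sub_rev x a] at this
    linarith
  by_cases hcase : ∀ y, ‖y - x‖ < 8 * σ → y ∉ C
  · apply seg_chain hδ
    intro t ht
    constructor
    · have e : (a + t • (b - a)) 2 = (1 - t) * a 2 + t * b 2 := by simp; ring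
      rw [e]
      nlinarith [ha.1, hb.1, ht.1, ht.2]
    · intro y hy
      apply hcase
      have h1 := norm_sub_le_norm_sub_add_norm_sub y (a + t • (b - a)) x
      have h2 := norm_sub_le_norm_sub_add_norm_sub (a + t • (b - a)) a x
      rw [add_sub_cancel_left, norm_smul, Real.norm_of_nonneg ht.1] at h2
      nlinarith [ht.1, ht.2, norm_nonneg (b - a)]
  · obtain ⟨Q, φ, ψ, hQ, hQC, c⟩ := near_chart hbd hxC hcase
    obtain ⟨ν, hν, hmv⟩ := mv_lin φ
    have hQ2 := cl_low hlow Q hQC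
    have hEσ : 0 < E * σ := by positivity
    set Λ := 5 * (1 + E) * σ with hΛ
    have hΛ0 : 0 < Λ := by positivity
    have go : ∀ a', Fre C a' h → ‖a' - x‖ ≤ 2 * σ →
        a' 2 ≤ -D + 10 * σ ∧ Relation.ReflTransGen (StepR C h δ) a' (mv φ (-Λ) a') := by
      intro a' ha' hax'
      have haQ := norm_sub_le_norm_sub_add_norm_sub a' x Q
      have ha2 := co_le a' Q
      refine ⟨by linarith, seg_chain hδ fun t ht => ?_⟩
      have e : a' + t • (mv φ (-Λ) a' - a') = mv φ (-(t * Λ)) a' := by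
        rw [hmv, hmv, add_sub_cancel_left, smul_smul]; congr 2; ring
      have ht0 : 0 ≤ t * Λ := mul_nonneg ht.1 hΛ0.le
      have ht1 : t * Λ ≤ Λ := mul_le_of_le_one_left hΛ0.le ht.2
      rw [e]
      constructor
      · have := co_le (mv φ (-(t * Λ)) a') a'
        rw [mv_dist0, abs_neg, abs_of_nonneg ht0] at this
        nlinarith
      · exact c.shift1 hE ht0 ha'.2 (by nlinarith)
    obtain ⟨ha2, ga⟩ := go a ha hax
    obtain ⟨hb2, gb⟩ := go b hb hbx
    refine (ga.trans ?_).trans (chain_symm gb)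
    apply seg_chain hδ
    intro t ht
    have e : mv φ (-Λ) b - mv φ (-Λ) a = b - a := by rw [hmv, hmv]; abel
    rw [e]
    have hn : ‖t • (b - a)‖ ≤ 4 * σ := by
      rw [norm_smul, Real.norm_of_nonneg ht.1]
      nlinarith [ht.1, ht.2, norm_nonneg (b - a)]
    have haQ := norm_sub_le_norm_sub_add_norm_sub a x Q
    have hf : Fre C (mv φ (-Λ) a) (5 * σ) := by
      constructor
      · have := co_le (mv φ (-Λ) a) a
        rw [mv_dist0, abs_neg, abs_of_nonneg hΛ0.le] at this
        nlinarith
      · have e5 : 5 * σ = Λ / (1 + E) := by rw [hΛ]; field_simp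
        rw [e5]
        exact c.shift2 hE hΛ0.le (ha.2 a (by simpa using hh)) (by nlinarith) (by nlinarith)
    apply hf.mono
    rw [add_sub_cancel_left]
    linarith

lemma ex_free {r E D σ h : ℝ} (hE : 0 < E) {C : Set E3}
    (hC : IsC3Cavity r E D C) (hσ : 0 < σ) (hσr : 30 * (1 + E) * σ ≤ r) (hσD : 30 * (1 + E) * σ ≤ D)
    (hh : h = σ / 2 / (1 + E)) {x : E3} (hx : x ∈ Om C) : ∃ a, ‖a - x‖ ≤ σ ∧ Fre C a h := by
  obtain ⟨⟨hop, _, hcl, _, hneg, hlow, _⟩, hbd⟩ := hC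
  have hxC : x ∉ C := fun h => hx.2 (subset_closure h)
  have hx2 : x 2 < 0 := hx.1
  have hEσ : 0 < E * σ := by positivity
  have hhσ : h ≤ σ / 2 := by rw [hh]; apply div_le_self <;> linarith
  by_cases hcase : ∀ y, ‖y - x‖ < σ → y ∉ C
  · have hn : ‖(x - (σ/2) • eb 2) - x‖ = σ / 2 := by
      rw [sub_sub_cancel_left, norm_neg, norm_smul, eb_norm, Real.norm_of_nonneg (by linarith), mul_one]
    refine ⟨x - (σ/2) • eb 2, by linarith, ?_, fun y hy => hcase y ?_⟩
    · have e : (x - (σ/2) • eb 2) 2 = x 2 - σ/2 := by simp [eb]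
      rw [e]; linarith
    · have := norm_sub_le_norm_sub_add_norm_sub y (x - (σ/2) • eb 2) x
      linarith
  · obtain ⟨Q, φ, ψ, hQ, hQC, c⟩ := near_chart hbd hxC hcase
    have hQ2 := cl_low hlow Q hQC
    have hn : ‖mv φ (-(σ/2)) x - x‖ = σ / 2 := by
      rw [mv_dist0, abs_neg, abs_of_nonneg (by linarith)]
    refine ⟨mv φ (-(σ/2)) x, by linarith, ?_, ?_⟩
    · have := co_le (mv φ (-(σ/2)) x) x
      have := co_le x Q
      nlinarith
    · rw [hh]
      exact c.shift2 hE (by linarith) hxC (by nlinarith) (by nlinarith)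

lemma conn {r E D σ h δ : ℝ} (hE : 0 < E) {C : Set E3} (hδ : 0 < δ)
    (hC : IsC3Cavity r E D C) (hσ : 0 < σ) (hσr : 30 * (1 + E) * σ ≤ r) (hσD : 30 * (1 + E) * σ ≤ D)
    (hh : h = σ / 2 / (1 + E)) {a b : E3} (ha : Fre C a h) (hb : Fre C b h) :
    Relation.ReflTransGen (StepR C h δ) a b := by
  have hh0 : 0 < h := by rw [hh]; positivity
  have hhσ : h ≤ σ := by
    rw [hh]; refine (div_le_self ?_ ?_).trans ?_ <;> linarith
  have hpre : IsPreconnected (Om C) := hC.1.2.2.2.1.isPreconnected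
  have := hpre.induction₂ (fun x y => ∀ a b, Fre C a h → Fre C b h → ‖a - x‖ ≤ σ → ‖b - y‖ ≤ σ →
    Relation.ReflTransGen (StepR C h δ) a b) ?_ ?_ ?_ (ha.sub (mem_ball_self hh0))
    (hb.sub (mem_ball_self hh0))
  · exact this a b ha hb (by simpa using hσ.le) (by simpa using hσ.le)
  · intro x hx
    filter_upwards [mem_nhdsWithin_of_mem_nhds (ball_mem_nhds x hσ)] with y hy a b ha hb hax hby
    rw [mem_ball, dist_eq_norm] at hy
    apply local_conn hE hδ hC hσ hσr hσD hh0 hhσ hx ha hb (by linarith)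
    have := norm_sub_le_norm_sub_add_norm_sub b y x
    linarith
  · intro x y z hx hy hz h1 h2 a b ha hb hax hbz
    obtain ⟨q, hq, hqf⟩ := ex_free hE hC hσ hσr hσD hh hy
    exact (h1 a q ha hqf hax hq).trans (h2 q b hqf hb hq hbz)
  · intro x y hx hy h1 a b ha hb hax hby
    exact chain_symm (h1 b a hb ha hby hax)

end


open MeasureTheory Metric Set
noncomputable section
open scoped ContDiff Topology
open Filter

def StepU (C : Set E3) (h δ : ℝ) (u v : E3) : Prop :=
  ∃ a b, Fre C a h ∧ Fre C b h ∧ ‖b - a‖ ≤ δ ∧ ‖a - u‖ ≤ δ ∧ ‖b - v‖ ≤ δ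

lemma StepU.symm {C : Set E3} {h δ : ℝ} {u v : E3} (H : StepU C h δ u v) : StepU C h δ v u := by
  obtain ⟨a, b, h1, h2, h3, h4, h5⟩ := H
  exact ⟨b, a, h2, h1, by rwa [norm_sub_rev], h5, h4⟩

lemma net_phase {r E D σ h δ : ℝ} (hE : 0 < E) (hδ : 0 < δ) (hδ1 : δ ≤ 1) (hD : 1 < D)
    (hσ : 0 < σ) (hσr : 30 * (1 + E) * σ ≤ r) (hσD : 30 * (1 + E) * σ ≤ D)
    (hh : h = σ / 2 / (1 + E)) : ∃ N : ℕ, ∀ C, IsC3Cavity r E D C → ∀ x, Fre C x h →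
    ‖x‖ ≤ 5 * D + 1 → ∀ S : ℕ → E3 → Prop,
    (∀ n u v, StepU C h δ u v → S n u → S (n+1) v) → (∀ u, ‖x - u‖ ≤ δ → S 0 u) →
    ∃ n ≤ N, ∃ y v, Fre C y h ∧ 5 * D ≤ ‖y‖ ∧ ‖y - v‖ ≤ δ ∧ S n v := by
  obtain ⟨t, -, htf, hcov⟩ := (isCompact_closedBall (0:E3) (5 * D + 1)).finite_cover_balls hδ
  have : Fintype t := htf.fintype
  refine ⟨Fintype.card t, fun C hC x hx hxn S hS hS0 => ?_⟩
  have near : ∀ a : E3, ‖a‖ ≤ 5 * D + 1 → ∃ u : t, ‖a - u‖ ≤ δ := by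
    intro a ha
    have := hcov (by simpa using ha : a ∈ closedBall (0:E3) (5*D+1))
    simp only [mem_iUnion, mem_ball, dist_eq_norm] at this
    obtain ⟨u, hu, hd⟩ := this
    exact ⟨⟨u, hu⟩, hd.le⟩
  let G : SimpleGraph t :=
    { Adj := fun u v => u ≠ v ∧ StepU C h δ u v
      symm := ⟨fun u v H => ⟨H.1.symm, H.2.symm⟩⟩
      loopless := ⟨fun u H => H.1 rfl⟩ }
  have hEσ : 0 < E * σ := by positivity
  have hhσ : h ≤ σ / 2 := by rw [hh]; apply div_le_self <;> linarith
  have hz : Fre C (-(5 * D) • eb 2) h := by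
    constructor
    · have : (-(5 * D) • eb 2) 2 = -(5 * D) := by simp [eb]
      rw [this]; nlinarith
    · intro y hy hyC
      have h1 := (hC.1.2.2.2.2.1 hyC).1
      have h2 := norm_sub_norm_le (-(5 * D) • eb 2) y
      rw [norm_smul, eb_norm, norm_neg, Real.norm_of_nonneg (by linarith), norm_sub_rev] at h2
      nlinarith
  have hzn : ‖-(5 * D) • eb 2‖ = 5 * D := by
    rw [norm_smul, eb_norm, norm_neg, Real.norm_of_nonneg (by linarith), mul_one]
  have key : ∀ a, Relation.ReflTransGen (StepR C h δ) a (-(5 * D) • eb 2) → Fre C a h → ‖a‖ ≤ 5 * D + 1 →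
      ∀ u : t, ‖a - u‖ ≤ δ → ∃ y, ∃ v : t, Fre C y h ∧ 5 * D ≤ ‖y‖ ∧ ‖y - v‖ ≤ δ ∧ G.Reachable u v := by
    intro a H
    induction H using Relation.ReflTransGen.head_induction_on with
    | refl => intro h1 h2 u hu; exact ⟨_, u, hz, hzn.ge, hu, SimpleGraph.Reachable.refl _⟩
    | @head a b hab _ ih =>
      intro h1 h2 u hu
      by_cases hcase : 5 * D ≤ ‖a‖
      · exact ⟨a, u, h1, hcase, hu, SimpleGraph.Reachable.refl _⟩
      · push Not at hcase
        have hbn : ‖b‖ ≤ 5 * D + 1 := by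
          have := norm_sub_norm_le b a
          linarith [hab.2.2]
        obtain ⟨u', hu'⟩ := near b hbn
        obtain ⟨y, v, g1, g2, g3, g4⟩ := ih hab.2.1 hbn u' hu'
        refine ⟨y, v, g1, g2, g3, ?_⟩
        by_cases e : u = u'
        · rwa [e]
        · have : G.Adj u u' := ⟨e, a, b, hab.1, hab.2.1, hab.2.2, hu, hu'⟩
          exact this.reachable.trans g4
  obtain ⟨u, hu⟩ := near x hxn
  obtain ⟨y, v, g1, g2, g3, g4⟩ := key x (conn hE hδ hC hσ hσr hσD hh hx hz) hx hxn u hu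
  obtain ⟨p, hp⟩ := g4.exists_isPath
  have hwalk : ∀ (u v : t) (p : G.Walk u v) (n : ℕ), S n u → S (n + p.length) v := by
    intro u v p
    induction p with
    | nil => intro n hn; simpa using hn
    | cons hadj p ih =>
      intro n hn
      have := ih (n+1) (hS n _ _ hadj.2 hn)
      rw [SimpleGraph.Walk.length_cons]
      rwa [show n + (p.length + 1) = n + 1 + p.length by ring]
  refine ⟨p.length, hp.length_lt.le, y, v, g1, g2, g3, ?_⟩
  simpa using hwalk u v p 0 (hS0 u hu)

lemma vol_ball (x : E3) {R : ℝ} (hR : 0 ≤ R) : R^3 ≤ volume.real (ball x R) := by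
  rw [Measure.real, EuclideanSpace.volume_ball_fin_three, ENNReal.toReal_mul, ENNReal.toReal_pow,
    ENNReal.toReal_ofReal hR, ENNReal.toReal_ofReal (by positivity)]
  have := Real.pi_gt_three
  have : 0 ≤ R^3 := by positivity
  nlinarith

/-- the last phase: smallness far away contradicts the finite energy -/
lemma endphase {C : Set E3} {f : E3 → ℝ} {c K D h : ℝ} (F : FD (Om C) f c K) (hneg : C ⊆ negBall (2 * D))
    (hD : 1 < D) (hh : 0 < h) (hh1 : h ≤ 1) {M a : ℝ} (hM : 0 < M) (ha : 0 < a)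
    (hbd : ∀ x ρ, h / 4 ≤ ρ → ball x ρ ⊆ Om C → ∀ y ∈ closedBall x (ρ / 2), |f y| ≤ M)
    {y : E3} (hy : 5 * D ≤ ‖y‖) (hyf : Fre C y h) {n N : ℕ} {T : ℝ} (hT : 0 < T)
    (hTK : K < c^2 / 4 * (T / (4 * LL))^3) (hN : h / 2 + T ≤ h / 2 * (1 + (1/2) / (4 * LL))^N)
    (h0 : Sm f M a n y (h / (8 * LL))) : ¬ 4 * M * a ^ ((1/2 : ℝ)^(n + N)) ≤ c / 2 := by
  have hL := LL_ge
  have hL0 : 0 < LL := by linarith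
  intro hsmall
  have hy2 : y 2 + h ≤ 0 := hyf.1
  have hfree : ∀ t ∈ Icc 0 T, Fre C (y - t • eb 2) (1 / 2 * (h / 2 + t)) := by
    intro t ht
    have ht0 : 0 ≤ t := ht.1
    constructor
    · have e : (y - t • eb 2) 2 = y 2 - t := by simp [eb]
      rw [e]; linarith
    · intro z hz hzC
      have h1 := (hneg hzC).1
      have h2 := norm_sub_norm_le (y - t • eb 2) z
      rw [norm_sub_rev _ z] at h2
      have h3 : ‖y - t • eb 2‖^2 = ‖y‖^2 - 2 * t * y 2 + t^2 := by
        rw [EuclideanSpace.norm_sq_eq, EuclideanSpace.norm_sq_eq]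
        simp [Fin.sum_univ_three, eb]
        ring
      have h4 : ‖y - t • eb 2‖ ≤ 3 * D + t / 2 := by linarith
      have h5 : ‖y - t • eb 2‖^2 ≤ (3 * D + t/2)^2 := by gcongr
      have h6 : (5 * D)^2 ≤ ‖y‖^2 := by gcongr
      have h7 : 0 ≤ t * (-y 2) := mul_nonneg ht0 (by linarith)
      nlinarith [sq_nonneg (t - 2 * D)]
  have hS := log_phase F.op F.rep hM ha (κ := 1/2) (s := h/2) (T := T) (by norm_num) (by norm_num)
    (by linarith) hT.le (γ := fun t => y - t • eb 2) (by
      intro t _ t' _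
      rw [dist_eq_norm, sub_sub_sub_cancel_left, ← sub_smul, norm_smul, eb_norm, mul_one,
        Real.norm_eq_abs, abs_sub_comm])
    (fun t ht => (hfree t ht).sub) (fun t ht => hbd _ _ (by nlinarith [ht.1]) (hfree t ht).sub)
    (n := n) (by
      simp only [zero_smul, sub_zero]
      apply h0.mono
      rw [dist_self, add_zero]
      apply le_of_eq; field_simp; ring) N hN
  set R := T / (4 * LL) with hR
  have hR0 : 0 < R := by positivity
  set z := y - T • eb 2 with hz
  have hsub : ball z R ⊆ Om C := by
    refine Subset.trans (ball_subset_ball ?_) (hfree T ⟨hT.le, le_rfl⟩).sub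
    rw [hR, div_le_iff₀ (by positivity)]
    nlinarith
  have hlow : ∀ x ∈ ball z R, c^2 / 4 ≤ (f x + c)^2 := by
    intro x hx
    have h1 := hS x (by
      refine closedBall_subset_closedBall ?_ (ball_subset_closedBall hx)
      rw [hR, div_le_div_iff₀ (by positivity) (by positivity)]
      nlinarith)
    have h2 := (abs_le.1 (h1.trans hsmall)).1
    have := F.c0
    nlinarith
  have h1 : c^2 / 4 * volume.real (ball z R) ≤ ∫ x in ball z R, (f x + c)^2 := by
    have := setIntegral_mono_on (f := fun _ => c^2/4) (g := fun x => (f x + c)^2) (s := ball z R)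
      (μ := volume) (integrableOn_const (measure_ball_lt_top.ne))
      (F.int.mono_set hsub) measurableSet_ball hlow
    rw [setIntegral_const, smul_eq_mul, mul_comm] at this
    exact this
  have h2 : ∫ x in ball z R, (f x + c)^2 ≤ K :=
    (setIntegral_mono_set F.int (Eventually.of_forall fun _ => sq_nonneg _)
      hsub.eventuallyLE).trans F.le
  have h3 := vol_ball z hR0.le
  have h4 : c^2 / 4 * R^3 ≤ c^2 / 4 * volume.real (ball z R) := by gcongr
  linarith

end


open MeasureTheory Metric Set
noncomputable section
open scoped ContDiff Topology
open Filter

set_option maxHeartbeats 2000000 in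
lemma lower {r E D c K : ℝ} (hr : 0 < r) (hE : 0 < E) (hD : 1 < D) (hc : 0 < c) (hK : 0 < K) :
    ∃ A : ℝ, ∃ B : ℕ, ∃ τ : ℝ, 0 < A ∧ 0 < B ∧ 0 < τ ∧ 8 * τ ≤ r ∧ τ ≤ 1 ∧
    ∀ C f, IsC3Cavity r E D C → FD (Om C) f c K → ∀ x s, 0 < s → s ≤ τ → x 2 ≤ -D → ‖x‖ ≤ 2 * D →
    (∀ y, ‖y - x‖ < s → y ∉ C) →
    Real.exp (-(A * (s⁻¹)^B)) < ∫ y in closedBall x (s/2), (f y)^2 := by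
  have hL := LL_ge
  have hL0 : 0 < LL := by linarith
  obtain ⟨m, hm0, hmr, hmD, hm1⟩ : ∃ m : ℝ, 0 < m ∧ m ≤ r ∧ m ≤ D ∧ m ≤ 1 :=
    ⟨min (min r D) 1, by positivity, (min_le_left _ _).trans (min_le_left _ _),
      (min_le_left _ _).trans (min_le_right _ _), min_le_right _ _⟩
  set κ := 1 / (2 * (1 + E)) with hκ
  have hκ0 : 0 < κ := by positivity
  have hκ1 : κ ≤ 1/2 := by apply one_div_le_one_div_of_le <;> linarith
  set τ := m / 8 with hτ
  have hτ0 : 0 < τ := by positivity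
  set σ := m / (30 * (1 + E)) with hσ
  have hσ0 : 0 < σ := by positivity
  have hσm : 30 * (1 + E) * σ = m := by rw [hσ]; field_simp
  set h := σ / 2 / (1 + E) with hh
  have hh0 : 0 < h := by positivity
  have hhκ : h = κ * σ := by rw [hh, hκ]; field_simp
  have hστ : 3 * σ ≤ τ := by
    rw [hσ, hτ, ← mul_div_assoc, div_le_div_iff₀ (by positivity) (by norm_num)]
    nlinarith [mul_pos hm0 hE]
  have hσ1 : σ ≤ 1 := by linarith
  have hh1 : h ≤ 1 := by rw [hhκ]; nlinarith
  have hh3 : 3 * h ≤ κ * τ := by rw [hhκ]; nlinarith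
  have hhκ' : h ≤ κ := by rw [hhκ]; nlinarith
  set δ := h / (16 * LL) with hδ
  have hδ0 : 0 < δ := by positivity
  have hδh : 16 * LL * δ = h := by rw [hδ]; field_simp
  have hδ1 : δ ≤ 1 := by nlinarith [mul_le_mul_of_nonneg_right hL hδ0.le]
  have hδ2 : δ ≤ h / 64 := by linarith [mul_le_mul_of_nonneg_right hL hδ0.le]
  obtain ⟨NF, hNF⟩ := net_phase (r := r) (D := D) (h := h) hE hδ0 hδ1 hD hσ0 (by linarith) (by linarith) hh
  obtain ⟨Ba, hBa0, hBa⟩ := log_count (q := κ / (4 * LL)) (by positivity)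
  -- the final distance
  obtain ⟨T, hT0, hTK⟩ : ∃ T : ℝ, 0 < T ∧ K < c^2 / 4 * (T / (4 * LL))^3 := by
    refine ⟨(4 * LL) * (1 + 4 * K / c^2), by positivity, ?_⟩
    rw [mul_div_cancel_left₀ _ (by positivity)]
    have h1 : 1 + 4 * K / c^2 ≤ (1 + 4 * K / c^2)^3 :=
      le_self_pow₀ (by have : 0 ≤ 4 * K / c^2 := by positivity
                       linarith) (by norm_num)
    have h2 : c^2 / 4 * (1 + 4 * K / c^2) = c^2 / 4 + K := by field_simp
    have h3 : c^2 / 4 * (1 + 4 * K / c^2) ≤ c^2/4 * (1 + 4 * K / c^2)^3 := by gcongr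
    have : 0 < c^2 / 4 := by positivity
    linarith
  obtain ⟨Nb, hNb⟩ : ∃ N : ℕ, h / 2 + T ≤ h / 2 * (1 + (1/2) / (4 * LL))^N := by
    obtain ⟨N, hN⟩ := pow_unbounded_of_one_lt ((h / 2 + T) / (h / 2))
      (show 1 < 1 + (1/2) / (4 * LL) by have : 0 < (1/2) / (4 * LL) := by positivity
                                        linarith)
    refine ⟨N, ?_⟩
    rw [div_lt_iff₀ (by positivity), mul_comm] at hN
    exact hN.le
  have hAK := AK_pos
  set M1 := c + AK * (16 / h)^3 * (1 + √K) with hM1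
  have hM10 : 0 < M1 := by positivity
  set P : ℝ := 2^(Ba + NF + Nb) with hP
  have hP0 : 0 < P := by positivity
  refine ⟨2 * P * (8 * M1 / c), Ba + 3, τ, by positivity, by omega, hτ0, by linarith, by linarith, ?_⟩
  intro C f hC F x s hs hsτ hx2 hxn hfr
  by_contra hcon
  push Not at hcon
  set A := 2 * P * (8 * M1 / c) with hA
  set ε := Real.exp (-(A * (s⁻¹)^(Ba+3))) with hε
  have hs1 : s ≤ 1 := by linarith
  have hsi : 1 ≤ s⁻¹ := (one_le_inv₀ hs).2 hs1
  have hs3 : 1 ≤ (s⁻¹)^3 := one_le_pow₀ hsi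
  set M := MM c K (s * (h / 4)) with hM
  have hMe : M = c + AK * (16 / h)^3 * (1 + √K) * (s⁻¹)^3 := by
    rw [hM, MM]; field_simp; ring
  have hMM1 : M ≤ M1 * (s⁻¹)^3 := by rw [hMe, hM1]; linarith [mul_le_mul_of_nonneg_left hs3 hc.le]
  have hM0 : 0 < M := by rw [hMe]; positivity
  have hsh : s * h ≤ h := mul_le_of_le_one_left hh0.le hs1
  have hm' : 0 < s * (h / 4) := by positivity
  have hbd : ∀ x ρ, s * (h / 4) ≤ ρ → ball x ρ ⊆ Om C → ∀ y ∈ closedBall x (ρ / 2), |f y| ≤ M :=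
    fun x ρ h1 h2 y hy => F.bd hm' (by linarith) h1 h2 hy
  have hbd4 : ∀ x ρ, h / 4 ≤ ρ → ball x ρ ⊆ Om C → ∀ y ∈ closedBall x (ρ / 2), |f y| ≤ M :=
    fun x ρ h1 h2 y hy => hbd x ρ (by linarith) h2 y hy
  have hε0 : 0 < ε := Real.exp_pos _
  set a := √ε with ha
  have ha0 : 0 < a := Real.sqrt_pos.2 hε0
  have hxF : Fre C x s := ⟨by linarith, hfr⟩
  -- initial smallness
  have hAM : AK * ((s/4)⁻¹)^3 ≤ M := by
    have e : AK * ((s/4)⁻¹)^3 = AK * 4^3 * (s⁻¹)^3 := by field_simp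
    have h1 : (4:ℝ)^3 ≤ (16 / h)^3 := by
      gcongr; rw [le_div_iff₀ hh0]; linarith
    have h2 : AK * 4^3 * (s⁻¹)^3 ≤ AK * (16/h)^3 * (s⁻¹)^3 := by gcongr
    have h3 : AK * (16/h)^3 * (s⁻¹)^3 * 1 ≤ AK * (16/h)^3 * (s⁻¹)^3 * (1 + √K) := by
      gcongr; linarith [Real.sqrt_nonneg K]
    rw [e, hMe]
    linarith
  have hS0 : Sm f M a 0 x (κ * s / (2 * LL)) := by
    intro y hy
    have hr1 : κ * s / (2 * LL) ≤ s / 4 := by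
      rw [div_le_div_iff₀ (by positivity) (by norm_num)]
      linarith [mul_le_mul_of_nonneg_right hκ1 hs.le, mul_le_mul_of_nonneg_right hL hs.le]
    have hsub : closedBall y (s/4) ⊆ closedBall x (s/2) := by
      apply closedBall_subset_closedBall'
      rw [mem_closedBall] at hy
      linarith
    have hsub2 : closedBall x (s/2) ⊆ Om C := (closedBall_subset_ball (by linarith)).trans hxF.sub
    have h1 := sup_est F.rep (by positivity : 0 < s/4) (by linarith) (hsub.trans hsub2) hε0
      ((setIntegral_mono_set (((F.rep.1.mono hsub2).pow 2).integrableOn_compact (isCompact_closedBall x (s/2)))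
        (Eventually.of_forall fun _ => sq_nonneg _) hsub.eventuallyLE).trans hcon)
    rw [pow_zero, Real.rpow_one]
    have h2 : AK * ((s/4)⁻¹)^3 * √ε ≤ M * a := by gcongr
    have : 0 < M * a := by positivity
    linarith
  -- first phase
  obtain ⟨γ, hγ0, hγl, hγf⟩ := curve hE hC hx2 hs hsτ (by linarith) (by linarith) hfr
  rw [← hκ] at hγf
  obtain ⟨Na, hNa, hNa2⟩ := hBa ((s + τ) / s) (by rw [le_div_iff₀ hs]; linarith)
  rw [div_le_iff₀ hs, mul_comm] at hNa
  have h1 := log_phase F.op F.rep hM0 ha0 hκ0 (by linarith) hs hτ0.le (fun t _ t' _ => hγl t t')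
    (fun t ht => (hγf t ht).sub)
    (fun t ht => hbd _ _ (by
      have := ht.1
      linarith [mul_pos hs hh0, mul_nonneg hκ0.le this, mul_le_mul_of_nonneg_right hhκ' hs.le]) (hγf t ht).sub)
    (by rw [hγ0]; exact hS0) Na hNa
  rw [zero_add] at h1
  have hmemτ : τ ∈ Icc 0 τ := ⟨hτ0.le, le_rfl⟩
  have hFτ : Fre C (γ τ) h := (hγf τ hmemτ).mono (by
    rw [sub_self, norm_zero]; linarith [mul_pos hκ0 hs])
  have hrad : 5 * δ ≤ κ * (s + τ) / (2 * LL) := by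
    rw [le_div_iff₀ (by positivity)]
    linarith [mul_pos hκ0 hs]
  have hnτ : ‖γ τ‖ ≤ 5 * D + 1 := by
    have h2 := hγl τ 0
    rw [hγ0, sub_zero, abs_of_pos hτ0, dist_eq_norm] at h2
    have := norm_sub_norm_le (γ τ) x
    linarith
  -- second phase
  obtain ⟨n, hn, y, v, hyF, hyD, hyv, hSv⟩ := hNF C hC (γ τ) hFτ hnτ
    (fun n u => Sm f M a (Na + n) u (4 * δ)) (by
      rintro n u v ⟨p, q, hp, hq, hpq, hpu, hqv⟩ hS
      have h2 : Fre C u (h/2) := hp.mono (by rw [norm_sub_rev]; linarith)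
      have h3 := hS.step F.op F.rep hM0 ha0 (by positivity) (ρ := h/2)
        (by linarith) (by positivity) h2.sub (hbd4 _ _ (by linarith) h2.sub)
      rw [← add_assoc]
      apply h3.mono
      have h4 := dist_triangle4 v q p u
      rw [dist_eq_norm q p, dist_eq_norm p u, dist_comm v q, dist_eq_norm q v] at h4
      linarith) (by
      intro u hu
      apply h1.mono
      rw [dist_comm, dist_eq_norm]
      linarith)
  have hSy : Sm f M a (Na + n) y (h / (8 * LL)) := by
    apply hSv.mono
    have : h / (8 * LL) = 2 * δ := by rw [hδ]; field_simp; ring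
    rw [this, dist_eq_norm]
    linarith
  refine endphase F hC.1.2.2.2.2.1 hD hh0 hh1 hM0 ha0 hbd4 hyD hyF hT0 hTK hNb hSy ?_
  -- the quantitative part
  set N := Na + n + Nb with hN
  have hX : (1 + κ / (4 * LL)) * ((s + τ) / s) ≤ 2 * s⁻¹ := by
    have e1 : κ / (4 * LL) ≤ 1 := by rw [div_le_one (by positivity)]; linarith
    have e2 : (s + τ) / s ≤ s⁻¹ := by
      rw [div_eq_mul_inv]
      exact mul_le_of_le_one_left (by positivity) (by linarith)
    have e3 : 0 < s⁻¹ := by positivity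
    have e4 : 0 ≤ (s + τ) / s := by positivity
    linarith [mul_le_mul_of_nonneg_right e1 e4]
  have h2N : (2:ℝ)^N ≤ P * (s⁻¹)^Ba := by
    have e1 : (2:ℝ)^Na ≤ (2 * s⁻¹)^Ba := hNa2.trans (by gcongr)
    have e2 : (2:ℝ)^n ≤ 2^NF := pow_le_pow_right₀ (by norm_num) hn
    rw [hN, pow_add, pow_add, hP, pow_add, pow_add]
    calc (2:ℝ)^Na * 2^n * 2^Nb ≤ (2 * s⁻¹)^Ba * 2^NF * 2^Nb := by gcongr
      _ = 2^Ba * 2^NF * 2^Nb * (s⁻¹)^Ba := by rw [mul_pow]; ring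
  have hae : a ^ ((1/2 : ℝ)^N) = Real.exp (-(A / 2 * (s⁻¹)^(Ba+3) * (1/2)^N)) := by
    have : a = Real.exp (-(A * (s⁻¹)^(Ba+3)) / 2) := by rw [ha, hε, Real.exp_half]
    rw [this, ← Real.exp_mul]
    congr 1
    ring
  have hexp : 8 * M / c ≤ A / 2 * (s⁻¹)^(Ba+3) * (1/2)^N := by
    have e1 : (1:ℝ) ≤ P * (s⁻¹)^Ba * (1/2)^N := by
      have : (2:ℝ)^N * (1/2)^N = 1 := by rw [← mul_pow]; norm_num
      refine this.symm.le.trans ?_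
      gcongr
    have e2 : A / 2 * (s⁻¹)^(Ba+3) * (1/2)^N = (8 * (M1 * (s⁻¹)^3) / c) * (P * (s⁻¹)^Ba * (1/2)^N) := by
      rw [hA, pow_add]; ring
    rw [e2]
    have e3 : 8 * M / c ≤ 8 * (M1 * (s⁻¹)^3) / c := by gcongr
    have e4 : 0 ≤ 8 * (M1 * (s⁻¹)^3) / c := by positivity
    exact e3.trans (le_mul_of_one_le_right e4 e1)
  rw [hae]
  have hfin : Real.exp (-(A / 2 * (s⁻¹)^(Ba+3) * (1/2)^N)) ≤ (8 * M / c)⁻¹ := by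
    rw [Real.exp_neg]
    apply inv_anti₀ (by positivity)
    exact hexp.trans ((by linarith : A / 2 * (s⁻¹)^(Ba+3) * (1/2)^N ≤ A / 2 * (s⁻¹)^(Ba+3) * (1/2)^N + 1).trans
      (Real.add_one_le_exp _))
  calc 4 * M * Real.exp (-(A / 2 * (s⁻¹)^(Ba+3) * (1/2)^N)) ≤ 4 * M * (8 * M / c)⁻¹ := by gcongr
    _ = c / 2 := by field_simp; ring

end


open MeasureTheory Metric Set
noncomputable section
open scoped ContDiff Topology
open Filter

lemma strain_diff {lam mu p : ℝ} {C : Set E3} {w : E3 → E3} (hw : IsNormalizedSolution lam mu p C w)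
    {x : E3} (hx : x ∈ Om C) : DifferentiableAt ℝ w x :=
  (hw.2.1.differentiableOn (by norm_num)).differentiableAt ((Om_open C).mem_nhds hx)

lemma strain_int {lam mu p : ℝ} (hmu : 0 < mu) (hlam : 0 < 3 * lam + 2 * mu) {C : Set E3}
    {w : E3 → E3} (hw : IsNormalizedSolution lam mu p C w) {S : Set E3} (hS : S ⊆ Om C)
    (hSm : MeasurableSet S) (hSf : volume S < ⊤) :
    IntegrableOn (fun x => frob2 (strain w x)) S := by
  set c := p / (3*lam+2*mu)
  have : IsFiniteMeasure (volume.restrict S) := ⟨by simpa using hSf⟩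
  have hm : ∀ i j, MemLp (pd (uc c w i) j) 2 (volume.restrict S) := fun i j =>
    (uc_pd_mem hmu hlam hw i j).mono_measure (Measure.restrict_mono hS le_rfl)
  have hq : ∀ i j : Fin 3, Integrable (fun x => ((pd (uc c w i) j x + pd (uc c w j) i x) * (1/2)
      - c * (if i = j then 1 else 0))^2) (volume.restrict S) := by
    intro i j
    have h1 : MemLp (fun x => (pd (uc c w i) j x + pd (uc c w j) i x) * (1/2)
      - c * (if i = j then 1 else 0)) 2 (volume.restrict S) :=
      ((((hm i j).add (hm j i)).mul_const (1/2))).sub (memLp_const _)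
    exact h1.integrable_sq
  have hsum := integrable_finsetSum Finset.univ fun i _ =>
    integrable_finsetSum (f := fun j x => ((pd (uc c w i) j x + pd (uc c w j) i x) * (1/2)
      - c * (if i = j then 1 else 0))^2) Finset.univ fun j _ => hq i j
  refine IntegrableOn.congr_fun hsum ?_ hSm
  intro x hx
  simp only [frob2]
  refine Finset.sum_congr rfl fun i _ => Finset.sum_congr rfl fun j _ => ?_
  have hd := strain_diff hw (hS hx)
  rw [strain, wc_jac hd, wc_jac hd, uc_pd hw c (hS hx), uc_pd hw c (hS hx)]
  congr 1
  by_cases e : i = j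
  · simp [e]; ring
  · simp [e, Ne.symm e]; ring

lemma ff_le {lam mu p : ℝ} (hp : 0 < p) {C : Set E3} {w : E3 → E3}
    (hw : IsNormalizedSolution lam mu p C w) {x : E3} (hx : x ∈ Om C) :
    p^2 * (ff p w x)^2 ≤ frob2 (strain w x) := by
  have h1 : p^2 * (ff p w x)^2 = (strain w x 0 0)^2 := by
    rw [strain, wc_jac (strain_diff hw hx), ff]
    field_simp
    ring
  rw [h1, frob2]
  have a := Finset.single_le_sum (f := fun i => ∑ j, (strain w x i j)^2) (fun _ _ => by positivity)
    (Finset.mem_univ 0)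
  have b := Finset.single_le_sum (f := fun j => (strain w x 0 j)^2) (fun _ _ => by positivity)
    (Finset.mem_univ 0)
  exact b.trans a

lemma core {r E lam mu D : ℝ} (hr : 0 < r) (hE : 0 < E)
    (hmu : 0 < mu) (hlam : 0 < 3 * lam + 2 * mu) (hD : 1 < D) :
    ∃ A : ℝ, ∃ B : ℕ, ∃ τ : ℝ, 0 < A ∧ 0 < B ∧ 0 < τ ∧ 8 * τ ≤ r ∧ τ ≤ 1 ∧
    ∀ C C' : Set E3, IsC3Cavity r E D C → IsC3Cavity r E D C' → ∀ p : ℝ, 0 < p → ∀ w : E3 → E3,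
    IsNormalizedSolution lam mu p C w → ∀ η, (∫ x in C' \ closure C, frob2 (strain w x)) ≤ η →
    ∀ y s, 0 < s → s ≤ τ → (∀ z, ‖z - y‖ < s → z ∈ C' ∧ z ∉ C) →
    p^2 * Real.exp (-(A * (s⁻¹)^B)) < η := by
  obtain ⟨K, hK, hen⟩ := energy hr hE hmu hlam (by linarith : 0 < D)
  obtain ⟨A, B, τ, hA, hB, hτ, hτr, hτ1, H⟩ := lower (c := 1 / (3*lam+2*mu)) hr hE hD (by positivity) hK
  refine ⟨A, B, τ, hA, hB, hτ, hτr, hτ1, ?_⟩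
  intro C C' hC hC' p hp w hw η hη y s hs hsτ hz
  obtain ⟨hi, hle⟩ := hen C p w hp hC hw
  have F : FD (Om C) (ff p w) (1 / (3*lam+2*mu)) K :=
    ⟨Om_open C, ff_rep hmu hlam hw, hi, hle, by positivity, hK⟩
  have hyC : y ∈ C' := (hz y (by simpa using hs)).1
  obtain ⟨hop', hbd', hcl', _, hneg', hlow', _⟩ := hC'.1
  have h1 := H C _ hC F y s hs hsτ (hlow' y hyC) (hneg' hyC).1.le (fun z h => (hz z h).2)
  have hS : C' \ closure C ⊆ Om C := fun x hx => ⟨(hneg' hx.1).2, hx.2⟩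
  have hSm : MeasurableSet (C' \ closure C) := hop'.measurableSet.diff isClosed_closure.measurableSet
  have hsub : closedBall y (s/2) ⊆ C' \ closure C := by
    intro x hx
    rw [mem_closedBall, dist_eq_norm] at hx
    have hx' : ‖x - y‖ < s := by linarith
    exact ⟨(hz x hx').1, ball_notMem_cl (fun z h => (hz z h).2) hx'⟩
  have hint := strain_int hmu hlam hw hS hSm ((hbd'.subset diff_subset).measure_lt_top)
  have h2 : ∫ x in closedBall y (s/2), p^2 * (ff p w x)^2 ≤ ∫ x in closedBall y (s/2), frob2 (strain w x) := by
    apply setIntegral_mono_on _ (hint.mono_set hsub) measurableSet_closedBall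
      (fun x hx => ff_le hp hw (hS (hsub hx)))
    exact (continuousOn_const.mul ((F.rep.1.mono (hsub.trans hS)).pow 2)).integrableOn_compact
      (isCompact_closedBall y (s/2))
  have h3 : ∫ x in closedBall y (s/2), frob2 (strain w x) ≤ ∫ x in C' \ closure C, frob2 (strain w x) :=
    setIntegral_mono_set hint (Eventually.of_forall fun x => by
      show 0 ≤ frob2 (strain w x)
      unfold frob2; positivity) hsub.eventuallyLE
  rw [integral_const_mul] at h2
  have h4 := mul_lt_mul_of_pos_left h1 (by positivity : 0 < p^2)
  linarith

/-- two-sided geometric alternative -/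
lemma geom {r E D τ θ s d : ℝ} (hr : 0 < r) (hE : 0 < E)
    {C₁ C₂ : Set E3} (h1 : IsC3Cavity r E D C₁) {P : E3} (hP : P ∈ frontier C₁)
    (hτr : 8 * τ ≤ r) (hθ : 0 < θ) (hθτ : θ ≤ τ) (hθd : 2 * θ ≤ d) (hs : s = θ / (2 * (1 + E)))
    (hd : ∀ z, ‖z - P‖ < d → z ∉ frontier C₂) :
    (∃ y, ∀ z, ‖z - y‖ < s → z ∈ C₁ ∧ z ∉ C₂) ∨ (∃ y, ∀ z, ‖z - y‖ < s → z ∈ C₂ ∧ z ∉ C₁) := by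
  obtain ⟨φ, ψ, c⟩ := chart_exists h1.2 hP
  have hPC : P ∉ C₁ := by
    have := hP.2
    rwa [h1.1.1.interior_eq] at this
  have hs2 : s * (1 + E) = θ / 2 := by rw [hs]; field_simp
  have hsθ : s ≤ θ / 2 := by
    have : 0 < s := by rw [hs]; positivity
    nlinarith
  have hlt : ∀ z t, ‖z - mv φ t P‖ < s → |t| = θ → ‖z - P‖ < 2 * θ := by
    intro z t hz ht
    have := norm_sub_le_norm_sub_add_norm_sub z (mv φ t P) P
    rw [mv_dist0] at this
    linarith
  by_cases hcase : ∃ z, ‖z - P‖ < d ∧ z ∈ C₂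
  · right
    refine ⟨mv φ (-θ) P, fun z hz => ?_⟩
    have hzl := hlt z (-θ) hz (by rw [abs_neg, abs_of_pos hθ])
    constructor
    · by_contra hzC
      obtain ⟨q, hq, hqC⟩ := hcase
      obtain ⟨Q, hQ1, hQ2⟩ := pre_frontier (convex_ball P d).isPreconnected
        ⟨q, by rwa [mem_ball, dist_eq_norm], hqC⟩ ⟨z, by rw [mem_ball, dist_eq_norm]; linarith, hzC⟩
      rw [mem_ball, dist_eq_norm] at hQ1
      exact hd Q hQ1 hQ2
    · apply c.down hE hPC (by simpa using hr) (t := θ) _ (by linarith)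
      have : ‖z - mv φ (-θ) P‖ * (1 + E) ≤ s * (1 + E) := by gcongr
      linarith
  · left
    push Not at hcase
    refine ⟨mv φ θ P, fun z hz => ?_⟩
    have hzl := hlt z θ hz (abs_of_pos hθ)
    refine ⟨?_, hcase z (by linarith)⟩
    apply c.up hE hr (t := θ) _ (by linarith)
    have : ‖z - mv φ θ P‖ * (1 + E) ≤ s * (1 + E) := by gcongr
    linarith

lemma root_est {A L s : ℝ} {B : ℕ} (hB : 0 < B) (hA : 0 < A) (hL : 0 < L) (hs : 0 < s)
    (h : L ≤ A * (s⁻¹)^B) : s ≤ A ^ (1 / (B:ℝ)) * L ^ (-(1 / (B:ℝ))) := by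
  have h1 : s^B ≤ A * L⁻¹ := by
    rw [inv_pow, ← div_eq_mul_inv, le_div_iff₀ (by positivity)] at h
    rw [← div_eq_mul_inv, le_div_iff₀ hL]
    linarith
  have hB' : (B:ℝ) ≠ 0 := by exact_mod_cast hB.ne'
  calc s = (s^B) ^ (1 / (B:ℝ)) := by
        rw [← Real.rpow_natCast, ← Real.rpow_mul hs.le, mul_one_div_cancel hB', Real.rpow_one]
    _ ≤ (A * L⁻¹) ^ (1 / (B:ℝ)) := Real.rpow_le_rpow (by positivity) h1 (by positivity)
    _ = A ^ (1 / (B:ℝ)) * L ^ (-(1 / (B:ℝ))) := by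
        rw [Real.mul_rpow hA.le (by positivity), Real.inv_rpow hL.le, Real.rpow_neg hL.le]

theorem hausdorff_distance_from_energy_smallness (lam mu r₀ E₀ D₀ : ℝ)
    (hmu : 0 < mu) (hlam : 0 < 3*lam + 2*mu) (hr₀ : 0 < r₀) (hE₀ : 0 < E₀) (hD₀ : 1 < D₀) :
    ∃ b c₁ c₂ : ℝ, 0 < b ∧ 0 < c₁ ∧ 0 < c₂ ∧
      ∀ C₁ C₂ : Set E3, IsC3Cavity r₀ E₀ D₀ C₁ → IsC3Cavity r₀ E₀ D₀ C₂ →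
      ∀ p : ℝ, 0 < p → ∀ w₁ w₂ : E3 → E3,
      IsNormalizedSolution lam mu p C₁ w₁ → IsNormalizedSolution lam mu p C₂ w₂ →
      ∀ η : ℝ, 0 < η → η < c₁ * p^2 →
      (∫ x in C₂ \ closure C₁, frob2 (strain w₁ x)) ≤ η →
      (∫ x in C₁ \ closure C₂, frob2 (strain w₂ x)) ≤ η →
      Metric.hausdorffDist (frontier C₁) (frontier C₂) ≤
        c₂ * (Real.log (c₁ * p^2 / η)) ^ (-(1/b)) := by
  obtain ⟨A, B, τ, hA, hB, hτ, hτr, hτ1, H⟩ := core hr₀ hE₀ hmu hlam hD₀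
  set q := τ / (4 * D₀) with hq
  have hq0 : 0 < q := by positivity
  set k := q / (2 * (1 + E₀)) with hk
  have hk0 : 0 < k := by positivity
  refine ⟨B, 1, k⁻¹ * A ^ (1 / (B:ℝ)), by exact_mod_cast hB, one_pos, by positivity, ?_⟩
  -- one sided estimate
  have side : ∀ C₁ C₂ : Set E3, IsC3Cavity r₀ E₀ D₀ C₁ → IsC3Cavity r₀ E₀ D₀ C₂ →
      ∀ p : ℝ, 0 < p → ∀ w₁ w₂ : E3 → E3,
      IsNormalizedSolution lam mu p C₁ w₁ → IsNormalizedSolution lam mu p C₂ w₂ →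
      ∀ η : ℝ, 0 < η → η < 1 * p^2 →
      (∫ x in C₂ \ closure C₁, frob2 (strain w₁ x)) ≤ η →
      (∫ x in C₁ \ closure C₂, frob2 (strain w₂ x)) ≤ η →
      ∀ P ∈ frontier C₁, infDist P (frontier C₂) ≤
        k⁻¹ * A ^ (1 / (B:ℝ)) * (Real.log (1 * p^2 / η)) ^ (-(1/(B:ℝ))) := by
    intro C₁ C₂ hC₁ hC₂ p hp w₁ w₂ hw₁ hw₂ η hη hηp hi₁ hi₂ P hP
    have hL : 0 < Real.log (1 * p^2 / η) := Real.log_pos (by rwa [lt_div_iff₀ hη, one_mul])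
    set L := Real.log (1 * p^2 / η) with hLdef
    set d := infDist P (frontier C₂) with hd
    have hd0 : 0 ≤ d := infDist_nonneg
    rcases hd0.eq_or_lt with h0 | h0
    · rw [← h0]; positivity
    have hne : (frontier C₂).Nonempty := by
      by_contra hn
      rw [not_nonempty_iff_eq_empty] at hn
      rw [hd, hn, infDist_empty] at h0
      exact lt_irrefl _ h0
    obtain ⟨Q, hQ⟩ := hne
    have hd4 : d ≤ 4 * D₀ := by
      have h1 := infDist_le_dist_of_mem (x := P) hQ
      rw [dist_eq_norm] at h1
      have h2 := norm_sub_le P Q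
      have h3 := cl_norm hC₁.1.2.2.2.2.1 P hP.1
      have h4 := cl_norm hC₂.1.2.2.2.2.1 Q hQ.1
      linarith
    have hθτ : q * d ≤ τ := by
      rw [hq, div_mul_eq_mul_div, div_le_iff₀ (by positivity)]
      gcongr
    have hq4 : q ≤ 1/4 := by
      rw [hq, div_le_iff₀ (by positivity)]; linarith
    have hθ0 : 0 < q * d := by positivity
    have hsk : k * d = q * d / (2 * (1 + E₀)) := by rw [hk]; ring
    have hks : 0 < k * d := by positivity
    have hkτ : k * d ≤ τ := by
      rw [hsk]
      exact (div_le_self hθ0.le (by linarith)).trans hθτ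
    have hmain : p^2 * Real.exp (-(A * ((k * d)⁻¹)^B)) < η := by
      rcases geom (C₂ := C₂) (d := d) hr₀ hE₀ hC₁ hP hτr hθ0 hθτ (by nlinarith) hsk (by
        intro z hz hzf
        have := infDist_le_dist_of_mem (x := P) hzf
        rw [dist_comm, dist_eq_norm] at this
        linarith) with ⟨y, hy⟩ | ⟨y, hy⟩
      · exact H C₂ C₁ hC₂ hC₁ p hp w₂ hw₂ η hi₂ y _ hks hkτ hy
      · exact H C₁ C₂ hC₁ hC₂ p hp w₁ hw₁ η hi₁ y _ hks hkτ hy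
    have hLe : L ≤ A * ((k * d)⁻¹)^B := by
      rw [hLdef, Real.log_le_iff_le_exp (by positivity), div_le_iff₀ hη, one_mul]
      rw [Real.exp_neg, ← div_eq_mul_inv, div_lt_iff₀ (Real.exp_pos _)] at hmain
      linarith
    have h5 := root_est hB hA hL hks hLe
    rw [mul_assoc, inv_mul_eq_div, le_div_iff₀ hk0]
    linarith
  intro C₁ C₂ hC₁ hC₂ p hp w₁ w₂ hw₁ hw₂ η hη hηp hi₁ hi₂
  have hL : 0 < Real.log (1 * p^2 / η) := Real.log_pos (by rwa [lt_div_iff₀ hη, one_mul])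
  apply hausdorffDist_le_of_infDist
  · positivity
  · exact side C₁ C₂ hC₁ hC₂ p hp w₁ w₂ hw₁ hw₂ η hη hηp hi₁ hi₂
  · exact side C₂ C₁ hC₂ hC₁ p hp w₂ w₁ hw₂ hw₁ η hη hηp hi₂ hi₁

end
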